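/- arXiv:1112.2411 — 2 statements merged into one kernel-verified Lean document; each statement's English description precedes it below -/
import Mathlib

section
/- Let k, m ∈ ℕ with k < m, let C ≥ 1 and ε ∈ (0, (f(2)−1)/f(2)) satisfy: (i) m is divisible by k; (ii) f(m) ≥ C·max( 50/ε² , f(l₀)·f(l₀−1)/(f(l₀)−f(l₀−1)) ), where l₀ = min{ l ∈ ℕ : f(l) ≥ 6 }; (iii) f(m)/f(m/k) ≤ 1 + ε/6. Assume (j_s)_{s=1}^m ⊂ ℕ and vectors (x_s)_{s=1}^m in c₀₀ satisfy e_{j_1} < x_1 < e_{j_2} < x_2 < … < e_{j_m} < x_m and ‖x_s‖_S ≤ C/m for s = 1,…,m. Then: (a) ‖Σ_{s=1}^m ( (f(m)/m)·e_{j_s} + x_s )‖_S ≤ C(1+ε); (b) for each i = 1,…,k, ‖Σ_{s=(i−1)(m/k)+1}^{i·m/k} ( (f(m)/m)·e_{j_s} + x_s )‖_S ≤ C(1+ε)/k; and consequently (c) the vectors y_i = (k/(C(1+ε)))·Σ_{s=(i−1)(m/k)+1}^{i·m/k} ( (f(m)/m)·e_{j_s} + x_s ), i = 1,…,k, lie in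 the unit ball of ‖·‖_S and satisfy ‖Σ_{i=1}^k a_i y_i‖_S ≥ (1/(C(1+ε)))·Σ_{i=1}^k |a_i| for all scalars (a_i). -/
/-- `f(x) = log₂(x+1)`; note `flog 0 = 0`. -/
noncomputable def flog (x : ℝ) : ℝ := Real.logb 2 (x + 1)

/-- The `n`-th largest value (1-indexed) of the sequence `(|x i|)`, i.e. the decreasing
rearrangement of `(|x i|)`. -/
noncomputable def drear (x : ℕ →₀ ℝ) (n : ℕ) : ℝ :=
  sSup {t : ℝ | 0 ≤ t ∧ n ≤ (x.support.filter fun i => t ≤ |x i|).card}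

/-- The norm `‖x‖_g = sup_{n₁ < … < n_l} (1/g(l)) ∑ |x_{n_i}|`. -/
noncomputable def gnorm (g : ℕ → ℝ) (x : ℕ →₀ ℝ) : ℝ :=
  sSup {r : ℝ | ∃ s : Finset ℕ, s.Nonempty ∧ r = (1 / g s.card) * ∑ i ∈ s, |x i|}

/-- The norm `|||x|||_g = ∑_{i ≥ 1} x_i^# / g(i)`. -/
noncomputable def tnorm (g : ℕ → ℝ) (x : ℕ →₀ ℝ) : ℝ :=
  ∑ i ∈ Finset.range x.support.card, drear x (i + 1) / g (i + 1)

/-- The coordinatewise restriction `E(x)` of `x` to a finite set `E`. -/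
noncomputable def restrictF (E : Finset ℕ) (x : ℕ →₀ ℝ) : ℕ →₀ ℝ :=
  ∑ i ∈ E, Finsupp.single i (x i)

/-- The sup-norm `‖x‖_∞` of `x ∈ c₀₀`. -/
noncomputable def supNorm (x : ℕ →₀ ℝ) : ℝ := sSup (Set.range fun i => |x i|)

/-- `E` is an interval of natural numbers. -/
def IsNatInterval (E : Finset ℕ) : Prop := ∃ a b : ℕ, E = Finset.Icc a b

/-- `NS` is a norm on `c₀₀` satisfying the implicit equation defining Schlumprecht's space `S`,
whose unit vector basis is moreover normalized, 1-unconditional and 1-spreading, and which gives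
norm one to the vectors `(f(n)/n)·∑_{i ∈ A} e_i`, `|A| = n`. -/
structure IsSNorm (NS : (ℕ →₀ ℝ) → ℝ) : Prop where
  nonneg : ∀ x, 0 ≤ NS x
  eq_zero : ∀ x, NS x = 0 → x = 0
  smul : ∀ (c : ℝ) (x : ℕ →₀ ℝ), NS (c • x) = |c| * NS x
  add_le : ∀ x y, NS (x + y) ≤ NS x + NS y
  implicit : ∀ x, NS x = max (supNorm x)
    (sSup {r : ℝ | ∃ l : ℕ, 2 ≤ l ∧ ∃ E : Fin l → Finset ℕ,
      (∀ i, IsNatInterval (E i)) ∧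
      (∀ i j : Fin l, i < j → ∀ s ∈ E i, ∀ t ∈ E j, s < t) ∧
      r = (1 / flog l) * ∑ i, NS (restrictF (E i) x)})
  spreading : ∀ (l : ℕ) (a ε : Fin l → ℝ) (n : Fin l → ℕ), StrictMono n →
    (∀ i, ε i = 1 ∨ ε i = -1) →
    NS (∑ i, (a i * ε i) • Finsupp.single (n i) (1 : ℝ)) =
      NS (∑ i, a i • Finsupp.single (i : ℕ) (1 : ℝ))
  const_one : ∀ n : ℕ, 1 ≤ n → ∀ A : Finset ℕ, A.card = n →
    NS ((flog n / n) • ∑ i ∈ A, Finsupp.single i (1 : ℝ)) = 1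

namespace SAux

lemma flog_mono {a b : ℝ} (ha : 0 ≤ a) (hab : a ≤ b) : flog a ≤ flog b := by
  unfold flog
  exact Real.logb_le_logb_of_le (by norm_num) (by linarith) (by linarith)

lemma flog_one : flog 1 = 1 := by
  unfold flog
  norm_num

lemma flog_zero : flog 0 = 0 := by
  unfold flog
  norm_num

lemma one_le_flog {a : ℝ} (ha : 1 ≤ a) : 1 ≤ flog a := by
  have := flog_mono (by norm_num) ha
  rwa [flog_one] at this

lemma flog_nonneg {a : ℝ} (ha : 0 ≤ a) : 0 ≤ flog a := by
  have := flog_mono le_rfl ha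
  rwa [flog_zero] at this

lemma logb_two_le {y : ℝ} (hy : 0 < y) : Real.logb 2 y ≤ y := by
  have h2 := Real.log_two_gt_d9
  have h2' := Real.log_two_lt_d9
  unfold Real.logb
  rw [div_le_iff₀ (by linarith)]
  have h := Real.log_le_sub_one_of_pos (show 0 < y / 2 by linarith)
  rw [Real.log_div hy.ne' (by norm_num)] at h
  nlinarith

lemma flog_le_add {a b c : ℝ} (ha : 0 ≤ a) (hb : 0 ≤ b) (hc : 0 < c)
    (h : 1 + a ≤ (1 + b) * c) : flog a ≤ flog b + Real.logb 2 c := by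
  unfold flog
  rw [← Real.logb_mul (by linarith) hc.ne']
  exact Real.logb_le_logb_of_le (by norm_num) (by linarith) (by linarith)

lemma flog_two_lower : 11 / 7 ≤ flog 2 := by
  unfold flog
  rw [Real.le_logb_iff_rpow_le (by norm_num) (by norm_num)]
  have : ((2 : ℝ) ^ (11 / 7 : ℝ)) ^ (7 : ℕ) ≤ 3 ^ (7 : ℕ) := by
    rw [← Real.rpow_natCast, ← Real.rpow_mul (by norm_num)]
    norm_num
  have h3 := (pow_le_pow_iff_left₀ (by positivity) (by norm_num) (by norm_num)).1 this
  linarith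

lemma flog_two_upper : flog 2 ≤ 8 / 5 := by
  unfold flog
  rw [Real.logb_le_iff_le_rpow (by norm_num) (by norm_num)]
  have : (3 : ℝ) ^ (5 : ℕ) ≤ ((2 : ℝ) ^ (8 / 5 : ℝ)) ^ (5 : ℕ) := by
    rw [← Real.rpow_natCast ((2 : ℝ) ^ (8 / 5 : ℝ)), ← Real.rpow_mul (by norm_num)]
    norm_num
  have h3 := (pow_le_pow_iff_left₀ (by norm_num) (by positivity) (by norm_num)).1 this
  linarith

lemma flog_three : flog 3 = 2 := by
  unfold flog
  rw [show (3 : ℝ) + 1 = (2 : ℝ) ^ (2 : ℝ) by norm_num]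
  exact Real.logb_rpow (by norm_num) (by norm_num)

lemma flog_63 : flog 63 = 6 := by
  unfold flog
  rw [show (63 : ℝ) + 1 = (2 : ℝ) ^ (6 : ℝ) by norm_num]
  exact Real.logb_rpow (by norm_num) (by norm_num)

/-- `t / f(t)` is increasing. -/
lemma div_flog_mono {t u : ℝ} (ht : 0 ≤ t) (htu : t ≤ u) : t / flog t ≤ u / flog u := by
  rcases ht.eq_or_lt with rfl | ht
  · simp only [zero_div]
    exact div_nonneg htu (flog_nonneg htu)
  have hft : 0 < flog t := by
    unfold flog
    exact Real.logb_pos (by norm_num) (by linarith)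
  have hfu : 0 < flog u := lt_of_lt_of_le hft (flog_mono ht.le htu)
  rw [div_le_div_iff₀ hft hfu]
  have h1 : 1 ≤ u / t := by rw [le_div_iff₀ ht]; linarith
  have h := one_add_mul_self_le_rpow_one_add (show -1 ≤ t by linarith) h1
  rw [div_mul_cancel₀ _ ht.ne'] at h
  have h2 : flog u ≤ u / t * flog t := by
    unfold flog
    rw [← Real.logb_rpow_eq_mul_logb_of_pos (by linarith)]
    refine Real.logb_le_logb_of_le (by norm_num) (by linarith) ?_
    rw [add_comm u, add_comm t]
    exact h
  calc t * flog u ≤ t * (u / t * flog t) := by gcongr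
    _ = u * flog t := by field_simp

lemma div_flog_le {t u : ℝ} (ht : t = 0 ∨ 1 ≤ t) (hu : 0 < u) :
    t / flog t ≤ (u + t) / flog u := by
  have ht0 : 0 ≤ t := by rcases ht with h | h <;> linarith
  have hfu : 0 < flog u := by
    unfold flog
    exact Real.logb_pos (by norm_num) (by linarith)
  rcases le_total t u with h | h
  · refine (div_flog_mono ht0 h).trans ?_
    gcongr
    linarith
  · have h1 : flog u ≤ flog t := flog_mono hu.le h
    calc t / flog t ≤ t / flog u := by gcongr
      _ ≤ _ := by gcongr; linarith

lemma flog_le_self {t : ℝ} (ht : 1 ≤ t) : flog t ≤ t := by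
  have := div_flog_mono zero_le_one ht
  rw [flog_one, div_one, le_div_iff₀ (by linarith [one_le_flog ht])] at this
  linarith

lemma flog_sq_le {t : ℝ} (ht : 1 ≤ t) : flog t ^ 2 ≤ 4 * t := by
  have h0 : 0 ≤ t := by linarith
  have hs : 1 ≤ √t := by rw [Real.one_le_sqrt]; exact ht
  have h1 : flog t ≤ 2 * flog (√t) := by
    have := flog_le_add h0 (Real.sqrt_nonneg t) (show 0 < √t + 1 by linarith)
      (by nlinarith [Real.sq_sqrt h0])
    unfold flog at this ⊢
    linarith
  have h2 := flog_le_self hs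
  have h3 := one_le_flog ht
  have h4 : flog t ≤ 2 * √t := by linarith
  calc flog t ^ 2 ≤ (2 * √t) ^ 2 := by gcongr
    _ = 4 * t := by rw [mul_pow, Real.sq_sqrt h0]; norm_num

lemma restrictF_apply (E : Finset ℕ) (x : ℕ →₀ ℝ) (i : ℕ) :
    restrictF E x i = if i ∈ E then x i else 0 := by
  unfold restrictF
  rw [Finsupp.finsetSum_apply]
  simp [Finsupp.single_apply]

lemma restrictF_add (E : Finset ℕ) (x y : ℕ →₀ ℝ) :
    restrictF E (x + y) = restrictF E x + restrictF E y := by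
  ext i
  simp only [Finsupp.add_apply, restrictF_apply]
  split_ifs <;> simp

lemma restrictF_smul (E : Finset ℕ) (c : ℝ) (x : ℕ →₀ ℝ) :
    restrictF E (c • x) = c • restrictF E x := by
  ext i
  simp only [Finsupp.smul_apply, restrictF_apply]
  split_ifs <;> simp

lemma restrictF_zero (E : Finset ℕ) : restrictF E 0 = 0 := by
  ext i
  simp [restrictF_apply]

lemma restrictF_sum {ι : Type*} (E : Finset ℕ) (I : Finset ι) (x : ι → ℕ →₀ ℝ) :
    restrictF E (∑ s ∈ I, x s) = ∑ s ∈ I, restrictF E (x s) := by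
  classical
  induction I using Finset.induction_on with
  | empty => simp [restrictF_zero]
  | insert a I ha ih => rw [Finset.sum_insert ha, Finset.sum_insert ha, restrictF_add, ih]

lemma restrictF_restrictF (E G : Finset ℕ) (x : ℕ →₀ ℝ) :
    restrictF E (restrictF G x) = restrictF (G ∩ E) x := by
  ext i
  simp only [restrictF_apply, Finset.mem_inter]
  split_ifs <;> tauto

lemma restrictF_single (E : Finset ℕ) (i : ℕ) (c : ℝ) :
    restrictF E (Finsupp.single i c) = if i ∈ E then Finsupp.single i c else 0 := by
  ext t
  rw [restrictF_apply]
  by_cases h : i = t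
  · subst h; split_ifs <;> simp
  · split_ifs <;> simp [h]

lemma interval_inter {E G : Finset ℕ} (hE : IsNatInterval E) (hG : IsNatInterval G) :
    IsNatInterval (E ∩ G) := by
  obtain ⟨a, b, rfl⟩ := hE
  obtain ⟨c, d, rfl⟩ := hG
  refine ⟨max a c, min b d, ?_⟩
  ext i
  simp only [Finset.mem_inter, Finset.mem_Icc]
  omega

section norm

lemma ns_zero {NS : (ℕ →₀ ℝ) → ℝ} (h : IsSNorm NS) : NS 0 = 0 := by
  have := h.smul 0 0
  simpa using this

lemma ns_sum_le {NS : (ℕ →₀ ℝ) → ℝ} (h : IsSNorm NS) {ι : Type*} (I : Finset ι)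
    (x : ι → ℕ →₀ ℝ) : NS (∑ s ∈ I, x s) ≤ ∑ s ∈ I, NS (x s) := by
  classical
  induction I using Finset.induction_on with
  | empty => simp [ns_zero h]
  | insert a I ha ih =>
    rw [Finset.sum_insert ha, Finset.sum_insert ha]
    exact (h.add_le _ _).trans (by linarith)

lemma ns_single {NS : (ℕ →₀ ℝ) → ℝ} (h : IsSNorm NS) (i : ℕ) (c : ℝ) :
    NS (Finsupp.single i c) = |c| := by
  have h1 := h.const_one 1 le_rfl {i} (by simp)
  have h2 : Finsupp.single i c = c • Finsupp.single i (1 : ℝ) := by simp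
  rw [h2, h.smul]
  simp [flog_one] at h1
  rw [h1, mul_one]

lemma ns_basis {NS : (ℕ →₀ ℝ) → ℝ} (h : IsSNorm NS) (A : Finset ℕ) :
    NS (∑ i ∈ A, Finsupp.single i (1 : ℝ)) = A.card / flog A.card := by
  rcases A.eq_empty_or_nonempty with rfl | hA
  · simp [ns_zero h]
  have hc : 1 ≤ A.card := hA.card_pos
  have hc' : (1 : ℝ) ≤ A.card := by exact_mod_cast hc
  have h1 := h.const_one _ hc A rfl
  have hf := one_le_flog hc'
  rw [h.smul, abs_of_nonneg (by positivity)] at h1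
  field_simp at h1 ⊢
  linarith

lemma ns_signs {NS : (ℕ →₀ ℝ) → ℝ} (h : IsSNorm NS) (x y : ℕ →₀ ℝ) (σ : ℕ → ℝ)
    (hσ : ∀ i, σ i = 1 ∨ σ i = -1) (hy : ∀ i, y i = x i * σ i) : NS y = NS x := by
  have key : ∀ z : ℕ →₀ ℝ, z.support ⊆ x.support →
      z = ∑ i : Fin (x.support.sup id + 1), z i • Finsupp.single (i : ℕ) (1 : ℝ) := by
    intro z hz
    rw [Fin.sum_univ_eq_sum_range (fun i => z i • Finsupp.single i (1 : ℝ))]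
    ext t
    rw [Finsupp.finsetSum_apply]
    simp only [Finsupp.smul_apply, Finsupp.single_apply, smul_eq_mul, mul_ite, mul_one, mul_zero,
      Finset.sum_ite_eq', Finset.mem_range]
    split_ifs with ht
    · rfl
    · by_contra hne
      have : t ∈ x.support := hz (by simpa using hne)
      exact ht (Nat.lt_succ_of_le (Finset.le_sup (f := id) this))
  have hsub : y.support ⊆ x.support := by
    intro i hi
    simp only [Finsupp.mem_support_iff] at hi ⊢
    intro h0
    exact hi (by rw [hy, h0, zero_mul])
  have ey := key y hsub
  have ex := key x subset_rfl
  have := h.spreading (x.support.sup id + 1) (fun i => x i) (fun i => σ i) (fun i => (i : ℕ))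
    (fun a b hab => hab) (fun i => hσ i)
  rw [← ex] at this
  rw [← this]
  refine (congrArg NS ey).trans ?_
  simp only [hy]

lemma ns_restrict_le {NS : (ℕ →₀ ℝ) → ℝ} (h : IsSNorm NS) (E : Finset ℕ) (x : ℕ →₀ ℝ) :
    NS (restrictF E x) ≤ NS x := by
  have h1 : NS (restrictF E x + restrictF E x - x) = NS x := by
    refine ns_signs h _ _ (fun i => if i ∈ E then 1 else -1) ?_ ?_
    · intro i; split_ifs <;> simp
    · intro i
      simp only [Finsupp.sub_apply, Finsupp.add_apply, restrictF_apply]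
      split_ifs <;> ring
  have h2 : restrictF E x = (1 / 2 : ℝ) • (x + (restrictF E x + restrictF E x - x)) := by
    ext i
    simp only [Finsupp.sub_apply, Finsupp.add_apply, Finsupp.smul_apply, smul_eq_mul]
    ring
  rw [h2, h.smul, abs_of_pos (by norm_num)]
  have := h.add_le x (restrictF E x + restrictF E x - x)
  linarith

lemma ns_restrict_le_sum {NS : (ℕ →₀ ℝ) → ℝ} (h : IsSNorm NS) (E : Finset ℕ) (x : ℕ →₀ ℝ) :
    NS (restrictF E x) ≤ ∑ t ∈ x.support, if t ∈ E then |x t| else 0 := by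
  have : restrictF E x = ∑ t ∈ x.support, if t ∈ E then Finsupp.single t (x t) else 0 := by
    conv_lhs => rw [← Finsupp.sum_single x]
    unfold Finsupp.sum
    rw [restrictF_sum]
    simp only [restrictF_single]
  rw [this]
  refine (ns_sum_le h _ _).trans (Finset.sum_le_sum fun t _ => ?_)
  split_ifs
  · rw [ns_single h]
  · rw [ns_zero h]

lemma ns_lower {NS : (ℕ →₀ ℝ) → ℝ} (h : IsSNorm NS) (x : ℕ →₀ ℝ) (l : ℕ) (hl : 2 ≤ l)
    (E : Fin l → Finset ℕ) (hE : ∀ i, IsNatInterval (E i))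
    (hlt : ∀ i j : Fin l, i < j → ∀ s ∈ E i, ∀ t ∈ E j, s < t) :
    ∑ i, NS (restrictF (E i) x) ≤ flog l * NS x := by
  have hl' : (1 : ℝ) ≤ l := by exact_mod_cast (by omega : 1 ≤ l)
  have hf := one_le_flog hl'
  suffices hs : (1 / flog l) * ∑ i, NS (restrictF (E i) x) ≤ NS x by
    rw [one_div, inv_mul_le_iff₀ (by linarith)] at hs
    exact hs
  rw [h.implicit x]
  refine le_max_of_le_right (le_csSup ?_ ⟨l, hl, E, hE, hlt, rfl⟩)
  refine ⟨∑ t ∈ x.support, |x t|, ?_⟩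
  rintro r ⟨l, hl, E, hE, hlt, rfl⟩
  have hl' : (1 : ℝ) ≤ l := by exact_mod_cast (by omega : 1 ≤ l)
  have hf := one_le_flog hl'
  have h0 : 0 ≤ ∑ i, NS (restrictF (E i) x) := Finset.sum_nonneg fun i _ => h.nonneg _
  have h1 : (1 / flog l) * ∑ i, NS (restrictF (E i) x) ≤ ∑ i, NS (restrictF (E i) x) := by
    refine mul_le_of_le_one_left h0 ?_
    rw [div_le_one (by linarith)]
    exact hf
  refine h1.trans ?_
  refine (Finset.sum_le_sum fun i _ => ns_restrict_le_sum h (E i) x).trans ?_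
  rw [Finset.sum_comm]
  refine Finset.sum_le_sum fun t _ => ?_
  rw [← Finset.sum_filter, Finset.sum_const, nsmul_eq_mul]
  refine mul_le_of_le_one_left (abs_nonneg _) ?_
  have : (Finset.univ.filter fun i => t ∈ E i).card ≤ 1 := by
    rw [Finset.card_le_one]
    intro a ha b hb
    simp only [Finset.mem_filter, Finset.mem_univ, true_and] at ha hb
    by_contra hab
    rcases lt_or_gt_of_ne hab with hab | hab
    · exact lt_irrefl _ (hlt _ _ hab t ha t hb)
    · exact lt_irrefl _ (hlt _ _ hab t hb t ha)
  exact_mod_cast this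

lemma ns_lower_sub {NS : (ℕ →₀ ℝ) → ℝ} (h : IsSNorm NS) (x : ℕ →₀ ℝ) (l : ℕ)
    (E : Fin l → Finset ℕ) (hE : ∀ i, IsNatInterval (E i))
    (hlt : ∀ i j : Fin l, i < j → ∀ s ∈ E i, ∀ t ∈ E j, s < t) (T : Finset (Fin l)) :
    ∑ i ∈ T, NS (restrictF (E i) x) ≤ flog T.card * NS x := by
  rcases Nat.lt_or_ge T.card 2 with hT | hT
  · interval_cases hc : T.card
    · rw [Finset.card_eq_zero] at hc
      subst hc
      simp [flog_zero]
    · rw [Finset.card_eq_one] at hc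
      obtain ⟨a, rfl⟩ := hc
      simp only [Finset.sum_singleton, Nat.cast_one, flog_one, one_mul]
      exact ns_restrict_le h _ _
  · have := ns_lower h x T.card hT (fun i => E (T.orderEmbOfFin rfl i)) (fun i => hE _)
      (fun i j hij => hlt _ _ ((T.orderEmbOfFin rfl).strictMono hij))
    refine le_trans (le_of_eq ?_) this
    conv_lhs => rw [← Finset.map_orderEmbOfFin_univ T rfl, Finset.sum_map]
    rfl

lemma ns_upper {NS : (ℕ →₀ ℝ) → ℝ} (h : IsSNorm NS) (x : ℕ →₀ ℝ) (B : ℝ) (hB : 0 ≤ B)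
    (hsup : ∀ i, |x i| ≤ B)
    (hall : ∀ l : ℕ, 2 ≤ l → ∀ E : Fin l → Finset ℕ, (∀ i, IsNatInterval (E i)) →
      (∀ i j : Fin l, i < j → ∀ s ∈ E i, ∀ t ∈ E j, s < t) →
      ∑ i, NS (restrictF (E i) x) ≤ B * flog l) : NS x ≤ B := by
  rw [h.implicit x]
  refine max_le ?_ ?_
  · refine Real.sSup_le ?_ hB
    rintro _ ⟨i, rfl⟩
    exact hsup i
  · refine Real.sSup_le ?_ hB
    rintro r ⟨l, hl, E, hE, hlt, rfl⟩
    have hl' : (1 : ℝ) ≤ l := by exact_mod_cast (by omega : 1 ≤ l)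
    have hf := one_le_flog hl'
    rw [one_div, inv_mul_le_iff₀ (by linarith), mul_comm]
    exact hall l hl E hE hlt

end norm

/-- The configuration `e_{j_s} < x_s < e_{j_{s'}}` for `s < s'` in `I`, with `‖x_s‖ ≤ C`. -/
structure Cfg (NS : (ℕ →₀ ℝ) → ℝ) (I : Finset ℕ) (j : ℕ → ℕ) (x : ℕ → ℕ →₀ ℝ) (A C : ℝ) :
    Prop where
  h : IsSNorm NS
  c1 : ∀ s ∈ I, ∀ i ∈ (x s).support, j s < i
  c2 : ∀ s ∈ I, ∀ s' ∈ I, s < s' → (∀ i ∈ (x s).support, i < j s') ∧ j s < j s'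
  hx : ∀ s ∈ I, NS (x s) ≤ C
  hA : 0 ≤ A
  hC : 0 ≤ C

noncomputable def WW (I : Finset ℕ) (j : ℕ → ℕ) (x : ℕ → ℕ →₀ ℝ) (A : ℝ) : ℕ →₀ ℝ :=
  ∑ s ∈ I, (A • Finsupp.single (j s) (1 : ℝ) + x s)

def rc (I : Finset ℕ) (j : ℕ → ℕ) (E : Finset ℕ) : ℕ := (I.filter fun s => j s ∈ E).card

def SE (I : Finset ℕ) (x : ℕ → ℕ →₀ ℝ) (E : Finset ℕ) : Finset ℕ :=
  I.filter fun s => ∃ t ∈ (x s).support, t ∈ E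

section cfg
variable {NS : (ℕ →₀ ℝ) → ℝ} {I : Finset ℕ} {j : ℕ → ℕ} {x : ℕ → ℕ →₀ ℝ} {A C : ℝ}

lemma Cfg.inj (c : Cfg NS I j x A C) : Set.InjOn j I := by
  intro a ha b hb hab
  by_contra hne
  rcases lt_or_gt_of_ne hne with h | h
  · exact absurd hab (c.c2 a ha b hb h).2.ne
  · exact absurd hab (c.c2 b hb a ha h).2.ne'

lemma Cfg.card_SE (c : Cfg NS I j x A C) {E : Finset ℕ} (hE : IsNatInterval E) :
    (SE I x E).card ≤ rc I j E + 1 := by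
  rcases (SE I x E).eq_empty_or_nonempty with h0 | h0
  · simp [h0]
  obtain ⟨a, b, rfl⟩ := hE
  have hm := (SE I x (Finset.Icc a b)).min'_mem h0
  set s0 := (SE I x (Finset.Icc a b)).min' h0 with hs0
  have hsub : (SE I x (Finset.Icc a b)).erase s0 ⊆ I.filter fun s => j s ∈ Finset.Icc a b := by
    intro s hs
    rw [Finset.mem_erase] at hs
    have hle : s0 ≤ s := Finset.min'_le _ _ hs.2
    have hlt : s0 < s := lt_of_le_of_ne hle (Ne.symm hs.1)
    have hs2 := hs.2
    unfold SE at hm hs2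
    rw [Finset.mem_filter] at hm hs2
    obtain ⟨hm1, t, ht, htE⟩ := hm
    obtain ⟨hs1, u, hu, huE⟩ := hs2
    have h1 := (c.c2 _ hm1 _ hs1 hlt).1 t ht
    have h2 := c.c1 _ hs1 u hu
    rw [Finset.mem_filter]
    simp only [Finset.mem_Icc] at *
    exact ⟨hs1, by omega, by omega⟩
  have := Finset.card_le_card hsub
  rw [Finset.card_erase_of_mem hm] at this
  unfold rc
  omega

lemma Cfg.epart (c : Cfg NS I j x A C) (E : Finset ℕ) :
    NS (restrictF E (∑ s ∈ I, A • Finsupp.single (j s) (1 : ℝ))) =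
      A * ((rc I j E : ℝ) / flog (rc I j E)) := by
  rw [← Finset.smul_sum, restrictF_smul, c.h.smul, abs_of_nonneg c.hA, restrictF_sum]
  simp only [restrictF_single]
  rw [← Finset.sum_filter]
  have hinj : Set.InjOn j (I.filter fun s => j s ∈ E) := by
    intro a ha b hb hab
    simp only [Finset.coe_filter, Set.mem_ofPred_eq] at ha hb
    exact c.inj ha.1 hb.1 hab
  have h1 : ∑ s ∈ I.filter (fun s => j s ∈ E), Finsupp.single (j s) (1 : ℝ) =
      ∑ i ∈ (I.filter fun s => j s ∈ E).image j, Finsupp.single i (1 : ℝ) := by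
    rw [Finset.sum_image hinj]
  rw [h1, ns_basis c.h, Finset.card_image_of_injOn hinj]
  rfl

lemma restrict_eq_zero {E : Finset ℕ} {s : ℕ}
    (h0 : ¬ ∃ t ∈ (x s).support, t ∈ E) : restrictF E (x s) = 0 := by
  ext t
  rw [restrictF_apply]
  split_ifs with ht
  · by_contra hne
    exact h0 ⟨t, by simpa using hne, ht⟩
  · rfl

lemma Cfg.xpart (c : Cfg NS I j x A C) {E : Finset ℕ} (hE : IsNatInterval E) :
    NS (restrictF E (∑ s ∈ I, x s)) ≤ C * (rc I j E + 1) := by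
  rw [restrictF_sum]
  have h1 : ∑ s ∈ I, restrictF E (x s) = ∑ s ∈ SE I x E, restrictF E (x s) := by
    symm
    refine Finset.sum_subset (Finset.filter_subset _ _) ?_
    intro s hs hs'
    refine restrict_eq_zero fun h => hs' ?_
    unfold SE
    rw [Finset.mem_filter]
    exact ⟨hs, h⟩
  rw [h1]
  refine (ns_sum_le c.h _ _).trans ?_
  have h2 : ∑ s ∈ SE I x E, NS (restrictF E (x s)) ≤ ∑ s ∈ SE I x E, C := by
    refine Finset.sum_le_sum fun s hs => (ns_restrict_le c.h _ _).trans (c.hx s ?_)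
    exact (Finset.mem_filter.1 hs).1
  refine h2.trans ?_
  rw [Finset.sum_const, nsmul_eq_mul, mul_comm]
  have := c.card_SE hE
  have h3 : ((SE I x E).card : ℝ) ≤ rc I j E + 1 := by exact_mod_cast this
  exact mul_le_mul_of_nonneg_left h3 c.hC

lemma WW_split : WW I j x A = (∑ s ∈ I, A • Finsupp.single (j s) (1 : ℝ)) + ∑ s ∈ I, x s := by
  unfold WW
  rw [Finset.sum_add_distrib]

lemma Cfg.trivial (c : Cfg NS I j x A C) {E : Finset ℕ} (hE : IsNatInterval E) :
    NS (restrictF E (WW I j x A)) ≤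
      A * ((rc I j E : ℝ) / flog (rc I j E)) + C * (rc I j E + 1) := by
  rw [WW_split, restrictF_add]
  refine (c.h.add_le _ _).trans ?_
  rw [c.epart]
  linarith [c.xpart hE]

/-- the number of intervals meeting the support of `x_s` -/
def pc (x : ℕ → ℕ →₀ ℝ) {l : ℕ} (G : Fin l → Finset ℕ) (s : ℕ) : Finset (Fin l) :=
  Finset.univ.filter fun i => ∃ t ∈ (x s).support, t ∈ G i

lemma Cfg.count (c : Cfg NS I j x A C) {l : ℕ} (G : Fin l → Finset ℕ)
    (hlt : ∀ i j : Fin l, i < j → ∀ s ∈ G i, ∀ t ∈ G j, s < t) (J : Finset ℕ) (hJ : J ⊆ I) :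
    ∑ s ∈ J, (pc x G s).card ≤ l + J.card := by
  classical
  set Q : Finset (Fin l × ℕ) :=
    (Finset.univ ×ˢ J).filter fun q => ∃ t ∈ (x q.2).support, t ∈ G q.1 with hQ
  have hQmem : ∀ i s, (i, s) ∈ Q ↔ s ∈ J ∧ ∃ t ∈ (x s).support, t ∈ G i := by
    intro i s
    simp [hQ]
  have h1 : ∑ s ∈ J, (pc x G s).card = Q.card := by
    rw [hQ, Finset.card_filter, Finset.sum_product_right]
    refine Finset.sum_congr rfl fun s _ => ?_
    unfold pc
    rw [Finset.card_filter]
  set Q1 := Q.filter fun q => ∀ s', (q.1, s') ∈ Q → s' ≤ q.2 with hQ1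
  set Q2 := Q.filter fun q => ∀ i', (i', q.2) ∈ Q → i' ≤ q.1 with hQ2
  have hsub : Q ⊆ Q1 ∪ Q2 := by
    rintro ⟨i, s⟩ hq
    by_contra hcon
    rw [Finset.mem_union, not_or, hQ1, hQ2, Finset.mem_filter (s := Q),
      Finset.mem_filter (s := Q)] at hcon
    have hn1 : ¬ ∀ s', (i, s') ∈ Q → s' ≤ s := fun hh => hcon.1 ⟨hq, hh⟩
    have hn2 : ¬ ∀ i', (i', s) ∈ Q → i' ≤ i := fun hh => hcon.2 ⟨hq, hh⟩
    push Not at hn1 hn2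
    obtain ⟨s', hs', hss⟩ := hn1
    obtain ⟨i', hi', hii⟩ := hn2
    obtain ⟨hs'J, u, hu, huG⟩ := (hQmem _ _).1 hs'
    obtain ⟨hsJ, v, hv, hvG⟩ := (hQmem _ _).1 hi'
    have h1 := hlt i i' hii u huG v hvG
    have h2 := (c.c2 s (hJ hsJ) s' (hJ hs'J) hss).1 v hv
    have h3 := c.c1 s' (hJ hs'J) u hu
    omega
  have hc1 : Q1.card ≤ l := by
    have : Q1.card ≤ (Finset.univ : Finset (Fin l)).card := by
      refine Finset.card_le_card_of_injOn Prod.fst (fun _ _ => Finset.mem_univ _) ?_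
      rintro ⟨i, s⟩ hq ⟨i', s'⟩ hq' heq
      simp only at heq
      subst heq
      rw [Finset.mem_coe, hQ1, Finset.mem_filter] at hq hq'
      have a1 := hq.2 s' hq'.1
      have a2 := hq'.2 s hq.1
      have : s = s' := le_antisymm a2 a1
      rw [this]
    simpa using this
  have hc2 : Q2.card ≤ J.card := by
    refine Finset.card_le_card_of_injOn Prod.snd ?_ ?_
    · rintro ⟨i, s⟩ hq
      rw [Finset.mem_coe, hQ2, Finset.mem_filter] at hq
      exact ((hQmem _ _).1 hq.1).1
    · rintro ⟨i, s⟩ hq ⟨i', s'⟩ hq' heq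
      simp only at heq
      subst heq
      rw [Finset.mem_coe, hQ2, Finset.mem_filter] at hq hq'
      have a1 := hq.2 i' hq'.1
      have a2 := hq'.2 i hq.1
      have : i = i' := le_antisymm a2 a1
      rw [this]
  rw [h1]
  have := Finset.card_le_card hsub
  have := Finset.card_union_le Q1 Q2
  omega

lemma Cfg.sum_rc {l : ℕ} (G : Fin l → Finset ℕ)
    (hlt : ∀ i j : Fin l, i < j → ∀ s ∈ G i, ∀ t ∈ G j, s < t) (E : Finset ℕ)
    (hGE : ∀ i, G i ⊆ E) : ∑ i, rc I j (G i) ≤ rc I j E := by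
  classical
  unfold rc
  rw [← Finset.card_biUnion]
  · refine Finset.card_le_card ?_
    intro s hs
    simp only [Finset.mem_biUnion, Finset.mem_univ, true_and, Finset.mem_filter] at hs ⊢
    obtain ⟨i, h1, h2⟩ := hs
    exact ⟨h1, hGE i h2⟩
  · intro a _ b _ hab
    change Disjoint _ _
    rw [Finset.disjoint_left]
    intro s hs hs'
    simp only [Finset.mem_filter] at hs hs'
    rcases lt_or_gt_of_ne hab with hab | hab
    · exact lt_irrefl _ (hlt _ _ hab _ hs.2 _ hs'.2)
    · exact lt_irrefl _ (hlt _ _ hab _ hs'.2 _ hs.2)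

lemma Cfg.split (c : Cfg NS I j x A C) {E : Finset ℕ} {l : ℕ} (G : Fin l → Finset ℕ)
    (hG : ∀ i, IsNatInterval (G i))
    (hlt : ∀ i j : Fin l, i < j → ∀ s ∈ G i, ∀ t ∈ G j, s < t) (hGE : ∀ i, G i ⊆ E) :
    ∑ i, NS (restrictF (G i) (WW I j x A)) ≤
      A * ∑ i, ((rc I j (G i) : ℝ) / flog (rc I j (G i))) +
      C * ∑ s ∈ SE I x E, flog ((pc x G s).card) := by
  have h1 : ∀ i, NS (restrictF (G i) (WW I j x A)) ≤
      A * ((rc I j (G i) : ℝ) / flog (rc I j (G i))) +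
      ∑ s ∈ SE I x E, NS (restrictF (G i) (x s)) := by
    intro i
    rw [WW_split, restrictF_add]
    refine (c.h.add_le _ _).trans ?_
    rw [c.epart]
    have h1 : restrictF (G i) (∑ s ∈ I, x s) = ∑ s ∈ SE I x E, restrictF (G i) (x s) := by
      rw [restrictF_sum]
      symm
      refine Finset.sum_subset (Finset.filter_subset _ _) ?_
      intro s hs hs'
      refine restrict_eq_zero ?_
      rintro ⟨t, ht, htG⟩
      refine hs' ?_
      unfold SE
      rw [Finset.mem_filter]
      exact ⟨hs, t, ht, hGE i htG⟩
    rw [h1]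
    linarith [ns_sum_le c.h (SE I x E) (fun s => restrictF (G i) (x s))]
  refine (Finset.sum_le_sum fun i _ => h1 i).trans ?_
  rw [Finset.sum_add_distrib, ← Finset.mul_sum, Finset.sum_comm, Finset.mul_sum (SE I x E)]
  gcongr with s hs
  have hsI : s ∈ I := (Finset.mem_filter.1 hs).1
  have h2 : ∑ i, NS (restrictF (G i) (x s)) = ∑ i ∈ pc x G s, NS (restrictF (G i) (x s)) := by
    symm
    refine Finset.sum_subset (Finset.subset_univ _) ?_
    intro i _ hi
    rw [restrict_eq_zero, ns_zero c.h]
    intro hh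
    refine hi ?_
    unfold pc
    rw [Finset.mem_filter]
    exact ⟨Finset.mem_univ _, hh⟩
  rw [h2, mul_comm C]
  refine (ns_lower_sub c.h (x s) l G hG hlt _).trans ?_
  exact mul_le_mul_of_nonneg_left (c.hx s hsI) (flog_nonneg (Nat.cast_nonneg _))

end cfg

section numerics
variable {A C ε n r : ℝ}

/-- the standing numerical assumptions -/
structure Num (A C ε n : ℝ) : Prop where
  e0 : 0 < ε
  e1 : ε ≤ 3 / 8
  hC : 1 ≤ C
  hn : 1 ≤ n
  hA1 : A ≤ (1 + ε / 6) * flog n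
  hA2 : 50 * C ≤ ε ^ 2 * A

lemma Num.Apos (H : Num A C ε n) : 0 < A := by
  obtain ⟨e0, e1, hC, hn, hA1, hA2⟩ := H
  by_contra hA
  have : ε ^ 2 * A ≤ 0 := mul_nonpos_of_nonneg_of_nonpos (by positivity) (by linarith)
  linarith

lemma Num.eA (H : Num A C ε n) : 50 ≤ ε * (ε * A) := by
  have := H.hA2
  have := H.hC
  nlinarith

lemma Num.eA' (H : Num A C ε n) : 133 ≤ ε * A := by
  have h := H.eA
  have hA := H.Apos
  have h0 := H.e0
  have h1 := H.e1
  have : ε * (ε * A) ≤ 3 / 8 * (ε * A) := by gcongr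
  linarith

lemma Num.A' (H : Num A C ε n) : 354 ≤ A := by
  have h := H.eA'
  have hA := H.Apos
  have h1 := H.e1
  have : ε * A ≤ 3 / 8 * A := by gcongr
  linarith

lemma Num.inv (H : Num A C ε n) : 1 / ε ≤ ε * A / 50 := by
  have h := H.eA
  rw [div_le_iff₀ H.e0]
  linarith

lemma Num.fn (H : Num A C ε n) : A * (1 - ε / 6) ≤ flog n := by
  have hA := H.Apos
  have h1 := H.hA1
  have h0 := H.e0
  have hf := one_le_flog H.hn
  have he := H.e1
  have h2 : A * (1 - ε / 6) ≤ ((1 + ε / 6) * flog n) * (1 - ε / 6) := by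
    gcongr
    linarith
  have h3 : ((1 + ε / 6) * flog n) * (1 - ε / 6) = flog n - ε ^ 2 / 36 * flog n := by ring
  have h4 : 0 ≤ ε ^ 2 / 36 * flog n := by positivity
  linarith

lemma Num.An (H : Num A C ε n) : A ≤ ε ^ 2 * n / 10 := by
  have hA := H.Apos
  have h1 := H.fn
  have h0 := H.e0
  have he := H.e1
  have hsq := flog_sq_le H.hn
  have h2 : 15 / 16 * A ≤ flog n := by nlinarith
  have h3 : (15 / 16 * A) ^ 2 ≤ 4 * n := le_trans (by gcongr) hsq
  have h4 := H.eA
  have h5 : A * 50 ≤ A * (ε * (ε * A)) := by gcongr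
  have h6 : ε ^ 2 * (15 / 16 * A) ^ 2 ≤ ε ^ 2 * (4 * n) := by gcongr
  nlinarith

lemma Num.en (H : Num A C ε n) : 1300 ≤ ε * n := by
  have h1 := H.An
  have h2 := H.A'
  have h0 := H.e0
  have he := H.e1
  have hn := H.hn
  have : ε ^ 2 * n ≤ 3 / 8 * (ε * n) := by
    have : 0 ≤ ε * n := by positivity
    nlinarith
  have h3 := H.eA'
  have h4 : ε * A ≤ ε * (ε ^ 2 * n / 10) := by gcongr
  have h5 : ε * (ε ^ 2 * n / 10) = ε ^ 2 * (ε * n) / 10 := by ring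
  have h6 : ε ^ 2 ≤ 9 / 64 := by nlinarith
  have h7 : ε ^ 2 * (ε * n) ≤ 9 / 64 * (ε * n) := by gcongr
  linarith

lemma Num.fr (H : Num A C ε n) (hr : 3 / 4 * ε * n ≤ r) : A * (1 - ε / 5) ≤ flog r := by
  have h0 := H.e0
  have he := H.e1
  have hn := H.hn
  have hR : 0 ≤ 3 / 4 * ε * n := by positivity
  have h1 : flog n ≤ flog (3 / 4 * ε * n) + Real.logb 2 (4 / (3 * ε)) := by
    refine flog_le_add (by linarith) hR (by positivity) ?_
    have : 1 ≤ 4 / (3 * ε) := by rw [le_div_iff₀ (by positivity)]; linarith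
    have h2 : (1 + 3 / 4 * ε * n) * (4 / (3 * ε)) = 4 / (3 * ε) + n := by field_simp
    rw [h2]
    linarith
  have h2 := logb_two_le (show 0 < 4 / (3 * ε) by positivity)
  have h3 : 4 / (3 * ε) = 4 / 3 * (1 / ε) := by field_simp
  have h4 := H.inv
  have h5 := H.fn
  have h6 := flog_mono hR hr
  have h7 : 0 < ε * A := mul_pos h0 H.Apos
  nlinarith

lemma Num.fr' (H : Num A C ε n) (hr : 3 / 4 * ε * n ≤ r) : 37 / 40 * A ≤ flog r := by
  have h1 := H.fr hr
  have h2 := H.e1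
  have h3 := H.Apos
  nlinarith

lemma Num.trivial (H : Num A C ε n) (hr0 : 0 ≤ r) (hr : r ≤ 3 / 4 * ε * n) :
    A * (r / flog r) + C * (r + 1) ≤ C * r + ε * C * n := by
  have h1 := div_flog_mono hr0 hr
  have h2 := H.fr' (le_refl (3 / 4 * ε * n))
  have hA := H.Apos
  have h0 := H.e0
  have hn := H.hn
  have hC := H.hC
  have hen := H.en
  have h3 : A * (r / flog r) ≤ A * ((3 / 4 * ε * n) / (37 / 40 * A)) := by
    refine mul_le_mul_of_nonneg_left (h1.trans ?_) hA.le
    gcongr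
  have h4 : A * ((3 / 4 * ε * n) / (37 / 40 * A)) = 30 / 37 * (ε * n) := by
    field_simp
    norm_num
  have h5 : ε * C * n = C * (ε * n) := by ring
  rw [h5]
  nlinarith

lemma Num.sup (H : Num A C ε n) (hr0 : 0 ≤ r) : A + 2 * C ≤ C * r + ε * C * n := by
  have h1 := H.An
  have h0 := H.e0
  have hn := H.hn
  have hC := H.hC
  have hen := H.en
  have he := H.e1
  have h5 : ε * C * n = C * (ε * n) := by ring
  rw [h5]
  have h6 : ε ^ 2 * n ≤ ε * n := by nlinarith
  have h7 : 0 ≤ C * r := by positivity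
  nlinarith

lemma Num.small (H : Num A C ε n) (hr : 3 / 4 * ε * n ≤ r) (hrn : r ≤ n) {l Se Sx : ℝ}
    (hl3 : 3 ≤ l) (hl : l ≤ 64)
    (hSe : ∀ u, 0 < u → Se ≤ (l * u + r) / flog u) (hSx : Sx ≤ l + (r + 1)) :
    A * Se + C * Sx ≤ (C * r + ε * C * n) * flog l := by
  have hA := H.Apos
  have h0 := H.e0
  have hn := H.hn
  have hC := H.hC
  have hen := H.en
  have he := H.e1
  have hr0 : 0 < r := by nlinarith
  have hfl : 2 ≤ flog l := by rw [← flog_three]; exact flog_mono (by norm_num) hl3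
  have hu : 0 < ε * r / 128 := by positivity
  have h1 := hSe _ hu
  have h2 : flog r ≤ flog (ε * r / 128) + Real.logb 2 (128 / ε) := by
    refine flog_le_add hr0.le hu.le (by positivity) ?_
    have : 1 ≤ 128 / ε := by rw [le_div_iff₀ h0]; linarith
    have h2 : (1 + ε * r / 128) * (128 / ε) = 128 / ε + r := by field_simp
    rw [h2]
    linarith
  have h3 : Real.logb 2 (128 / ε) = 7 + Real.logb 2 (1 / ε) := by
    rw [show 128 / ε = (2 : ℝ) ^ (7 : ℝ) * (1 / ε) by norm_num; ring,
      Real.logb_mul (by positivity) (by positivity), Real.logb_rpow (by norm_num) (by norm_num)]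
  have h4 := logb_two_le (show 0 < 1 / ε by positivity)
  have h5 := H.inv
  have h6 := H.fr hr
  have h7 := H.eA'
  have h8 : A * (1 - 3 / 10 * ε) ≤ flog (ε * r / 128) := by nlinarith
  have h9 : 0 < 1 - 3 / 10 * ε := by linarith
  have h10 : Se ≤ (1 + ε / 2) * r / (A * (1 - 3 / 10 * ε)) := by
    refine h1.trans ?_
    have : l * (ε * r / 128) + r ≤ (1 + ε / 2) * r := by
      have : l * (ε * r) ≤ 64 * (ε * r) := by gcongr
      linarith
    gcongr
  have h11 : A * Se ≤ (1 + ε) * r := by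
    calc A * Se ≤ A * ((1 + ε / 2) * r / (A * (1 - 3 / 10 * ε))) := by gcongr
      _ = (1 + ε / 2) / (1 - 3 / 10 * ε) * r := by field_simp
      _ ≤ (1 + ε) * r := by
        gcongr
        rw [div_le_iff₀ h9]
        nlinarith
  have h12 : C * Sx ≤ C * (64 + (r + 1)) := by gcongr; linarith
  have h13 : (C * r + ε * C * n) * 2 ≤ (C * r + ε * C * n) * flog l := by gcongr
  refine le_trans ?_ h13
  have h14 : ε * C * n = C * (ε * n) := by ring
  have h15 : (1 + ε) * r ≤ C * r + C * (ε * n) := by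
    have a1 : r ≤ C * r := by nlinarith
    have a2 : ε * r ≤ ε * n := by gcongr
    have a3 : ε * n ≤ C * (ε * n) := by nlinarith
    linarith
  have h16 : C * 1300 ≤ C * (ε * n) := by gcongr
  rw [h14]
  linarith

lemma Num.mid (H : Num A C ε n) (hr : 3 / 4 * ε * n ≤ r) {l Se Sx : ℝ}
    (hl : 64 ≤ l) (hlr : l ≤ r) (hfl : flog l ≤ flog r - 6)
    (hSe : ∀ u, 0 < u → Se ≤ (l * u + r) / flog u) (hSx : Sx ≤ l + (r + 1)) :
    A * Se + C * Sx ≤ (C * r + ε * C * n) * flog l := by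
  have hA := H.Apos
  have hA' := H.A'
  have h0 := H.e0
  have hn := H.hn
  have hC := H.hC
  have hen := H.en
  have he := H.e1
  have hr0 : 0 < r := by linarith
  have hf6 : 6 ≤ flog l := by rw [← flog_63]; exact flog_mono (by norm_num) (by linarith)
  have hu : 0 < r / l := by positivity
  have h1 := hSe _ hu
  have h2 : flog r ≤ flog (r / l) + flog l := by
    have : flog l = Real.logb 2 (l + 1) := rfl
    rw [this]
    refine flog_le_add hr0.le hu.le (by positivity) ?_
    have h2 : (1 + r / l) * (l + 1) = l + 1 + r + r / l := by field_simp; ring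
    rw [h2]
    linarith
  have h3 := H.fr' hr
  have h4 : 6 * (flog r - 6) ≤ flog l * flog (r / l) := by
    have : flog l * (flog r - flog l) ≤ flog l * flog (r / l) := by
      gcongr
      linarith
    nlinarith
  have hfu : 0 < flog (r / l) := by linarith
  have h5 : l * (r / l) + r = 2 * r := by field_simp; norm_num
  rw [h5, le_div_iff₀ hfu] at h1
  have h6 : A * 5 ≤ flog l * flog (r / l) := by linarith
  have h7 : A * Se ≤ r / 2 * flog l := by
    by_contra hcon
    push Not at hcon
    have a1 : r / 2 * flog l * flog (r / l) < A * Se * flog (r / l) := by gcongr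
    have a2 : A * (Se * flog (r / l)) ≤ A * (2 * r) := by gcongr
    have a3 : r / 2 * (A * 5) ≤ r / 2 * (flog l * flog (r / l)) := by gcongr
    nlinarith
  have h8 : C * Sx ≤ C * (r / 2 * 6) := by gcongr; linarith
  have h9 : C * (r / 2 * 6) ≤ C * (r / 2 * flog l) := by gcongr
  have h10 : r / 2 * flog l ≤ C * (r / 2 * flog l) := by
    have : 0 ≤ r / 2 * flog l := by positivity
    nlinarith
  have h11 : 0 ≤ ε * C * n * flog l := by positivity
  linarith

lemma Num.large (H : Num A C ε n) (hr : 3 / 4 * ε * n ≤ r) (hrn : r ≤ n) {l Se Sx : ℝ}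
    (hlr : l ≤ r) (hfl : flog r - 6 ≤ flog l)
    (hSe : Se ≤ r) (hSx : Sx ≤ l + (r + 1)) :
    A * Se + C * Sx ≤ (C * r + ε * C * n) * flog l := by
  have hA := H.Apos
  have hA' := H.A'
  have h0 := H.e0
  have hn := H.hn
  have hC := H.hC
  have hen := H.en
  have he := H.e1
  have hr0 : 900 ≤ r := by nlinarith
  have h1 := H.fr hr
  have h2 := H.eA'
  have h2' := H.eA
  have h3 : A * (1 - ε / 4) ≤ flog l := by nlinarith
  have h4 : A * Se ≤ A * r := by gcongr
  have h5 : C * Sx ≤ C * (3 * r) := by gcongr; linarith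
  have h6 : (C * r + ε * C * n) * (A * (1 - ε / 4)) ≤ (C * r + ε * C * n) * flog l := by gcongr
  refine le_trans ?_ h6
  have h7 : (C * r + ε * C * r) * (A * (1 - ε / 4)) ≤
      (C * r + ε * C * n) * (A * (1 - ε / 4)) := by
    have : 0 ≤ 1 - ε / 4 := by linarith
    gcongr
  refine le_trans ?_ h7
  have h8 : (C * r + ε * C * r) * (A * (1 - ε / 4)) =
      C * r * (A + ε * A * (3 / 4 - ε / 4)) := by ring
  rw [h8]
  have h9 : A * r ≤ C * r * A := by
    have : 0 ≤ A * r := by positivity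
    nlinarith
  have h10 : 3 ≤ ε * A * (3 / 4 - ε / 4) := by nlinarith
  have h11 : C * r * 3 ≤ C * r * (ε * A * (3 / 4 - ε / 4)) := by gcongr
  linarith

lemma Num.huge (H : Num A C ε n) (hr : 3 / 4 * ε * n ≤ r) (hrn : r ≤ n) {l Se Sx : ℝ}
    (hlr : r ≤ l) (hSe : Se ≤ r)
    (hSx : ∀ q, 0 ≤ q → Sx ≤ (r + 1) * flog q + (2 * (r + 1) + l) / (1 + q)) :
    A * Se + C * Sx ≤ (C * r + ε * C * n) * flog l := by
  have hA := H.Apos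
  have hA' := H.A'
  have h0 := H.e0
  have hn := H.hn
  have hC := H.hC
  have hen := H.en
  have he := H.e1
  have hr0 : 900 ≤ r := by nlinarith
  have h1 := H.fr hr
  have h1' := H.fr' hr
  have h2 := H.eA'
  have hl0 : 0 < l := by linarith
  have hfl : flog r ≤ flog l := flog_mono (by linarith) hlr
  have h3 := hSx (l / r) (by positivity)
  have h4 : (2 * (r + 1) + l) / (1 + l / r) ≤ 2 * (r + 1) := by
    rw [div_le_iff₀ (by positivity)]
    have : 2 * (r + 1) * (1 + l / r) = 2 * (r + 1) + 2 * l + 2 * (l / r) := by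
      field_simp
      ring
    rw [this]
    have : 0 ≤ l / r := by positivity
    linarith
  have h5 : flog (l / r) ≤ flog l - flog r + 1 := by
    have h6 : (l / r + 1) * (r + 1) ≤ 2 * (l + 1) := by
      have a1 : (l / r + 1) * (r + 1) = l + l / r + r + 1 := by field_simp; ring
      rw [a1]
      have a2 : l / r + r ≤ 1 + l := by
        have a3 : (1 + l - r) - l / r = (r - 1) * (l - r) / r := by field_simp; ring
        have a4 : 0 ≤ (r - 1) * (l - r) / r :=
          div_nonneg (mul_nonneg (by linarith) (by linarith)) (by linarith)
        linarith
      linarith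
    have h7 := Real.logb_le_logb_of_le (b := 2) (by norm_num) (by positivity) h6
    rw [Real.logb_mul (by positivity) (by positivity),
      Real.logb_mul (by positivity) (by positivity), Real.logb_self_eq_one (by norm_num)] at h7
    unfold flog
    linarith
  have h6 : Sx ≤ (r + 1) * (flog l - flog r + 3) := by
    have : (r + 1) * flog (l / r) ≤ (r + 1) * (flog l - flog r + 1) := by gcongr
    linarith
  have h7 : A * Se ≤ A * r := by gcongr
  have h8 : C * Sx ≤ C * ((r + 1) * (flog l - flog r + 3)) := by gcongr
  have h9 : A * r ≤ C * (A * r) := by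
    have : 0 ≤ A * r := by positivity
    nlinarith
  suffices hs : A * r + (r + 1) * (flog l - flog r + 3) ≤ (r + ε * n) * flog l by
    have : C * (A * r + (r + 1) * (flog l - flog r + 3)) ≤ C * ((r + ε * n) * flog l) := by gcongr
    linarith
  have h10 : A - flog r ≤ ε / 4 * flog l := by nlinarith
  have h11 : r * (A - flog r) ≤ n * (ε / 4 * flog l) := by
    have : 0 ≤ ε / 4 * flog l := by
      have : 0 ≤ flog l := by linarith
      positivity
    calc r * (A - flog r) ≤ r * (ε / 4 * flog l) := by gcongr
      _ ≤ _ := by gcongr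
  have h12 : flog l ≤ ε * n / 4 * flog l := by nlinarith
  have h13 : 24 ≤ ε * flog l := by nlinarith
  have h14 : n * 24 ≤ n * (ε * flog l) := by gcongr
  nlinarith

end numerics

section core
variable {NS : (ℕ →₀ ℝ) → ℝ} {I : Finset ℕ} {j : ℕ → ℕ} {x : ℕ → ℕ →₀ ℝ} {A C ε : ℝ}

lemma rc_le (E : Finset ℕ) : rc I j E ≤ I.card := Finset.card_filter_le _ _

lemma nat_div_flog_le (t : ℕ) {u : ℝ} (hu : 0 < u) :
    (t : ℝ) / flog t ≤ (u + t) / flog u := by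
  refine div_flog_le ?_ hu
  rcases Nat.eq_zero_or_pos t with h | h
  · left; simp [h]
  · right; exact_mod_cast h

lemma nat_div_flog_le_self (t : ℕ) : (t : ℝ) / flog t ≤ t := by
  rcases Nat.eq_zero_or_pos t with h | h
  · simp [h]
  · exact div_le_self (Nat.cast_nonneg _) (one_le_flog (by exact_mod_cast h))

lemma nat_flog_le_self (t : ℕ) : flog t ≤ t := by
  rcases Nat.eq_zero_or_pos t with h | h
  · simp [h, flog_zero]
  · exact flog_le_self (by exact_mod_cast h)

lemma core_ge_three (c : Cfg NS I j x A C) (H : Num A C ε I.card) {E : Finset ℕ}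
    (hE : IsNatInterval E) (hr : 3 / 4 * ε * I.card ≤ rc I j E) {l : ℕ} (hl : 3 ≤ l)
    (G : Fin l → Finset ℕ) (hG : ∀ i, IsNatInterval (G i))
    (hlt : ∀ i j : Fin l, i < j → ∀ s ∈ G i, ∀ t ∈ G j, s < t) (hGE : ∀ i, G i ⊆ E) :
    ∑ i, NS (restrictF (G i) (WW I j x A)) ≤ (C * rc I j E + ε * C * I.card) * flog l := by
  refine (c.split G hG hlt hGE).trans ?_
  have hrn : (rc I j E : ℝ) ≤ I.card := by exact_mod_cast rc_le E
  have hN : ((SE I x E).card : ℝ) ≤ rc I j E + 1 := by exact_mod_cast c.card_SE hE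
  have hcount : ∑ s ∈ SE I x E, ((pc x G s).card : ℝ) ≤ l + (SE I x E).card := by
    exact_mod_cast c.count G hlt (SE I x E) (Finset.filter_subset _ _)
  have hsum : ∑ i, (rc I j (G i) : ℝ) ≤ rc I j E := by
    exact_mod_cast Cfg.sum_rc (I := I) (j := j) G hlt E hGE
  have hSe1 : ∀ u, 0 < u → ∑ i, ((rc I j (G i) : ℝ) / flog (rc I j (G i))) ≤
      (l * u + rc I j E) / flog u := by
    intro u hu
    have hfu := flog_nonneg hu.le
    calc _ ≤ ∑ i : Fin l, (u + (rc I j (G i) : ℝ)) / flog u :=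
          Finset.sum_le_sum fun i _ => nat_div_flog_le _ hu
      _ = (l * u + ∑ i, (rc I j (G i) : ℝ)) / flog u := by
          rw [← Finset.sum_div, Finset.sum_add_distrib]
          simp
      _ ≤ _ := by gcongr
  have hSe2 : ∑ i, ((rc I j (G i) : ℝ) / flog (rc I j (G i))) ≤ rc I j E :=
    (Finset.sum_le_sum fun i _ => nat_div_flog_le_self _).trans hsum
  have hSx1 : ∑ s ∈ SE I x E, flog ((pc x G s).card) ≤ l + ((rc I j E : ℝ) + 1) := by
    have := Finset.sum_le_sum fun s (_ : s ∈ SE I x E) => nat_flog_le_self (pc x G s).card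
    linarith
  have hSx2 : ∀ q : ℝ, 0 ≤ q → ∑ s ∈ SE I x E, flog ((pc x G s).card) ≤
      ((rc I j E : ℝ) + 1) * flog q + (2 * ((rc I j E : ℝ) + 1) + l) / (1 + q) := by
    intro q hq
    have hfq := flog_nonneg hq
    have h1 : ∀ p : ℕ, flog p ≤ flog q + (1 + (p : ℝ)) / (1 + q) := by
      intro p
      have h2 : 0 < (1 + (p : ℝ)) / (1 + q) := by positivity
      have := flog_le_add (Nat.cast_nonneg p) hq h2 (le_of_eq (by field_simp))
      linarith [logb_two_le h2]
    calc _ ≤ ∑ s ∈ SE I x E, (flog q + (1 + ((pc x G s).card : ℝ)) / (1 + q)) :=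
          Finset.sum_le_sum fun s _ => h1 _
      _ = (SE I x E).card * flog q +
          ((SE I x E).card + ∑ s ∈ SE I x E, ((pc x G s).card : ℝ)) / (1 + q) := by
          rw [Finset.sum_add_distrib, ← Finset.sum_div, Finset.sum_add_distrib]
          simp
      _ ≤ _ := by
          have h2 : ((SE I x E).card : ℝ) + ∑ s ∈ SE I x E, ((pc x G s).card : ℝ) ≤
              2 * ((rc I j E : ℝ) + 1) + l := by linarith
          exact add_le_add (mul_le_mul_of_nonneg_right hN hfq)
            (div_le_div_of_nonneg_right h2 (by linarith))
  have hl' : (3 : ℝ) ≤ l := by exact_mod_cast hl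
  rcases le_total (l : ℝ) 64 with h64 | h64
  · exact H.small hr hrn hl' h64 hSe1 hSx1
  rcases le_total (l : ℝ) (rc I j E) with hlr | hlr
  · rcases le_total (flog l) (flog (rc I j E) - 6) with hf | hf
    · exact H.mid hr h64 hlr hf hSe1 hSx1
    · exact H.large hr hrn hlr hf hSe2 hSx1
  · exact H.huge hr hrn hlr hSe2 hSx2

lemma core (c : Cfg NS I j x A C) (H : Num A C ε I.card) (N : ℕ) :
    ∀ E : Finset ℕ, IsNatInterval E → E.card ≤ N →
      NS (restrictF E (WW I j x A)) ≤ C * rc I j E + ε * C * I.card := by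
  have hC := H.hC
  have e0 := H.e0
  have hen := H.en
  induction N with
  | zero =>
    intro E hE hc
    have hE0 : E = ∅ := by simpa using hc
    have : restrictF E (WW I j x A) = 0 := by
      rw [hE0]; rfl
    rw [this, ns_zero c.h]
    positivity
  | succ N ih =>
    intro E hE hc
    rcases le_total (rc I j E : ℝ) (3 / 4 * ε * I.card) with hr | hr
    · exact (c.trivial hE).trans (H.trivial (Nat.cast_nonneg _) hr)
    have hB0 : 0 ≤ C * rc I j E + ε * C * I.card := by positivity
    set B := C * rc I j E + ε * C * I.card with hB
    have hf2 := flog_two_lower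
    set v := restrictF E (WW I j x A) with hv
    have key : NS v ≤ max B (NS v / flog 2) := by
      refine ns_upper c.h v _ (le_max_of_le_left hB0) ?_ ?_
      · intro i
        refine le_max_of_le_left ?_
        have h1 : |v i| = NS (restrictF {i} v) := by
          have : restrictF {i} v = Finsupp.single i (v i) := by
            unfold restrictF
            simp
          rw [this, ns_single c.h]
        rw [h1, hv, restrictF_restrictF]
        have hi : IsNatInterval (E ∩ {i}) := interval_inter hE ⟨i, i, by simp⟩
        have hrc : rc I j (E ∩ {i}) ≤ 1 := by
          unfold rc
          rw [Finset.card_le_one]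
          intro a ha b hb
          simp only [Finset.mem_filter, Finset.mem_inter, Finset.mem_singleton] at ha hb
          exact c.inj ha.1 hb.1 (ha.2.2.trans hb.2.2.symm)
        have hrc' : (rc I j (E ∩ {i}) : ℝ) ≤ 1 := by exact_mod_cast hrc
        refine (c.trivial hi).trans (le_trans ?_ (H.sup (Nat.cast_nonneg (rc I j E))))
        have a1 := nat_div_flog_le_self (rc I j (E ∩ {i}))
        have a2 : A * ((rc I j (E ∩ {i}) : ℝ) / flog (rc I j (E ∩ {i}))) ≤ A * 1 :=
          mul_le_mul_of_nonneg_left (by linarith) c.hA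
        have a3 : C * ((rc I j (E ∩ {i}) : ℝ) + 1) ≤ C * 2 := by
          gcongr
          linarith
        linarith
      · intro l hl E' hE' hlt
        have hrew : ∀ i, restrictF (E' i) v = restrictF (E ∩ E' i) (WW I j x A) := by
          intro i
          rw [hv, restrictF_restrictF]
        simp only [hrew]
        set G : Fin l → Finset ℕ := fun i => E ∩ E' i with hGdef
        have hG : ∀ i, IsNatInterval (G i) := fun i => interval_inter hE (hE' i)
        have hGE : ∀ i, G i ⊆ E := fun i => Finset.inter_subset_left
        have hGlt : ∀ i j : Fin l, i < j → ∀ s ∈ G i, ∀ t ∈ G j, s < t :=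
          fun i j hij s hs t ht =>
            hlt i j hij s (Finset.mem_inter.1 hs).2 t (Finset.mem_inter.1 ht).2
        have hfl : 0 ≤ flog l := flog_nonneg (Nat.cast_nonneg _)
        change ∑ i, NS (restrictF (G i) (WW I j x A)) ≤ _
        clear_value G
        rcases Nat.lt_or_ge l 3 with hl3 | hl3
        · obtain rfl : l = 2 := by omega
          have h2c : flog ((2 : ℕ) : ℝ) = flog 2 := by norm_num
          rw [h2c, Fin.sum_univ_two]
          have hempty : ∀ G' : Finset ℕ, G' = ∅ → NS (restrictF G' (WW I j x A)) = 0 := by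
            rintro G' rfl
            have : restrictF ∅ (WW I j x A) = 0 := rfl
            rw [this, ns_zero c.h]
          have hNSv : NS v ≤ max B (NS v / flog 2) * flog 2 := by
            have : NS v = NS v / flog 2 * flog 2 := by field_simp
            conv_lhs => rw [this]
            gcongr
            exact le_max_right _ _
          by_cases h0 : G 0 = E
          · have h1 : G 1 = ∅ := by
              rw [Finset.eq_empty_iff_forall_notMem]
              intro t ht
              exact lt_irrefl _ (hGlt 0 1 (by decide) t (h0 ▸ hGE 1 ht) t ht)
            rw [hempty _ h1, h0, add_zero]
            exact hNSv
          by_cases h1 : G 1 = E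
          · have h0 : G 0 = ∅ := by
              rw [Finset.eq_empty_iff_forall_notMem]
              intro t ht
              exact lt_irrefl _ (hGlt 0 1 (by decide) t ht t (h1 ▸ hGE 0 ht))
            rw [hempty _ h0, h1, zero_add]
            exact hNSv
          have c0 : (G 0).card ≤ N := by
            have := Finset.card_lt_card ((hGE 0).ssubset_of_ne h0)
            omega
          have c1 : (G 1).card ≤ N := by
            have := Finset.card_lt_card ((hGE 1).ssubset_of_ne h1)
            omega
          have i0 := ih _ (hG 0) c0
          have i1 := ih _ (hG 1) c1
          have hsum : (rc I j (G 0) : ℝ) + rc I j (G 1) ≤ rc I j E := by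
            have := Cfg.sum_rc (I := I) (j := j) G hGlt E hGE
            rw [Fin.sum_univ_two] at this
            exact_mod_cast this
          have hsumC : C * ((rc I j (G 0) : ℝ) + rc I j (G 1)) ≤ C * rc I j E := by gcongr
          have hmain : C * rc I j E + 2 * (ε * C * I.card) ≤ B * flog 2 := by
            have a1 : B * (11 / 7) ≤ B * flog 2 := by gcongr
            have a2 : C * (3 / 4 * ε * I.card) ≤ C * rc I j E := by gcongr
            rw [hB] at a1 ⊢
            linarith
          have hle : B * flog 2 ≤ max B (NS v / flog 2) * flog 2 := by
            gcongr
            exact le_max_left _ _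
          linarith
        · refine (core_ge_three c H hE hr hl3 G hG hGlt hGE).trans ?_
          gcongr
          exact le_max_left _ _
    rcases le_max_iff.1 key with hk | hk
    · exact hk
    · rw [le_div_iff₀ (by linarith)] at hk
      have := c.h.nonneg v
      nlinarith

lemma restrict_big (v : ℕ →₀ ℝ) : restrictF (Finset.Icc 0 (v.support.sup id)) v = v := by
  ext t
  rw [restrictF_apply]
  split_ifs with ht
  · rfl
  · by_contra hne
    refine ht ?_
    rw [Finset.mem_Icc]
    have : t ∈ v.support := by
      rw [Finsupp.mem_support_iff]
      exact fun h => hne h.symm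
    exact ⟨Nat.zero_le _, Finset.le_sup (f := id) this⟩

lemma core_final (c : Cfg NS I j x A C) (H : Num A C ε I.card) :
    NS (WW I j x A) ≤ C * (1 + ε) * I.card := by
  have h1 := core c H _ (Finset.Icc 0 ((WW I j x A).support.sup id)) ⟨_, _, rfl⟩ le_rfl
  rw [restrict_big] at h1
  have hrn : (rc I j (Finset.Icc 0 ((WW I j x A).support.sup id)) : ℝ) ≤ I.card := by
    exact_mod_cast rc_le _
  have hC := H.hC
  have : C * (rc I j (Finset.Icc 0 ((WW I j x A).support.sup id)) : ℝ) ≤ C * I.card := by gcongr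
  linarith

end core

/-- the upper estimate for a sub-block `I` of `{1,…,m}` -/
lemma block_le {NS : (ℕ →₀ ℝ) → ℝ} (hNS : IsSNorm NS) {m : ℕ} (hm : 1 ≤ m) {C ε : ℝ}
    (hC : 1 ≤ C) (hε0 : 0 < ε) (hε1 : ε < (flog 2 - 1) / flog 2)
    (hfm : C * (50 / ε ^ 2) ≤ flog m)
    {j : ℕ → ℕ} {x : ℕ → ℕ →₀ ℝ}
    (hchain1 : ∀ s ∈ Finset.Icc 1 m, ∀ i ∈ (x s).support, j s < i)
    (hchain2 : ∀ s ∈ Finset.Icc 1 m, ∀ s' ∈ Finset.Icc 1 m, s < s' →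
      (∀ i ∈ (x s).support, i < j s') ∧ j s < j s')
    (hx : ∀ s ∈ Finset.Icc 1 m, NS (x s) ≤ C / m)
    {I : Finset ℕ} (hI : I ⊆ Finset.Icc 1 m) (hIc : 1 ≤ I.card)
    (hratio : flog m ≤ (1 + ε / 6) * flog I.card) :
    NS (∑ s ∈ I, ((flog m / m) • Finsupp.single (j s) (1 : ℝ) + x s)) ≤
      C * (1 + ε) * I.card / m := by
  have hm0 : (0 : ℝ) < m := by exact_mod_cast hm
  have hsupp : ∀ s, ((m : ℝ) • x s).support ⊆ (x s).support := fun s => Finsupp.support_smul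
  have c : Cfg NS I j (fun s => (m : ℝ) • x s) (flog m) C := by
    refine ⟨hNS, ?_, ?_, ?_, flog_nonneg hm0.le, by linarith⟩
    · intro s hs i hi
      exact hchain1 s (hI hs) i (hsupp s hi)
    · intro s hs s' hs' hss
      have := hchain2 s (hI hs) s' (hI hs') hss
      exact ⟨fun i hi => this.1 i (hsupp s hi), this.2⟩
    · intro s hs
      have := hx s (hI hs)
      rw [le_div_iff₀ hm0] at this
      rw [hNS.smul, abs_of_pos hm0]
      linarith
  have H : Num (flog m) C ε I.card := by
    refine ⟨hε0, ?_, hC, by exact_mod_cast hIc, hratio, ?_⟩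
    · have h2 := flog_two_upper
      have h3 := flog_two_lower
      rw [lt_div_iff₀ (by linarith)] at hε1
      nlinarith
    · have : ε ^ 2 * (C * (50 / ε ^ 2)) = 50 * C := by field_simp
      rw [← this]
      gcongr
  have h1 := core_final c H
  have h2 : WW I j (fun s => (m : ℝ) • x s) (flog m) =
      (m : ℝ) • ∑ s ∈ I, ((flog m / m) • Finsupp.single (j s) (1 : ℝ) + x s) := by
    unfold WW
    rw [Finset.smul_sum]
    refine Finset.sum_congr rfl fun s _ => ?_
    rw [smul_add, smul_smul, mul_div_cancel₀ _ hm0.ne']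
  rw [h2, hNS.smul, abs_of_pos hm0] at h1
  rw [le_div_iff₀ hm0]
  linarith

lemma sum_range_blocks (k n : ℕ) (g : ℕ → ℝ) :
    ∑ t ∈ Finset.range (k * n), g t =
      ∑ i ∈ Finset.range k, ∑ b ∈ Finset.range n, g (i * n + b) := by
  induction k with
  | zero => simp
  | succ k ih => rw [Nat.succ_mul, Finset.sum_range_add, ih, Finset.sum_range_succ]

lemma lower_est {NS : (ℕ →₀ ℝ) → ℝ} (hNS : IsSNorm NS) {k m n : ℕ} (hm : 2 ≤ m)
    (hmkn : m = k * n) (hn : 1 ≤ n)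
    {j : ℕ → ℕ} {x : ℕ → ℕ →₀ ℝ}
    (hchain1 : ∀ s ∈ Finset.Icc 1 m, ∀ i ∈ (x s).support, j s < i)
    (hchain2 : ∀ s ∈ Finset.Icc 1 m, ∀ s' ∈ Finset.Icc 1 m, s < s' →
      (∀ i ∈ (x s).support, i < j s') ∧ j s < j s') (b : ℕ → ℝ) (A : ℝ) :
    n * |A| * ∑ i ∈ Finset.Icc 1 k, |b i| ≤
      flog m * NS (∑ i ∈ Finset.Icc 1 k, b i •
        ∑ s ∈ Finset.Icc ((i - 1) * n + 1) (i * n),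
          (A • Finsupp.single (j s) (1 : ℝ) + x s)) := by
  set v := ∑ i ∈ Finset.Icc 1 k, b i •
        ∑ s ∈ Finset.Icc ((i - 1) * n + 1) (i * n),
          (A • Finsupp.single (j s) (1 : ℝ) + x s) with hv
  have hmono : ∀ s ∈ Finset.Icc 1 m, ∀ s' ∈ Finset.Icc 1 m, j s = j s' → s = s' := by
    intro s hs s' hs' hjj
    by_contra hne
    rcases lt_or_gt_of_ne hne with h | h
    · exact absurd hjj (hchain2 s hs s' hs' h).2.ne
    · exact absurd hjj (hchain2 s' hs' s hs h).2.ne'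
  have hx0 : ∀ s ∈ Finset.Icc 1 m, ∀ s' ∈ Finset.Icc 1 m, x s (j s') = 0 := by
    intro s hs s' hs'
    by_contra hne
    have hmem : j s' ∈ (x s).support := by simpa using hne
    have h1 := hchain1 s hs _ hmem
    rcases lt_trichotomy s s' with h | h | h
    · exact lt_irrefl _ ((hchain2 s hs s' hs' h).1 _ hmem)
    · subst h; exact lt_irrefl _ h1
    · exact lt_irrefl _ (h1.trans (hchain2 s' hs' s hs h).2)
  have hblk : ∀ i ∈ Finset.Icc 1 k, ∀ s ∈ Finset.Icc ((i - 1) * n + 1) (i * n),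
      s ∈ Finset.Icc 1 m := by
    intro i hi s hs
    rw [Finset.mem_Icc] at *
    have : i * n ≤ k * n := Nat.mul_le_mul_right n hi.2
    exact ⟨by omega, by omega⟩
  have hval : ∀ i < k, ∀ t < n, v (j (i * n + t + 1)) = b (i + 1) * A := by
    intro i hi t ht
    have hin : (i + 1) * n ≤ k * n := Nat.mul_le_mul_right n hi
    have hin' : (i + 1) * n = i * n + n := by ring
    have hs0 : i * n + t + 1 ∈ Finset.Icc 1 m := by
      rw [Finset.mem_Icc]
      omega
    have hinner : ∀ i' ∈ Finset.Icc 1 k,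
        (∑ s ∈ Finset.Icc ((i' - 1) * n + 1) (i' * n),
          (A • Finsupp.single (j s) (1 : ℝ) + x s)) (j (i * n + t + 1)) =
        if i + 1 = i' then A else 0 := by
      intro i' hi'
      rw [Finsupp.finsetSum_apply]
      have h1 : ∀ s ∈ Finset.Icc ((i' - 1) * n + 1) (i' * n),
          (A • Finsupp.single (j s) (1 : ℝ) + x s) (j (i * n + t + 1)) =
          if i * n + t + 1 = s then A else 0 := by
        intro s hs
        have hsm := hblk i' hi' s hs
        rw [Finsupp.add_apply, hx0 s hsm _ hs0, add_zero, Finsupp.smul_apply,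
          Finsupp.single_apply]
        by_cases h : i * n + t + 1 = s
        · simp [h]
        · have : j s ≠ j (i * n + t + 1) := fun hh => h (hmono _ hsm _ hs0 hh).symm
          simp [h, this]
      rw [Finset.sum_congr rfl h1, Finset.sum_ite_eq]
      congr 1
      rw [Finset.mem_Icc] at *
      rw [eq_iff_iff]
      obtain ⟨i'', rfl⟩ : ∃ i'', i' = i'' + 1 := ⟨i' - 1, by omega⟩
      simp only [Nat.add_sub_cancel]
      constructor
      · rintro ⟨h1, h2⟩
        have h3 : i'' < i + 1 := by
          by_contra hcon
          have : (i + 1) * n ≤ i'' * n := Nat.mul_le_mul_right n (by omega)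
          omega
        have h4 : i < i'' + 1 := by
          by_contra hcon
          have : (i'' + 1) * n ≤ i * n := Nat.mul_le_mul_right n (by omega)
          omega
        omega
      · intro h
        have : i = i'' := by omega
        subst this
        omega
    rw [hv, Finsupp.finsetSum_apply]
    have h2 : ∀ i' ∈ Finset.Icc 1 k, (b i' • ∑ s ∈ Finset.Icc ((i' - 1) * n + 1) (i' * n),
          (A • Finsupp.single (j s) (1 : ℝ) + x s)) (j (i * n + t + 1)) =
        if i + 1 = i' then b i' * A else 0 := by
      intro i' hi'
      rw [Finsupp.smul_apply, hinner i' hi', smul_eq_mul]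
      split_ifs <;> simp
    rw [Finset.sum_congr rfl h2, Finset.sum_ite_eq, if_pos]
    rw [Finset.mem_Icc]
    omega
  have hlow := ns_lower hNS v m hm (fun t => Finset.Icc (j (t + 1)) (j (t + 1)))
    (fun t => ⟨_, _, rfl⟩) (by
      intro a b hab s hs t ht
      simp only [Finset.Icc_self, Finset.mem_singleton] at hs ht
      subst hs ht
      refine (hchain2 _ ?_ _ ?_ ?_).2
      · rw [Finset.mem_Icc]; omega
      · rw [Finset.mem_Icc]; omega
      · have : (a : ℕ) < b := hab
        omega)
  refine le_trans (le_of_eq ?_) hlow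
  have hsingle : ∀ t : ℕ, NS (restrictF (Finset.Icc t t) v) = |v t| := by
    intro t
    have : restrictF (Finset.Icc t t) v = Finsupp.single t (v t) := by
      unfold restrictF
      simp
    rw [this, ns_single hNS]
  simp only [hsingle]
  rw [Fin.sum_univ_eq_sum_range (fun t => |v (j (t + 1))|) m, hmkn, sum_range_blocks]
  have h3 : ∑ i ∈ Finset.range k, ∑ t ∈ Finset.range n, |v (j (i * n + t + 1))| =
      ∑ i ∈ Finset.range k, n * |A| * |b (i + 1)| := by
    refine Finset.sum_congr rfl fun i hi => ?_
    have : ∀ t ∈ Finset.range n, |v (j (i * n + t + 1))| = |A| * |b (i + 1)| := by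
      intro t ht
      rw [hval i (Finset.mem_range.1 hi) t (Finset.mem_range.1 ht), abs_mul, mul_comm]
    rw [Finset.sum_congr rfl this, Finset.sum_const, Finset.card_range, nsmul_eq_mul, mul_assoc]
  rw [h3, ← Finset.mul_sum]
  congr 1
  rw [Finset.range_eq_Ico, Finset.sum_Ico_add' (fun i => |b i|) 0 k 1]
  rfl

end SAux

theorem snorm_sum_basis_plus_blocks_le (NS : (ℕ →₀ ℝ) → ℝ) (hNS : IsSNorm NS)
    (k m : ℕ) (hk : 1 ≤ k) (hkm : k < m)
    (C : ℝ) (hC : 1 ≤ C)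
    (ε : ℝ) (hε0 : 0 < ε) (hε1 : ε < (flog 2 - 1) / flog 2)
    (l₀ : ℕ) (hl₀ : 6 ≤ flog l₀ ∧ ∀ l : ℕ, l < l₀ → flog l < 6)
    (hdvd : k ∣ m)
    (hfm : C * max (50 / ε ^ 2)
      (flog l₀ * flog (l₀ - 1) / (flog l₀ - flog (l₀ - 1))) ≤ flog m)
    (hratio : flog m / flog (m / k) ≤ 1 + ε / 6)
    (j : ℕ → ℕ) (x : ℕ → ℕ →₀ ℝ)
    -- `e_{j_1} < x_1 < e_{j_2} < x_2 < … < e_{j_m} < x_m`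
    (hchain1 : ∀ s ∈ Finset.Icc 1 m, ∀ i ∈ (x s).support, j s < i)
    (hchain2 : ∀ s ∈ Finset.Icc 1 m, ∀ s' ∈ Finset.Icc 1 m, s < s' →
      (∀ i ∈ (x s).support, i < j s') ∧ j s < j s')
    (hx : ∀ s ∈ Finset.Icc 1 m, NS (x s) ≤ C / m) :
    NS (∑ s ∈ Finset.Icc 1 m,
        ((flog m / m) • Finsupp.single (j s) (1 : ℝ) + x s)) ≤ C * (1 + ε) ∧
    (∀ i ∈ Finset.Icc 1 k,
      NS (∑ s ∈ Finset.Icc ((i - 1) * (m / k) + 1) (i * (m / k)),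
        ((flog m / m) • Finsupp.single (j s) (1 : ℝ) + x s)) ≤ C * (1 + ε) / k) ∧
    (∀ i ∈ Finset.Icc 1 k,
      NS (((k : ℝ) / (C * (1 + ε))) • ∑ s ∈ Finset.Icc ((i - 1) * (m / k) + 1) (i * (m / k)),
        ((flog m / m) • Finsupp.single (j s) (1 : ℝ) + x s)) ≤ 1) ∧
    (∀ a : ℕ → ℝ,
      (1 / (C * (1 + ε))) * ∑ i ∈ Finset.Icc 1 k, |a i| ≤
        NS (∑ i ∈ Finset.Icc 1 k, a i • (((k : ℝ) / (C * (1 + ε))) •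
          ∑ s ∈ Finset.Icc ((i - 1) * (m / k) + 1) (i * (m / k)),
            ((flog m / m) • Finsupp.single (j s) (1 : ℝ) + x s)))) := by
  have hm2 : 2 ≤ m := by omega
  obtain ⟨n, rfl⟩ := hdvd
  have hk0 : (0 : ℝ) < k := by exact_mod_cast hk
  have hn : 1 ≤ n := by
    rcases Nat.eq_zero_or_pos n with h | h
    · subst h; omega
    · exact h
  have hn0 : (0 : ℝ) < n := by exact_mod_cast hn
  have hdiv : k * n / k = n := Nat.mul_div_cancel_left n (by omega)
  rw [hdiv]
  have hm0 : (0 : ℝ) < ((k * n : ℕ) : ℝ) := by exact_mod_cast (by omega : 0 < k * n)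
  have hmc : ((k * n : ℕ) : ℝ) = k * n := by push_cast; ring
  have hdivR : ((k * n : ℕ) : ℝ) / k = n := by rw [hmc]; field_simp
  rw [hdivR] at hratio
  have hfn : 1 ≤ flog n := SAux.one_le_flog (by exact_mod_cast hn)
  rw [div_le_iff₀ (by linarith)] at hratio
  have hfm' : C * (50 / ε ^ 2) ≤ flog ((k * n : ℕ) : ℝ) :=
    le_trans (mul_le_mul_of_nonneg_left (le_max_left _ _) (by linarith)) hfm
  have hfm1 : 1 ≤ flog ((k * n : ℕ) : ℝ) :=
    SAux.one_le_flog (by exact_mod_cast (by omega : 1 ≤ k * n))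
  have hA : NS (∑ s ∈ Finset.Icc 1 (k * n),
        ((flog ((k * n : ℕ) : ℝ) / ((k * n : ℕ) : ℝ)) • Finsupp.single (j s) (1 : ℝ) + x s))
        ≤ C * (1 + ε) := by
    have := SAux.block_le hNS (by omega) hC hε0 hε1 hfm' hchain1 hchain2 hx
      (I := Finset.Icc 1 (k * n)) subset_rfl (by simp; omega)
      (by
        rw [Nat.card_Icc, Nat.add_sub_cancel]
        nlinarith)
    rw [Nat.card_Icc, Nat.add_sub_cancel, mul_div_assoc, div_self hm0.ne', mul_one] at this
    exact this
  have hB : ∀ i ∈ Finset.Icc 1 k,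
      NS (∑ s ∈ Finset.Icc ((i - 1) * n + 1) (i * n),
        ((flog ((k * n : ℕ) : ℝ) / ((k * n : ℕ) : ℝ)) • Finsupp.single (j s) (1 : ℝ) + x s))
        ≤ C * (1 + ε) / k := by
    intro i hi
    rw [Finset.mem_Icc] at hi
    have hle : i * n ≤ k * n := Nat.mul_le_mul_right n hi.2
    have hi' : i * n = (i - 1) * n + n := by
      obtain ⟨i', rfl⟩ : ∃ i', i = i' + 1 := ⟨i - 1, by omega⟩
      rw [Nat.add_sub_cancel]
      ring
    have hcard : (Finset.Icc ((i - 1) * n + 1) (i * n)).card = n := by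
      rw [Nat.card_Icc]
      omega
    have := SAux.block_le hNS (by omega) hC hε0 hε1 hfm' hchain1 hchain2 hx
      (I := Finset.Icc ((i - 1) * n + 1) (i * n))
      (by
        intro s hs
        rw [Finset.mem_Icc] at *
        omega) (by rw [hcard]; exact hn) (by rw [hcard]; exact hratio)
    rw [hcard] at this
    refine this.trans (le_of_eq ?_)
    rw [hmc]
    field_simp
  have hCe : 0 < C * (1 + ε) := by positivity
  refine ⟨hA, hB, ?_, ?_⟩
  · intro i hi
    rw [hNS.smul, abs_of_pos (by positivity)]
    calc _ ≤ (k : ℝ) / (C * (1 + ε)) * (C * (1 + ε) / k) := by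
          gcongr
          exact hB i hi
      _ = 1 := by field_simp
  · intro a
    have hlow := SAux.lower_est hNS hm2 rfl hn hchain1 hchain2
      (fun i => a i * ((k : ℝ) / (C * (1 + ε)))) (flog ((k * n : ℕ) : ℝ) / ((k * n : ℕ) : ℝ))
    simp only [smul_smul]
    have hsum : ∑ i ∈ Finset.Icc 1 k, |a i * ((k : ℝ) / (C * (1 + ε)))| =
        (k : ℝ) / (C * (1 + ε)) * ∑ i ∈ Finset.Icc 1 k, |a i| := by
      rw [Finset.mul_sum]
      refine Finset.sum_congr rfl fun i _ => ?_
      rw [abs_mul, abs_of_pos (show 0 < (k : ℝ) / (C * (1 + ε)) by positivity), mul_comm]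
    rw [hsum, abs_of_pos (div_pos (by linarith) hm0)] at hlow
    refine le_of_mul_le_mul_left (le_trans (le_of_eq ?_) hlow)
      (show 0 < flog ((k * n : ℕ) : ℝ) by linarith)
    generalize flog ((k * n : ℕ) : ℝ) = L
    rw [hmc]
    field_simp
end

section
/- Let (ε_i)_{i≥1} ⊂ (0, (f(2)−1)/f(2)) be a summable sequence and set C_i = Π_{j≥i} (1+ε_j) for i ≥ 0. Let (m_i)_{i≥0} ⊂ ℕ be an admissible sequence satisfying, for all i ≥ 1: f(m_i) ≥ C_i·max( 50/ε_i² , f(l₀)·f(l₀−1)/(f(l₀)−f(l₀−1)) ), where l₀ = min{ l ∈ ℕ : f(l) ≥ 6 }, and f(m_i)/f(m_i/m_{i−1}) ≤ 1 + ε_i/6. Then for all 1 ≤ i ≤ j in ℕ: ‖y(m_i, m_{i+1}, …, m_j)‖_S ≤ C_i, and (1/C_i)·y(m_i, m_{i+1}, …, m_j) is an ℓ₁^{m_{i−1}}-average of constant 1/C_i. -/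
/-- The yardstick vector `y(m₁, …, m_k)`, where the *reversed* list `(m_k, …, m₁)` is given:
`yard [] = 0`, and `yard (m :: ms)` spreads out the coordinates of `yard ms` so that between two
successive nonzero coordinates there are `m / (m₁ + … + m_{k-1})` zeros, and fills the remaining
positions of the interval `[1, m₁ + … + m_k]` with the value `f(m)/m`. -/
noncomputable def yard : List ℕ → (ℕ →₀ ℝ)
  | [] => 0
  | m :: ms =>
    (∑ i ∈ Finset.Icc 1 ms.sum,
      Finsupp.single (1 + (i - 1) * (m / ms.sum)) (yard ms i)) +
    ∑ t ∈ Finset.Icc 1 (ms.sum + m) \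
        ((Finset.Icc 1 ms.sum).image fun i => 1 + (i - 1) * (m / ms.sum)),
      Finsupp.single t (flog m / m)

/-- `y(m_i, m_{i+1}, …, m_j)` for a sequence `m`. -/
noncomputable def yardstick (m : ℕ → ℕ) (i j : ℕ) : ℕ →₀ ℝ :=
  yard (((List.range (j + 1 - i)).map fun t => m (i + t)).reverse)

/-- A sequence `(m_i)_{i ≥ 0}` is admissible if each `m_i` is even and is a multiple of the
product `∏_{∅ ≠ A ⊆ {0, …, i-1}} (∑_{j ∈ A} m_j)`. -/
def Admissible (m : ℕ → ℕ) : Prop :=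
  ∀ i, 2 ∣ m i ∧
    (∏ A ∈ (Finset.range i).powerset.filter Finset.Nonempty, ∑ j ∈ A, m j) ∣ m i

/-- `x` is an `ℓ₁ⁿ`-average of constant `c` for the norm `NS`: `x = (1/n) ∑_{i=1}^n x_i` for a
block sequence `x₁ < … < x_n` in the unit ball which `(1/c)`-dominates the `ℓ₁ⁿ` unit basis. -/
def IsL1Average (NS : (ℕ →₀ ℝ) → ℝ) (n : ℕ) (c : ℝ) (x : ℕ →₀ ℝ) : Prop :=
  ∃ xs : ℕ → (ℕ →₀ ℝ),
    (∀ i ∈ Finset.Icc 1 n, NS (xs i) ≤ 1 ∧ xs i ≠ 0) ∧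
    (∀ i ∈ Finset.Icc 1 n, ∀ i' ∈ Finset.Icc 1 n, i < i' →
      ∀ s ∈ (xs i).support, ∀ t ∈ (xs i').support, s < t) ∧
    x = (1 / (n : ℝ)) • ∑ i ∈ Finset.Icc 1 n, xs i ∧
    ∀ a : ℕ → ℝ, c * ∑ i ∈ Finset.Icc 1 n, |a i| ≤
      NS (∑ i ∈ Finset.Icc 1 n, a i • xs i)

/-! ### Analytic facts on `flog` and `x / flog x` -/

/-- `x / f(x)`. -/
noncomputable def hh (x : ℝ) : ℝ := x / flog x

lemma log_two_pos' : 0 < Real.log 2 := Real.log_pos (by norm_num)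

lemma flog_mono {x y : ℝ} (hx : 0 ≤ x) (h : x ≤ y) : flog x ≤ flog y := by
  unfold flog
  exact Real.logb_le_logb_of_le (by norm_num) (by linarith) (by linarith)

lemma flog_zero : flog 0 = 0 := by simp [flog]

lemma flog_one : flog 1 = 1 := by
  unfold flog
  norm_num

lemma flog_nonneg {x : ℝ} (hx : 0 ≤ x) : 0 ≤ flog x := by
  rw [← flog_zero]; exact flog_mono le_rfl hx

lemma flog_pos {x : ℝ} (hx : 0 < x) : 0 < flog x := by
  unfold flog
  exact Real.logb_pos (by norm_num) (by linarith)

lemma one_le_flog {x : ℝ} (hx : 1 ≤ x) : 1 ≤ flog x := by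
  rw [← flog_one]; exact flog_mono (by norm_num) hx

lemma le_flog_of_pow {x c : ℝ} (hx : 0 ≤ x) (h : (2 : ℝ) ^ c ≤ x + 1) : c ≤ flog x := by
  unfold flog
  rw [Real.le_logb_iff_rpow_le (by norm_num) (by linarith)]
  exact h

lemma flog_two_ge : (19 / 12 : ℝ) ≤ flog 2 := by
  have h : (19 : ℝ) ≤ 12 * Real.logb 2 3 := by
    have := Real.logb_le_logb_of_le (b := 2) (by norm_num) (x := 2 ^ (19 : ℕ)) (y := 3 ^ (12 : ℕ))
      (by norm_num) (by norm_num)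
    rw [Real.logb_pow, Real.logb_pow] at this
    simpa using this
  unfold flog
  norm_num
  linarith

lemma flog_two_le : flog 2 ≤ (8 / 5 : ℝ) := by
  have h : 5 * Real.logb 2 3 ≤ (8 : ℝ) := by
    have := Real.logb_le_logb_of_le (b := 2) (by norm_num) (x := 3 ^ (5 : ℕ)) (y := 2 ^ (8 : ℕ))
      (by norm_num) (by norm_num)
    rw [Real.logb_pow, Real.logb_pow] at this
    simpa using this
  unfold flog
  norm_num
  linarith

lemma flog_eight_ge : (19 / 6 : ℝ) ≤ flog 8 := by
  have h := flog_two_ge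
  unfold flog at *
  have : Real.logb 2 ((8 : ℝ) + 1) = 2 * Real.logb 2 3 := by
    rw [show (8 : ℝ) + 1 = 3 ^ (2 : ℕ) by norm_num, Real.logb_pow]; norm_num
  rw [this]
  norm_num at h
  linarith

/-- `f(x)/2 ≤ f(√x)` in the form `y ≤ x²+2x → f(y) ≤ 2 f(x)`. -/
lemma flog_le_two_mul {x y : ℝ} (hy : 0 ≤ y) (h : y + 1 ≤ (x + 1) ^ 2) :
    flog y ≤ 2 * flog x := by
  unfold flog
  have := Real.logb_le_logb_of_le (b := 2) (by norm_num) (by linarith) h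
  rw [Real.logb_pow] at this
  simpa using this

lemma flog_le_self_div {x : ℝ} (hx : 0 ≤ x) : flog x ≤ (x + 1) / 10 + 4 := by
  unfold flog
  have h1 : Real.logb 2 (x + 1) = Real.logb 2 ((x + 1) / 16) + 4 := by
    rw [Real.logb_div (by linarith) (by norm_num),
      show (16 : ℝ) = 2 ^ (4 : ℕ) by norm_num, Real.logb_pow]
    simp
  have h2 : Real.log ((x + 1) / 16) ≤ (x + 1) / 16 := by
    have := Real.log_le_sub_one_of_pos (x := (x + 1) / 16) (by positivity)
    linarith
  have h3 : Real.logb 2 ((x + 1) / 16) ≤ (x + 1) / 10 := by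
    unfold Real.logb
    have := Real.log_two_gt_d9
    rw [div_le_iff₀ (by linarith)]
    nlinarith
  linarith

lemma hh_eq_integral {x : ℝ} (hx : 0 < x) :
    hh x = Real.log 2 * ∫ t in (0 : ℝ)..1, (x + 1) ^ t := by
  have hlog : 0 < Real.log (x + 1) := Real.log_pos (by linarith)
  have : ∫ t in (0 : ℝ)..1, (x + 1) ^ t = x / Real.log (x + 1) := by
    have h1 : ∀ t : ℝ, (x + 1) ^ t = Real.exp (Real.log (x + 1) * t) := fun t =>
      Real.rpow_def_of_pos (by linarith) t
    simp_rw [h1]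
    rw [intervalIntegral.integral_comp_mul_left (fun t => Real.exp t) hlog.ne', integral_exp]
    rw [mul_one, mul_zero, Real.exp_log (by linarith), Real.exp_zero, smul_eq_mul]
    field_simp
    ring
  rw [this]
  unfold hh flog Real.logb
  have := log_two_pos'
  field_simp

lemma rpow_intble {x : ℝ} (hx : 0 < x) :
    IntervalIntegrable (fun t : ℝ => (x + 1) ^ t) MeasureTheory.volume 0 1 := by
  apply Continuous.intervalIntegrable
  exact continuous_const.rpow continuous_id (fun t => Or.inl (by linarith))

lemma hh_mono {x y : ℝ} (hx : 0 ≤ x) (h : x ≤ y) : hh x ≤ hh y := by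
  rcases hx.eq_or_lt with rfl | hx
  · have : hh 0 = 0 := by simp [hh]
    rw [this]
    exact div_nonneg h (flog_nonneg h)
  · rw [hh_eq_integral hx, hh_eq_integral (hx.trans_le h)]
    apply mul_le_mul_of_nonneg_left _ log_two_pos'.le
    apply intervalIntegral.integral_mono_on (by norm_num) (rpow_intble hx)
      (rpow_intble (hx.trans_le h))
    intro t ht
    exact Real.rpow_le_rpow (by linarith) (by linarith) ht.1

lemma one_le_hh {x : ℝ} (hx : 1 ≤ x) : 1 ≤ hh x := by
  have := hh_mono (by norm_num : (0 : ℝ) ≤ 1) hx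
  simpa [hh, flog_one] using this

lemma hh_nonneg {x : ℝ} (hx : 0 ≤ x) : 0 ≤ hh x := div_nonneg hx (flog_nonneg hx)

lemma hh_le_self {x : ℝ} (hx : 1 ≤ x) : hh x ≤ x := by
  unfold hh
  exact div_le_self (by linarith) (one_le_flog hx)

/-- Jensen for `x / f(x)`. -/
lemma sum_hh_le {l : ℕ} (hl : 1 ≤ l) (x : Fin l → ℝ) (hx : ∀ p, 0 < x p) :
    ∑ p, hh (x p) ≤ l * hh ((∑ p, x p) / l) := by
  have hl0 : (0 : ℝ) < l := by exact_mod_cast hl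
  have : Nonempty (Fin l) := ⟨⟨0, hl⟩⟩
  have hS : 0 < (∑ p, x p) / l := div_pos (Finset.sum_pos (fun p _ => hx p) Finset.univ_nonempty) hl0
  rw [hh_eq_integral hS]
  simp_rw [fun p => hh_eq_integral (hx p)]
  rw [← Finset.mul_sum, ← intervalIntegral.integral_finsetSum (fun p _ => rpow_intble (hx p)),
    mul_left_comm, ← intervalIntegral.integral_const_mul (l : ℝ)]
  apply mul_le_mul_of_nonneg_left _ log_two_pos'.le
  apply intervalIntegral.integral_mono_on (by norm_num)
  · apply Continuous.intervalIntegrable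
    apply continuous_finsetSum
    intro p _
    exact continuous_const.rpow continuous_id (fun t => Or.inl (by linarith [hx p]))
  · exact (rpow_intble hS).const_mul _
  intro t ht
  have hc := (Real.concaveOn_rpow ht.1 ht.2).le_map_sum (t := Finset.univ)
    (w := fun _ : Fin l => (1 / l : ℝ)) (p := fun p => x p + 1) (fun _ _ => by positivity)
    (by simp [hl0.ne']) (fun p _ => by simp; linarith [hx p])
  simp only [smul_eq_mul] at hc
  rw [← Finset.mul_sum, ← Finset.mul_sum, Finset.sum_add_distrib] at hc
  have e : 1 / (l : ℝ) * (∑ i, x i + ∑ i : Fin l, (1 : ℝ)) = (∑ p, x p) / l + 1 := by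
    simp; field_simp
  rw [e] at hc
  calc ∑ i, (x i + 1) ^ t = l * (1 / l * ∑ i, (x i + 1) ^ t) := by field_simp
    _ ≤ _ := mul_le_mul_of_nonneg_left hc hl0.le

/-- The small-`l` estimate. -/
lemma small_l {l : ℕ} (hl : 2 ≤ l) {a : ℝ} (ha : 0 ≤ a) (hla : (l : ℝ) ^ 2 ≤ a + 4)
    (hX : 64 ≤ flog (a + 4)) :
    1.49 * flog (a + 4) ≤ flog l * flog ((a + 4) / l) := by
  have hl0 : (2 : ℝ) ≤ l := by exact_mod_cast hl
  have h1 : flog (a + 4) - Real.logb 2 l ≤ flog ((a + 4) / l) := by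
    unfold flog
    rw [← Real.logb_div (by linarith) (by linarith)]
    apply Real.logb_le_logb_of_le (by norm_num) (by positivity)
    rw [div_add_one (by linarith), div_le_div_iff_of_pos_right (by linarith)]
    linarith
  have h2 : 2 * Real.logb 2 l ≤ flog (a + 4) := by
    unfold flog
    have := Real.logb_le_logb_of_le (b := 2) (by norm_num) (by positivity)
      (hla.trans (by linarith : a + 4 ≤ a + 4 + 1))
    rw [Real.logb_pow] at this
    simpa using this
  have hu : 0 ≤ Real.logb 2 l := Real.logb_nonneg (by norm_num) (by linarith)
  have hf2 := flog_two_ge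
  have hfl : flog 2 ≤ flog l := flog_mono (by norm_num) hl0
  rcases le_total l 8 with h8 | h8
  · have : Real.logb 2 l ≤ 3 := by
      have h8' : (l : ℝ) ≤ 8 := by exact_mod_cast h8
      have := Real.logb_le_logb_of_le (b := 2) (by norm_num) (by linarith) h8'
      rw [show (8 : ℝ) = 2 ^ (3 : ℕ) by norm_num, Real.logb_pow] at this
      simpa using this
    nlinarith
  · have h8' : (8 : ℝ) ≤ l := by exact_mod_cast h8
    have : flog 8 ≤ flog l := flog_mono (by norm_num) h8'
    have := flog_eight_ge
    nlinarith

/-! ### Norm facts -/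

/-- The indicator vector of a finite set. -/
noncomputable def ind (T : Finset ℕ) : ℕ →₀ ℝ := ∑ t ∈ T, Finsupp.single t (1 : ℝ)

lemma ind_apply (T : Finset ℕ) (t : ℕ) : ind T t = if t ∈ T then 1 else 0 := by
  classical
  unfold ind
  rw [Finsupp.finsetSum_apply]
  simp [Finsupp.single_apply]

lemma restrictF_apply (E : Finset ℕ) (x : ℕ →₀ ℝ) (t : ℕ) :
    restrictF E x t = if t ∈ E then x t else 0 := by
  classical
  unfold restrictF
  rw [Finsupp.finsetSum_apply]
  simp [Finsupp.single_apply]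

lemma restrictF_ind (E T : Finset ℕ) : restrictF E (ind T) = ind (E ∩ T) := by
  ext t
  rw [restrictF_apply, ind_apply, ind_apply]
  by_cases h1 : t ∈ E <;> by_cases h2 : t ∈ T <;> simp [h1, h2]

lemma restrictF_add (E : Finset ℕ) (x y : ℕ →₀ ℝ) :
    restrictF E (x + y) = restrictF E x + restrictF E y := by
  ext t
  simp only [restrictF_apply, Finsupp.add_apply]
  split_ifs <;> simp

lemma restrictF_smul (E : Finset ℕ) (c : ℝ) (x : ℕ →₀ ℝ) :
    restrictF E (c • x) = c • restrictF E x := by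
  ext t
  simp only [restrictF_apply, Finsupp.smul_apply]
  split_ifs <;> simp

lemma restrictF_sum {ι : Type*} (E : Finset ℕ) (s : Finset ι) (x : ι → ℕ →₀ ℝ) :
    restrictF E (∑ i ∈ s, x i) = ∑ i ∈ s, restrictF E (x i) := by
  ext t
  simp only [restrictF_apply, Finsupp.finsetSum_apply]
  split_ifs <;> simp

lemma NS_zero {NS : (ℕ →₀ ℝ) → ℝ} (hNS : IsSNorm NS) : NS 0 = 0 := by
  have := hNS.smul 0 0
  simpa using this

lemma NS_sum_le {NS : (ℕ →₀ ℝ) → ℝ} (hNS : IsSNorm NS) {ι : Type*} (s : Finset ι)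
    (x : ι → ℕ →₀ ℝ) : NS (∑ i ∈ s, x i) ≤ ∑ i ∈ s, NS (x i) := by
  classical
  induction s using Finset.induction_on with
  | empty => simp [NS_zero hNS]
  | insert a s ha ih =>
    rw [Finset.sum_insert ha, Finset.sum_insert ha]
    exact (hNS.add_le _ _).trans (by linarith)

lemma NS_ind {NS : (ℕ →₀ ℝ) → ℝ} (hNS : IsSNorm NS) (T : Finset ℕ) :
    NS (ind T) = hh T.card := by
  rcases T.eq_empty_or_nonempty with rfl | hT
  · simp [ind, hh, NS_zero hNS]
  · have hc : 1 ≤ T.card := hT.card_pos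
    have hc' : (1 : ℝ) ≤ T.card := by exact_mod_cast hc
    have h := hNS.const_one T.card hc T rfl
    rw [hNS.smul] at h
    have hf := flog_pos (x := T.card) (by linarith)
    rw [abs_of_pos (by positivity)] at h
    unfold hh
    change flog T.card / T.card * NS (ind T) = 1 at h
    field_simp at h ⊢
    linarith

lemma NS_single {NS : (ℕ →₀ ℝ) → ℝ} (hNS : IsSNorm NS) (t : ℕ) (c : ℝ) :
    NS (Finsupp.single t c) = |c| := by
  have h := NS_ind hNS {t}
  have e : Finsupp.single t c = c • ind {t} := by simp [ind]
  rw [e, hNS.smul, h]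
  simp [hh, flog_one]

lemma NS_restrict_le {NS : (ℕ →₀ ℝ) → ℝ} (hNS : IsSNorm NS) (E : Finset ℕ) (x : ℕ →₀ ℝ) :
    NS (restrictF E x) ≤ ∑ t ∈ E, |x t| := by
  unfold restrictF
  refine (NS_sum_le hNS _ _).trans (le_of_eq ?_)
  exact Finset.sum_congr rfl fun t _ => NS_single hNS t _

lemma sum_restrict_bound (x : ℕ →₀ ℝ) {l : ℕ} (E : Fin l → Finset ℕ)
    (hE : ∀ i j : Fin l, i < j → ∀ s ∈ E i, ∀ t ∈ E j, s < t) :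
    ∑ p, ∑ t ∈ E p, |x t| ≤ ∑ t ∈ x.support, |x t| := by
  classical
  rw [← Finset.sum_biUnion]
  · calc ∑ t ∈ Finset.univ.biUnion E, |x t|
        = ∑ t ∈ Finset.univ.biUnion E with t ∈ x.support, |x t| := by
          rw [Finset.sum_filter]
          refine Finset.sum_congr rfl fun t _ => ?_
          by_cases h : x t = 0 <;> simp [h]
      _ ≤ _ := by
          apply Finset.sum_le_sum_of_subset_of_nonneg
          · intro t ht
            exact (Finset.mem_filter.1 ht).2
          · intros; positivity
  · intro i _ j _ hij
    rw [Function.onFun, Finset.disjoint_left]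
    intro t h1 h2
    rcases lt_or_gt_of_ne hij with h | h
    · exact absurd (hE i j h t h1 t h2) (lt_irrefl _)
    · exact absurd (hE j i h t h2 t h1) (lt_irrefl _)

lemma supNorm_bdd (x : ℕ →₀ ℝ) : BddAbove (Set.range fun i => |x i|) := by
  refine ⟨∑ t ∈ x.support, |x t|, ?_⟩
  rintro _ ⟨i, rfl⟩
  by_cases h : x i = 0
  · simp only [h, abs_zero]
    positivity
  · exact Finset.single_le_sum (f := fun t => |x t|) (fun t _ => abs_nonneg _)
      (Finsupp.mem_support_iff.2 h)

lemma abs_le_NS {NS : (ℕ →₀ ℝ) → ℝ} (hNS : IsSNorm NS) (x : ℕ →₀ ℝ) (t : ℕ) : |x t| ≤ NS x := by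
  rw [hNS.implicit x]
  exact le_max_of_le_left (le_csSup (supNorm_bdd x) ⟨t, rfl⟩)

lemma NS_lower {NS : (ℕ →₀ ℝ) → ℝ} (hNS : IsSNorm NS) (x : ℕ →₀ ℝ) {l : ℕ} (hl : 2 ≤ l)
    (E : Fin l → Finset ℕ) (hI : ∀ i, IsNatInterval (E i))
    (hE : ∀ i j : Fin l, i < j → ∀ s ∈ E i, ∀ t ∈ E j, s < t) :
    (1 / flog l) * ∑ i, NS (restrictF (E i) x) ≤ NS x := by
  rw [hNS.implicit x]
  apply le_max_of_le_right
  apply le_csSup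
  · refine ⟨∑ t ∈ x.support, |x t|, ?_⟩
    rintro r ⟨l', hl', E', _, hE', rfl⟩
    have h1 : 1 ≤ flog (l' : ℝ) := one_le_flog (by exact_mod_cast (by omega : 1 ≤ l'))
    have h2 : ∑ i, NS (restrictF (E' i) x) ≤ ∑ t ∈ x.support, |x t| :=
      (Finset.sum_le_sum fun i _ => NS_restrict_le hNS (E' i) x).trans (sum_restrict_bound x E' hE')
    have h3 : 0 ≤ ∑ i, NS (restrictF (E' i) x) := Finset.sum_nonneg fun i _ => hNS.nonneg _
    calc 1 / flog l' * ∑ i, NS (restrictF (E' i) x) ≤ 1 * ∑ i, NS (restrictF (E' i) x) := by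
          apply mul_le_mul_of_nonneg_right _ h3
          rw [div_le_one (by linarith)]
          exact h1
      _ ≤ _ := by linarith
  · exact ⟨l, hl, E, hI, hE, rfl⟩

lemma NS_upper {NS : (ℕ →₀ ℝ) → ℝ} (hNS : IsSNorm NS) (x : ℕ →₀ ℝ) {B : ℝ} (hB : 0 ≤ B)
    (hsup : ∀ t, |x t| ≤ B)
    (h : ∀ l : ℕ, 2 ≤ l → ∀ E : Fin l → Finset ℕ, (∀ i, IsNatInterval (E i)) →
      (∀ i j : Fin l, i < j → ∀ s ∈ E i, ∀ t ∈ E j, s < t) →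
      (1 / flog l) * ∑ i, NS (restrictF (E i) x) ≤ B) : NS x ≤ B := by
  rw [hNS.implicit x]
  apply max_le
  · apply Real.sSup_le _ hB
    rintro _ ⟨t, rfl⟩
    exact hsup t
  · apply Real.sSup_le _ hB
    rintro r ⟨l, hl, E, hI, hE, rfl⟩
    exact h l hl E hI hE

/-- Lower bound by sets of coordinates. -/
lemma NS_coord_lower {NS : (ℕ →₀ ℝ) → ℝ} (hNS : IsSNorm NS) (x : ℕ →₀ ℝ) (T : Finset ℕ)
    (hT : 2 ≤ T.card) : (1 / flog T.card) * ∑ t ∈ T, |x t| ≤ NS x := by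
  have h := NS_lower hNS x hT (fun p => {T.orderEmbOfFin rfl p})
    (fun p => ⟨T.orderEmbOfFin rfl p, T.orderEmbOfFin rfl p, by simp⟩)
    (by
      intro i j hij s hs t ht
      simp only [Finset.mem_singleton] at hs ht
      rw [hs, ht]
      exact (T.orderEmbOfFin rfl).strictMono hij)
  refine le_trans (le_of_eq ?_) h
  congr 1
  have e : ∑ t ∈ T, |x t| = ∑ t ∈ Finset.univ.map (T.orderEmbOfFin rfl).toEmbedding, |x t| := by
    rw [Finset.map_orderEmbOfFin_univ]
  rw [e, Finset.sum_map]
  refine Finset.sum_congr rfl fun p _ => ?_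
  simp [restrictF, NS_single hNS]

/-! ### Growth of the sequence -/

/-- The growth conditions which are used. -/
structure Grow (ε : ℕ → ℝ) (m : ℕ → ℕ) : Prop where
  eps : ∀ k, 1 ≤ k → 0 < ε k ∧ ε k ≤ 3 / 8
  big : ∀ k, 1 ≤ k → 50 ≤ ε k ^ 2 * flog (m k)
  ratio : ∀ k, flog (m (k + 1)) ≤ (1 + ε (k + 1) / 6) * flog (m (k + 1) / m k)
  pos : ∀ k, 1 ≤ m k
  dvd : ∀ k, m k ∣ m (k + 1)

namespace Grow

variable {ε : ℕ → ℝ} {m : ℕ → ℕ}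

lemma mono (G : Grow ε m) : Monotone m :=
  monotone_nat_of_le_succ fun k => Nat.le_of_dvd (G.pos _) (G.dvd k)

lemma posR (G : Grow ε m) (k : ℕ) : (1 : ℝ) ≤ m k := by exact_mod_cast G.pos k

lemma monoR (G : Grow ε m) {k k' : ℕ} (h : k ≤ k') : (m k : ℝ) ≤ m k' := by
  exact_mod_cast G.mono h

lemma Fpos (G : Grow ε m) (k : ℕ) : 0 < flog (m k) := flog_pos (by linarith [G.posR k])

lemma F_ge (G : Grow ε m) {k : ℕ} (hk : 1 ≤ k) : 355 ≤ flog (m k) := by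
  have h1 := G.eps k hk
  have h2 := G.big k hk
  have h3 := G.Fpos k
  have : ε k ^ 2 ≤ 9 / 64 := by nlinarith
  nlinarith

/-- `ε F ≥ 133`. -/
lemma epsF (G : Grow ε m) {k : ℕ} (hk : 1 ≤ k) : 133 ≤ ε k * flog (m k) := by
  have h1 := G.eps k hk
  have h2 := G.big k hk
  have h3 := G.Fpos k
  have h4 : 0 < ε k * flog (m k) := mul_pos h1.1 h3
  nlinarith

lemma Fprev (G : Grow ε m) (k : ℕ) : flog (m k) ≤ 0.19 * ε (k + 1) * flog (m (k + 1)) := by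
  have h0 := G.posR k
  have h0' := G.posR (k + 1)
  have hm := G.monoR (Nat.le_succ k)
  have e := G.eps (k + 1) (by omega)
  have r := G.ratio k
  have b := G.epsF (k := k + 1) (by omega)
  have h1 : flog (m (k + 1) / m k) ≤ flog (m (k + 1)) - flog (m k) + 2 := by
    unfold flog
    have e1 : Real.logb 2 ((m k : ℝ) + 1) ≤ 1 + Real.logb 2 (m k) := by
      have := Real.logb_le_logb_of_le (b := 2) (by norm_num) (by linarith)
        (by linarith : (m k : ℝ) + 1 ≤ 2 * m k)
      rw [Real.logb_mul (by norm_num) (by linarith)] at this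
      simpa using this
    have e2 : Real.logb 2 ((m (k + 1) : ℝ) / m k + 1) ≤
        1 + Real.logb 2 (m (k + 1) + 1) - Real.logb 2 (m k) := by
      have := Real.logb_le_logb_of_le (b := 2) (by norm_num) (by positivity)
        (show (m (k + 1) : ℝ) / m k + 1 ≤ 2 * (m (k + 1) + 1) / m k by
          rw [div_add_one (by linarith), div_le_div_iff_of_pos_right (by linarith)]
          linarith)
      rw [Real.logb_div (by linarith) (by linarith),
        Real.logb_mul (by norm_num) (by linarith)] at this
      simpa using this
    linarith
  have h2 : flog (m (k + 1)) ≤ (1 + ε (k + 1) / 6) *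
      (flog (m (k + 1)) - flog (m k) + 2) :=
    r.trans (mul_le_mul_of_nonneg_left h1 (by linarith))
  have h3 := G.Fpos k
  have h4 : 0 ≤ ε (k + 1) * flog (m k) := mul_nonneg e.1.le h3.le
  nlinarith

lemma F14 (G : Grow ε m) (k : ℕ) : 14 * flog (m k) ≤ flog (m (k + 1)) := by
  have h1 := G.Fprev k
  have e := G.eps (k + 1) (by omega)
  have h3 := G.Fpos (k + 1)
  nlinarith

lemma Fmono (G : Grow ε m) {k k' : ℕ} (h : k ≤ k') : flog (m k) ≤ flog (m k') :=
  flog_mono (by linarith [G.posR k]) (G.monoR h)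

lemma sumF (G : Grow ε m) (i k : ℕ) (h : i ≤ k) :
    ∑ k' ∈ Finset.Ico i (k + 1), flog (m k') ≤ 14 / 13 * flog (m k) := by
  induction k, h using Nat.le_induction with
  | base => simp; linarith [G.Fpos i]
  | succ k hk ih =>
    rw [Finset.sum_Ico_succ_top (by omega)]
    have := G.F14 k
    linarith

/-- `F_k ≤ m_k / m_{k-1}`. -/
lemma F_le_quot (G : Grow ε m) (k : ℕ) : flog (m (k + 1)) ≤ m (k + 1) / m k := by
  by_contra hcon
  push Not at hcon
  have h0 := G.posR k
  have h0' := G.posR (k + 1)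
  have hq : (0 : ℝ) ≤ m (k + 1) / m k := by positivity
  have h1 := flog_mono hq hcon.le
  have h2 := flog_le_self_div (G.Fpos (k + 1)).le
  have r := G.ratio k
  have e := G.eps (k + 1) (by omega)
  have h3 := G.F_ge (k := k + 1) (by omega)
  have h4 := flog_nonneg hq
  nlinarith

/-- `(m_k+1)^4 ≤ m_{k+1} + 1`. -/
lemma pow_le (G : Grow ε m) (k : ℕ) : (m k + 1) ^ 4 ≤ m (k + 1) + 1 := by
  have h := G.F14 k
  have h3 := G.Fpos k
  have h0 := G.posR k
  have h0' := G.posR (k + 1)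
  unfold flog at h h3
  have : Real.logb 2 (((m k : ℝ) + 1) ^ 4) ≤ Real.logb 2 (m (k + 1) + 1) := by
    rw [Real.logb_pow]
    push_cast
    linarith
  rw [Real.logb_le_logb (by norm_num) (by positivity) (by positivity)] at this
  exact_mod_cast this

end Grow

/-! ### Abstract systems of levels -/

/-- Level sets `A k`, `i0 ≤ k ≤ j`, uniformly spread. -/
structure Sys (m : ℕ → ℕ) (A : ℕ → Finset ℕ) (i0 j : ℕ) : Prop where
  card : ∀ k, i0 ≤ k → k ≤ j → (A k).card = m k
  disj : ∀ k k', i0 ≤ k → k < k' → k' ≤ j → Disjoint (A k) (A k')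
  unif : ∀ k k', i0 ≤ k → k ≤ k' → k' ≤ j → ∀ a b,
    (Finset.Icc a b ∩ A k').card * m k ≤ m k' * ((Finset.Icc a b ∩ A k).card + 4)

/-- The part of the vector of levels `≥ k`, restricted to `E`. -/
noncomputable def WW (m : ℕ → ℕ) (A : ℕ → Finset ℕ) (j : ℕ) (E : Finset ℕ) (k : ℕ) : ℕ →₀ ℝ :=
  ∑ k' ∈ Finset.Icc k j, (flog (m k') / m k') • ind (E ∩ A k')

lemma WW_restrict (m : ℕ → ℕ) (A : ℕ → Finset ℕ) (j : ℕ) (E E' : Finset ℕ) (k : ℕ) :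
    restrictF E' (WW m A j E k) = WW m A j (E' ∩ E) k := by
  unfold WW
  rw [restrictF_sum]
  refine Finset.sum_congr rfl fun k' _ => ?_
  rw [restrictF_smul, restrictF_ind, Finset.inter_assoc]

lemma WW_split (m : ℕ → ℕ) (A : ℕ → Finset ℕ) (j : ℕ) (E : Finset ℕ) {i k : ℕ} (hik : i ≤ k)
    (hkj : k ≤ j) :
    WW m A j E i = ∑ k' ∈ Finset.Ico i k, (flog (m k') / m k') • ind (E ∩ A k')
      + (flog (m k) / m k) • ind (E ∩ A k) + WW m A j E (k + 1) := by
  unfold WW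
  have e1 : Finset.Icc i j = Finset.Ico i (j + 1) := by ext; simp
  have e2 : Finset.Icc (k + 1) j = Finset.Ico (k + 1) (j + 1) := by ext; simp
  rw [e1, e2, ← Finset.sum_Ico_consecutive _ hik (by omega : k ≤ j + 1),
    Finset.sum_eq_sum_Ico_succ_bot (by omega : k < j + 1), add_assoc]

lemma WW_top (m : ℕ → ℕ) (A : ℕ → Finset ℕ) (j : ℕ) (E : Finset ℕ) :
    WW m A j E (j + 1) = 0 := by
  unfold WW
  simp

lemma inter_interval {E E' : Finset ℕ} (h : IsNatInterval E) (h' : IsNatInterval E') :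
    IsNatInterval (E ∩ E') := by
  obtain ⟨a, b, rfl⟩ := h
  obtain ⟨c, d, rfl⟩ := h'
  exact ⟨max a c, min b d, by ext; simp; omega⟩

lemma sum_card_le {l : ℕ} (E : Fin l → Finset ℕ) (F T : Finset ℕ)
    (hE : ∀ i j : Fin l, i < j → ∀ s ∈ E i, ∀ t ∈ E j, s < t) :
    ∑ p, (((E p ∩ F) ∩ T).card : ℝ) ≤ ((F ∩ T).card : ℝ) := by
  classical
  have : ∑ p, ((E p ∩ F) ∩ T).card = (Finset.univ.biUnion fun p => (E p ∩ F) ∩ T).card := by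
    rw [Finset.card_biUnion]
    intro i _ j _ hij
    rw [Function.onFun, Finset.disjoint_left]
    intro t h1 h2
    simp only [Finset.mem_inter] at h1 h2
    rcases lt_or_gt_of_ne hij with h | h
    · exact absurd (hE i j h t h1.1.1 t h2.1.1) (lt_irrefl _)
    · exact absurd (hE j i h t h2.1.1 t h1.1.1) (lt_irrefl _)
  have h2 : (Finset.univ.biUnion fun p => (E p ∩ F) ∩ T).card ≤ (F ∩ T).card := by
    apply Finset.card_le_card
    intro t
    simp only [Finset.mem_biUnion, Finset.mem_inter]
    rintro ⟨p, _, h⟩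
    exact ⟨h.1.2, h.2⟩
  rw [← this] at h2
  exact_mod_cast h2

section Main

variable {NS : (ℕ →₀ ℝ) → ℝ} {ε : ℕ → ℝ} {m : ℕ → ℕ} {A : ℕ → Finset ℕ} {i0 j : ℕ}

/-- Number of points of level `k` in `E`. -/
noncomputable def bc (A : ℕ → Finset ℕ) (E : Finset ℕ) (k : ℕ) : ℝ := ((E ∩ A k).card : ℝ)

lemma bc_nonneg (E : Finset ℕ) (k : ℕ) : 0 ≤ bc A E k := Nat.cast_nonneg _

lemma bc_le (S : Sys m A i0 j) (E : Finset ℕ) {k : ℕ} (h1 : i0 ≤ k) (h2 : k ≤ j) :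
    bc A E k ≤ m k := by
  unfold bc
  rw [← S.card k h1 h2]
  exact_mod_cast Finset.card_le_card Finset.inter_subset_right

lemma unifR (G : Grow ε m) (S : Sys m A i0 j) {E : Finset ℕ} (hE : IsNatInterval E) {k k' : ℕ}
    (h1 : i0 ≤ k) (h2 : k ≤ k') (h3 : k' ≤ j) :
    bc A E k' ≤ (bc A E k + 4) / m k * m k' := by
  obtain ⟨a, b, rfl⟩ := hE
  have h := S.unif k k' h1 h2 h3 a b
  have h' : bc A (Finset.Icc a b) k' * m k ≤ m k' * (bc A (Finset.Icc a b) k + 4) := by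
    unfold bc
    exact_mod_cast h
  have := G.posR k
  rw [div_mul_eq_mul_div, le_div_iff₀ (by linarith)]
  linarith

lemma NS_piece (hNS : IsSNorm NS) (G : Grow ε m) (E : Finset ℕ) (k : ℕ) :
    NS ((flog (m k) / m k) • ind (E ∩ A k)) = flog (m k) / m k * hh (bc A E k) := by
  rw [hNS.smul, NS_ind hNS, abs_of_nonneg]
  · rfl
  · have := G.Fpos k
    have := G.posR k
    positivity

lemma hh_bc_le (E : Finset ℕ) (k : ℕ) : hh (bc A E k) ≤ bc A E k := by
  unfold bc
  rcases Nat.eq_zero_or_pos (E ∩ A k).card with h | h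
  · rw [h]; simp [hh]
  · exact hh_le_self (by exact_mod_cast h)

lemma sumL (G : Grow ε m) (R : ℝ) (hR : 0 ≤ R) (k : ℕ)
    (H : ∀ E, IsNatInterval E → NS (WW m A j E k) ≤ R * (flog (m k) / m k * hh (bc A E k + 4)))
    {E : Finset ℕ} (hE : IsNatInterval E) {l : ℕ} (hl : 2 ≤ l) (P : Fin l → Finset ℕ)
    (hI : ∀ i, IsNatInterval (P i))
    (hP : ∀ i j : Fin l, i < j → ∀ s ∈ P i, ∀ t ∈ P j, s < t) {β : ℝ} (hβ : bc A E k ≤ β) :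
    ∑ p, NS (WW m A j (P p ∩ E) k) ≤
      R * (flog (m k) / m k * ((β + 4 * l) / flog ((β + 4 * l) / l))) := by
  have hl0 : (2 : ℝ) ≤ l := by exact_mod_cast hl
  have hF := G.Fpos k
  have hm := G.posR k
  have h1 : ∑ p, hh (bc A (P p ∩ E) k + 4) ≤ (β + 4 * l) / flog ((β + 4 * l) / l) := by
    have h2 := sum_hh_le (by omega : 1 ≤ l) (fun p => bc A (P p ∩ E) k + 4)
      (fun p => by linarith [bc_nonneg (A := A) (P p ∩ E) k])
    have h3 : ∑ p, (bc A (P p ∩ E) k + 4) ≤ β + 4 * l := by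
      rw [Finset.sum_add_distrib]
      have := sum_card_le P E (A k) hP
      simp only [Finset.sum_const, Finset.card_univ, Fintype.card_fin, nsmul_eq_mul]
      unfold bc at hβ ⊢
      linarith
    have h4 : 0 ≤ ∑ p, (bc A (P p ∩ E) k + 4) :=
      Finset.sum_nonneg fun p _ => by linarith [bc_nonneg (A := A) (P p ∩ E) k]
    refine h2.trans ?_
    have h5 : hh ((∑ p, (bc A (P p ∩ E) k + 4)) / l) ≤ hh ((β + 4 * l) / l) :=
      hh_mono (by positivity) (div_le_div_of_nonneg_right h3 (by linarith))
    refine (mul_le_mul_of_nonneg_left h5 (by linarith)).trans (le_of_eq ?_)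
    unfold hh
    field_simp
  calc ∑ p, NS (WW m A j (P p ∩ E) k)
      ≤ ∑ p, R * (flog (m k) / m k * hh (bc A (P p ∩ E) k + 4)) :=
        Finset.sum_le_sum fun p _ => H _ (inter_interval (hI p) hE)
    _ = R * (flog (m k) / m k * ∑ p, hh (bc A (P p ∩ E) k + 4)) := by
        rw [Finset.mul_sum, Finset.mul_sum]
    _ ≤ _ := by
        apply mul_le_mul_of_nonneg_left _ hR
        apply mul_le_mul_of_nonneg_left h1
        positivity

lemma large_of_flog {a : ℝ} (ha : 0 ≤ a) (hX : 64 ≤ flog (a + 4)) : 1000000 ≤ a + 4 := by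
  unfold flog at hX
  rw [Real.le_logb_iff_rpow_le (by norm_num) (by linarith)] at hX
  have : (2 : ℝ) ^ (64 : ℝ) = 18446744073709551616 := by
    rw [show (64 : ℝ) = ((64 : ℕ) : ℝ) by norm_num, Real.rpow_natCast]; norm_num
  linarith

lemma small_case (G : Grow ε m) (R : ℝ) (hR : 0 ≤ R) (k : ℕ)
    (H : ∀ E, IsNatInterval E → NS (WW m A j E k) ≤ R * (flog (m k) / m k * hh (bc A E k + 4)))
    {E : Finset ℕ} (hE : IsNatInterval E) {l : ℕ} (hl : 2 ≤ l) (P : Fin l → Finset ℕ)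
    (hI : ∀ i, IsNatInterval (P i))
    (hP : ∀ i j : Fin l, i < j → ∀ s ∈ P i, ∀ t ∈ P j, s < t)
    (hX : 64 ≤ flog (bc A E k + 4)) (hla : (l : ℝ) ^ 2 ≤ bc A E k + 4) :
    1 / flog l * ∑ p, NS (WW m A j (P p ∩ E) k) ≤
      R / 1.48 * (flog (m k) / m k * hh (bc A E k + 4)) := by
  have h0 := sumL G R hR k H hE hl P hI hP (le_refl (bc A E k))
  have ha := bc_nonneg (A := A) E k
  have hs := small_l hl ha hla hX
  have hbig := large_of_flog ha hX
  set a := bc A E k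
  have hl0 : (2 : ℝ) ≤ l := by exact_mod_cast hl
  have hF := G.Fpos k
  have hm := G.posR k
  have hfl : 0 < flog (l : ℝ) := flog_pos (by linarith)
  have h1 : a + 4 * l ≤ 1.006 * (a + 4) := by
    rcases le_total (l : ℝ) 667 with h | h <;> nlinarith
  have hq : 0 < flog ((a + 4) / l) := flog_pos (by positivity)
  have h2 : flog ((a + 4) / l) ≤ flog ((a + 4 * l) / l) := by
    apply flog_mono (by positivity)
    apply div_le_div_of_nonneg_right _ (by linarith)
    linarith
  have h3 : 1 / flog l * ((a + 4 * l) / flog ((a + 4 * l) / l)) ≤ 1 / 1.48 * hh (a + 4) := by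
    calc 1 / flog l * ((a + 4 * l) / flog ((a + 4 * l) / l))
        ≤ 1 / flog l * ((1.006 * (a + 4)) / flog ((a + 4) / l)) := by
          gcongr
      _ = 1.006 * (a + 4) / (flog l * flog ((a + 4) / l)) := by field_simp
      _ ≤ 1.006 * (a + 4) / (1.49 * flog (a + 4)) := by
          gcongr
      _ ≤ 1 / 1.48 * hh (a + 4) := by
          unfold hh
          rw [div_mul_div_comm, div_le_div_iff₀ (by positivity) (by positivity)]
          have : 0 < (a + 4) * flog (a + 4) := by positivity
          nlinarith
  have hc : 0 ≤ R * (flog (m k) / m k) := by positivity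
  calc 1 / flog l * ∑ p, NS (WW m A j (P p ∩ E) k)
      ≤ 1 / flog l * (R * (flog (m k) / m k * ((a + 4 * l) / flog ((a + 4 * l) / l)))) := by
        gcongr
    _ = R * (flog (m k) / m k) * (1 / flog l * ((a + 4 * l) / flog ((a + 4 * l) / l))) := by ring
    _ ≤ R * (flog (m k) / m k) * (1 / 1.48 * hh (a + 4)) := mul_le_mul_of_nonneg_left h3 hc
    _ = _ := by ring

lemma tail_bound (G : Grow ε m) (k : ℕ)
    (H : ∀ E, IsNatInterval E →
      NS (WW m A j E (k + 1)) ≤ 1.4 * (flog (m (k + 1)) / m (k + 1) * hh (bc A E (k + 1) + 4)))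
    {E : Finset ℕ} (hE : IsNatInterval E) {l : ℕ} (hl : 2 ≤ l) (P : Fin l → Finset ℕ)
    (hI : ∀ i, IsNatInterval (P i))
    (hP : ∀ i j : Fin l, i < j → ∀ s ∈ P i, ∀ t ∈ P j, s < t)
    {θ : ℝ} (hβ : bc A E (k + 1) ≤ θ * m (k + 1)) (hlθ : (l : ℝ) ≤ θ * √(m (k + 1))) :
    ∑ p, NS (WW m A j (P p ∩ E) (k + 1)) ≤ 3 * θ := by
  have h0 := sumL G 1.4 (by norm_num) (k + 1) H hE hl P hI hP hβ
  refine h0.trans ?_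
  have hl0 : (2 : ℝ) ≤ l := by exact_mod_cast hl
  have hF := G.F_ge (k := k + 1) (by omega)
  have hm := G.posR (k + 1)
  have hbig := flog_le_self_div (x := m (k + 1)) (by linarith)
  set s := √(m (k + 1) : ℝ) with hs
  set M : ℝ := (m (k + 1) : ℝ) with hM
  have hss : s * s = M := Real.mul_self_sqrt (by linarith)
  have hs0 : 59 ≤ s := by
    apply Real.le_sqrt_of_sq_le
    change (59 : ℝ) ^ 2 ≤ M
    linarith
  have hθ : 0 < θ := by
    by_contra h
    push Not at h
    nlinarith
  have h1 : flog M / 2 ≤ flog s := by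
    have := flog_le_two_mul (x := s) (y := M) (by linarith) (by nlinarith)
    linarith
  have h2 : flog s ≤ flog ((θ * M + 4 * l) / l) := by
    apply flog_mono (by linarith)
    rw [le_div_iff₀ (by linarith)]
    nlinarith
  calc 1.4 * (flog M / M * ((θ * M + 4 * l) / flog ((θ * M + 4 * l) / l)))
      ≤ 1.4 * (flog M / M * ((θ * M + 4 * (θ * s)) / (flog M / 2))) := by
        gcongr
        linarith
    _ = 2.8 * θ * (1 + 4 * s / M) := by
        field_simp
        ring
    _ ≤ 2.8 * θ * (1 + 4 / 59) := by
        gcongr 2.8 * θ * (1 + ?_)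
        rw [div_le_div_iff₀ (by linarith) (by norm_num)]
        nlinarith
    _ ≤ 3 * θ := by linarith

lemma mid_bound (hNS : IsSNorm NS) (G : Grow ε m) (k : ℕ) (E : Finset ℕ) {l : ℕ} (hl : 2 ≤ l)
    (P : Fin l → Finset ℕ) (hI : ∀ i, IsNatInterval (P i))
    (hP : ∀ i j : Fin l, i < j → ∀ s ∈ P i, ∀ t ∈ P j, s < t) :
    1 / flog l * ∑ p, NS ((flog (m k) / m k) • ind ((P p ∩ E) ∩ A k)) ≤
      flog (m k) / m k * hh (bc A E k) := by
  have := NS_lower hNS ((flog (m k) / m k) • ind (E ∩ A k)) hl P hI hP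
  rw [NS_piece hNS G] at this
  refine le_trans (le_of_eq ?_) this
  congr 1
  refine Finset.sum_congr rfl fun p _ => ?_
  rw [restrictF_smul, restrictF_ind, Finset.inter_assoc]

lemma low_bound (hNS : IsSNorm NS) (G : Grow ε m) (i k : ℕ) (E : Finset ℕ) {l : ℕ}
    (P : Fin l → Finset ℕ)
    (hP : ∀ i j : Fin l, i < j → ∀ s ∈ P i, ∀ t ∈ P j, s < t) {θ : ℝ}
    (hb : ∀ k', i ≤ k' → k' < k → bc A E k' ≤ θ * m k') :
    ∑ p, NS (∑ k' ∈ Finset.Ico i k, (flog (m k') / m k') • ind ((P p ∩ E) ∩ A k')) ≤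
      θ * ∑ k' ∈ Finset.Ico i k, flog (m k') := by
  calc ∑ p, NS (∑ k' ∈ Finset.Ico i k, (flog (m k') / m k') • ind ((P p ∩ E) ∩ A k'))
      ≤ ∑ p, ∑ k' ∈ Finset.Ico i k, flog (m k') / m k' * bc A (P p ∩ E) k' := by
        refine Finset.sum_le_sum fun p _ => (NS_sum_le hNS _ _).trans ?_
        refine Finset.sum_le_sum fun k' _ => ?_
        rw [NS_piece hNS G]
        have := G.Fpos k'
        have := G.posR k'
        exact mul_le_mul_of_nonneg_left (hh_bc_le _ _) (by positivity)
    _ = ∑ k' ∈ Finset.Ico i k, flog (m k') / m k' * ∑ p, bc A (P p ∩ E) k' := by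
        rw [Finset.sum_comm]
        simp_rw [Finset.mul_sum]
    _ ≤ ∑ k' ∈ Finset.Ico i k, θ * flog (m k') := by
        refine Finset.sum_le_sum fun k' hk' => ?_
        rw [Finset.mem_Ico] at hk'
        have h1 := G.Fpos k'
        have h2 := G.posR k'
        have h3 : ∑ p, bc A (P p ∩ E) k' ≤ θ * m k' :=
          (sum_card_le P E (A k') hP).trans (hb k' hk'.1 hk'.2)
        calc flog (m k') / m k' * ∑ p, bc A (P p ∩ E) k'
            ≤ flog (m k') / m k' * (θ * m k') := by gcongr
          _ = θ * flog (m k') := by field_simp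
    _ = _ := by rw [Finset.mul_sum]

lemma quot_bound (G : Grow ε m) {i k : ℕ} (hik : i ≤ k) {x : ℝ}
    (hx : (m (k + 1) : ℝ) / m i ≤ x) :
    flog (m (k + 1)) / flog x ≤ 1 + ε (k + 1) / 6 := by
  have h0 := G.posR k
  have h0' := G.posR (k + 1)
  have h0i := G.posR i
  have hq : (0 : ℝ) < m (k + 1) / m k := by positivity
  have h1 : (m (k + 1) : ℝ) / m k ≤ x :=
    le_trans (div_le_div_of_nonneg_left (by linarith) (by linarith) (G.monoR hik)) hx
  have h2 := flog_mono hq.le h1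
  have h3 := flog_pos hq
  have e := G.eps (k + 1) (by omega)
  rw [div_le_iff₀ (by linarith)]
  exact (G.ratio k).trans (mul_le_mul_of_nonneg_left h2 (by linarith))

lemma flog_l_bound (G : Grow ε m) {i k : ℕ} (hik : i ≤ k) {l : ℕ} {θ : ℝ}
    (hθ : 1 / (m i : ℝ) ≤ θ) (hl : θ * √(m (k + 1)) < l) :
    0.4 * flog (m (k + 1)) ≤ flog l := by
  have h0i := G.posR i
  have h0 := G.posR (k + 1)
  have h14 := G.F14 k
  have hF := G.F_ge (k := k + 1) (by omega)
  have hmono := G.Fmono hik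
  have hs : 0 < √(m (k + 1) : ℝ) := Real.sqrt_pos.2 (by linarith)
  have h1 : √(m (k + 1) : ℝ) / m i ≤ l + 1 := by
    have : 1 / (m i : ℝ) * √(m (k + 1)) ≤ θ * √(m (k + 1)) :=
      mul_le_mul_of_nonneg_right hθ hs.le
    rw [one_div_mul_eq_div] at this
    linarith
  have h2 := Real.logb_le_logb_of_le (b := 2) (by norm_num) (by positivity) h1
  rw [Real.logb_div hs.ne' (by linarith)] at h2
  have h3 : Real.logb 2 (m i) ≤ flog (m i) := by
    unfold flog
    exact Real.logb_le_logb_of_le (by norm_num) (by linarith) (by linarith)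
  have h4 : flog (m (k + 1)) ≤ 1 + 2 * Real.logb 2 (√(m (k + 1))) := by
    have e1 : Real.logb 2 ((m (k + 1) : ℝ) + 1) ≤ 1 + Real.logb 2 (m (k + 1)) := by
      have := Real.logb_le_logb_of_le (b := 2) (by norm_num) (by linarith)
        (by linarith : (m (k + 1) : ℝ) + 1 ≤ 2 * m (k + 1))
      rw [Real.logb_mul (by norm_num) (by linarith)] at this
      simpa using this
    have e2 : Real.logb 2 (m (k + 1)) = 2 * Real.logb 2 (√(m (k + 1))) := by
      conv_lhs => rw [← Real.sq_sqrt (show (0 : ℝ) ≤ m (k + 1) by linarith)]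
      rw [Real.logb_pow]
      norm_num
    unfold flog
    linarith
  have h5 : flog l = Real.logb 2 (l + 1) := rfl
  rw [h5]
  linarith

lemma large_case (hNS : IsSNorm NS) (G : Grow ε m) (S : Sys m A i0 j) {i : ℕ}
    (h1 : i0 ≤ i) (h2 : i ≤ j)
    (H : ∀ k, i < k → k ≤ j → ∀ E, IsNatInterval E →
      NS (WW m A j E k) ≤ 1.4 * (flog (m k) / m k * hh (bc A E k + 4)))
    {E : Finset ℕ} (hE : IsNatInterval E) {l : ℕ} (hl : 2 ≤ l) (P : Fin l → Finset ℕ)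
    (hI : ∀ i, IsNatInterval (P i))
    (hP : ∀ i j : Fin l, i < j → ∀ s ∈ P i, ∀ t ∈ P j, s < t)
    {θ : ℝ} (hθ : θ = (bc A E i + 4) / m i)
    (hla : bc A E i + 4 < (l : ℝ) ^ 2) :
    1 / flog l * ∑ p, NS (WW m A j (P p ∩ E) i) ≤
      θ * (flog (m i) + 6) / flog (bc A E i + 4) ∨
    ∃ k, i < k ∧ k ≤ j ∧
      1 / flog l * ∑ p, NS (WW m A j (P p ∩ E) i) ≤ θ * (1 + 0.75 * ε k) := by
  classical
  have hl0 : (2 : ℝ) ≤ l := by exact_mod_cast hl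
  have ha := bc_nonneg (A := A) E i
  have hmi := G.posR i
  have hFi := G.Fpos i
  have hθm : θ * m i = bc A E i + 4 := by rw [hθ]; field_simp
  have hθ1 : 1 / (m i : ℝ) ≤ θ := by
    rw [hθ]
    exact div_le_div_of_nonneg_right (by linarith) (by linarith)
  have hθ0 : 0 < θ := lt_of_lt_of_le (by positivity) hθ1
  have hfl : 0 < flog (l : ℝ) := flog_pos (by linarith)
  have hb : ∀ k', i ≤ k' → k' ≤ j → bc A E k' ≤ θ * m k' := fun k' hk hk' => by
    rw [hθ]; exact unifR G S hE h1 hk hk'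
  have hex : ∃ k, i ≤ k ∧ (k = j ∨ (l : ℝ) ≤ θ * √(m (k + 1))) := ⟨j, h2, Or.inl rfl⟩
  set k := Nat.find hex with hk
  have hkP := Nat.find_spec hex
  rw [← hk] at hkP
  have hkj : k ≤ j := Nat.find_min' hex ⟨h2, Or.inl rfl⟩
  have htail : ∑ p, NS (WW m A j (P p ∩ E) (k + 1)) ≤ 3 * θ := by
    by_cases hkj' : k = j
    · rw [hkj']
      simp only [WW_top, NS_zero hNS, Finset.sum_const_zero]
      linarith
    · rcases hkP.2 with h | h
      · exact absurd h hkj'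
      · exact tail_bound G k (H (k + 1) (by omega) (by omega)) hE hl P hI hP
          (hb _ (by omega) (by omega)) h
  have hlow := low_bound hNS G i k E P hP (θ := θ) (fun k' hk1 hk2 => hb k' hk1 (by omega))
  have hmid := mid_bound (A := A) hNS G k E hl P hI hP
  have htot : 1 / flog l * ∑ p, NS (WW m A j (P p ∩ E) i) ≤
      θ * (∑ k' ∈ Finset.Ico i k, flog (m k')) / flog l + flog (m k) / m k * hh (bc A E k)
        + 3 * θ / flog l := by
    have h3 : ∑ p, NS (WW m A j (P p ∩ E) i) ≤
        ∑ p, NS (∑ k' ∈ Finset.Ico i k, (flog (m k') / m k') • ind ((P p ∩ E) ∩ A k')) +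
        ∑ p, NS ((flog (m k) / m k) • ind ((P p ∩ E) ∩ A k)) +
        ∑ p, NS (WW m A j (P p ∩ E) (k + 1)) := by
      rw [← Finset.sum_add_distrib, ← Finset.sum_add_distrib]
      refine Finset.sum_le_sum fun p _ => ?_
      rw [WW_split m A j _ hkP.1 hkj]
      refine (hNS.add_le _ _).trans ?_
      have := hNS.add_le (∑ k' ∈ Finset.Ico i k, (flog (m k') / m k') • ind ((P p ∩ E) ∩ A k'))
        ((flog (m k) / m k) • ind ((P p ∩ E) ∩ A k))
      linarith
    have h4 := mul_le_mul_of_nonneg_left h3 (show 0 ≤ 1 / flog (l : ℝ) by positivity)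
    have h5 := mul_le_mul_of_nonneg_left hlow (show 0 ≤ 1 / flog (l : ℝ) by positivity)
    have h6 := mul_le_mul_of_nonneg_left htail (show 0 ≤ 1 / flog (l : ℝ) by positivity)
    rw [mul_add, mul_add] at h4
    rw [one_div_mul_eq_div (flog (l : ℝ)) (θ * _)] at h5
    rw [one_div_mul_eq_div (flog (l : ℝ)) (3 * _)] at h6
    linarith
  rcases Nat.eq_or_lt_of_le hkP.1 with hik | hik
  · left
    rw [← hik] at htot
    simp only [Finset.Ico_self, Finset.sum_empty, mul_zero, zero_div, zero_add] at htot
    refine htot.trans ?_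
    have hX : 0 < flog (bc A E i + 4) := flog_pos (by linarith)
    have h7 : flog (bc A E i + 4) ≤ 2 * flog l :=
      flog_le_two_mul (by linarith) (by nlinarith)
    have h8 : flog (m i) / m i * hh (bc A E i) ≤ θ * flog (m i) / flog (bc A E i + 4) := by
      calc flog (m i) / m i * hh (bc A E i) ≤ flog (m i) / m i * hh (bc A E i + 4) := by
            apply mul_le_mul_of_nonneg_left (hh_mono ha (by linarith)) (by positivity)
        _ = _ := by
            unfold hh
            rw [← hθm]
            field_simp
    have h9 : 3 * θ / flog l ≤ θ * 6 / flog (bc A E i + 4) := by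
      rw [div_le_div_iff₀ hfl hX]
      nlinarith
    rw [mul_add, add_div]
    linarith
  · right
    refine ⟨k, hik, hkj, htot.trans ?_⟩
    obtain ⟨k', hk'⟩ : ∃ k', k = k' + 1 := ⟨k - 1, by omega⟩
    have hnot := Nat.find_min hex (m := k') (by omega)
    have hlt : θ * √(m (k' + 1)) < l := by
      by_contra hcon
      push Not at hcon
      exact hnot ⟨by omega, Or.inr hcon⟩
    have hfl2 := flog_l_bound G (by omega : i ≤ k') hθ1 hlt
    rw [← hk'] at hfl2
    have hsum := G.sumF i k' (by omega)
    rw [← hk'] at hsum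
    have hFp := G.Fprev k'
    rw [← hk'] at hFp
    have hFk := G.Fpos k
    have hmk := G.posR k
    have e := G.eps k (by omega)
    have hbig := G.big k (by omega)
    have e1 : θ * (∑ k' ∈ Finset.Ico i k, flog (m k')) / flog l ≤ θ * (0.52 * ε k) := by
      rw [mul_div_assoc]
      apply mul_le_mul_of_nonneg_left _ hθ0.le
      rw [div_le_iff₀ hfl]
      have : 0.52 * ε k * (0.4 * flog (m k)) ≤ 0.52 * ε k * flog l :=
        mul_le_mul_of_nonneg_left hfl2 (by linarith)
      have : 0 < ε k * flog (m k) := mul_pos e.1 hFk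
      linarith
    have e2 : flog (m k) / m k * hh (bc A E k) ≤ θ * (1 + ε k / 6) := by
      calc flog (m k) / m k * hh (bc A E k) ≤ flog (m k) / m k * hh (θ * m k) := by
            apply mul_le_mul_of_nonneg_left (hh_mono (bc_nonneg _ _) (hb k (by omega) hkj))
              (by positivity)
        _ = θ * (flog (m k) / flog (θ * m k)) := by
            unfold hh
            field_simp
        _ ≤ _ := by
            apply mul_le_mul_of_nonneg_left _ hθ0.le
            rw [hk']
            apply quot_bound G (by omega : i ≤ k')
            have := mul_le_mul_of_nonneg_right hθ1 (show (0 : ℝ) ≤ m (k' + 1) by positivity)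
            rwa [one_div_mul_eq_div] at this
    have e3 : 3 * θ / flog l ≤ θ * (0.06 * ε k) := by
      rw [div_le_iff₀ hfl, mul_assoc]
      have : 3 ≤ 0.06 * ε k * flog l := by
        have h10 : 0.06 * ε k * (0.4 * flog (m k)) ≤ 0.06 * ε k * flog l :=
          mul_le_mul_of_nonneg_left hfl2 (by linarith)
        have := G.epsF (k := k) (by omega)
        linarith
      nlinarith
    have e4 : 0 < θ * ε k := mul_pos hθ0 e.1
    nlinarith

end Main

section Sharp

variable {NS : (ℕ →₀ ℝ) → ℝ} {ε : ℕ → ℝ} {m : ℕ → ℕ} {A : ℕ → Finset ℕ} {i0 j : ℕ}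

lemma Fm_le (G : Grow ε m) {i k : ℕ} (h : i ≤ k) :
    flog (m k) / m k ≤ flog (m i) / m i := by
  have h1 := G.Fpos i
  have h2 := G.Fpos k
  have h3 := G.posR i
  have h4 := G.posR k
  have h5 := hh_mono (by linarith : (0 : ℝ) ≤ m i) (G.monoR h)
  unfold hh at h5
  rw [div_le_div_iff₀ h1 h2] at h5
  rw [div_le_div_iff₀ (by linarith) (by linarith)]
  linarith

lemma WW_sup (G : Grow ε m) (S : Sys m A i0 j) {i : ℕ} (h1 : i0 ≤ i) (E : Finset ℕ) (t : ℕ) :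
    |WW m A j E i t| ≤ flog (m i) / m i := by
  classical
  have hp : ∀ k, 0 ≤ flog (m k) / m k := fun k => by
    have := G.Fpos k
    have := G.posR k
    positivity
  have e : WW m A j E i t =
      ∑ k ∈ Finset.Icc i j, flog (m k) / m k * (if t ∈ E ∩ A k then 1 else 0) := by
    unfold WW
    rw [Finsupp.finsetSum_apply]
    refine Finset.sum_congr rfl fun k _ => ?_
    rw [Finsupp.smul_apply, ind_apply, smul_eq_mul]
  rw [e]
  by_cases hex : ∃ k ∈ Finset.Icc i j, t ∈ E ∩ A k
  · obtain ⟨k, hk, ht⟩ := hex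
    rw [Finset.sum_eq_single_of_mem k hk, if_pos ht, mul_one, abs_of_nonneg (hp k)]
    · exact Fm_le G (Finset.mem_Icc.1 hk).1
    · intro k' hk' hne
      rw [if_neg, mul_zero]
      intro ht'
      rw [Finset.mem_Icc] at hk hk'
      rw [Finset.mem_inter] at ht ht'
      rcases lt_or_gt_of_ne hne with h | h
      · exact Finset.disjoint_left.1 (S.disj k' k (by omega) h (by omega)) ht'.2 ht.2
      · exact Finset.disjoint_left.1 (S.disj k k' (by omega) h (by omega)) ht.2 ht'.2
  · push Not at hex
    rw [Finset.sum_eq_zero]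
    · simpa using hp i
    · intro k hk
      rw [if_neg (hex k hk), mul_zero]

/-- The lossy bound at level `i` in the case of few points. -/
lemma lossy_few (hNS : IsSNorm NS) (G : Grow ε m) (S : Sys m A i0 j) {i : ℕ} (hi : 1 ≤ i)
    (h1 : i0 ≤ i) (h2 : i ≤ j)
    (H : ∀ k, i < k → k ≤ j → ∀ E, IsNatInterval E →
      NS (WW m A j E k) ≤ 1.4 * (flog (m k) / m k * hh (bc A E k + 4)))
    {E : Finset ℕ} (hE : IsNatInterval E) (hX : flog (bc A E i + 4) ≤ 64) :
    NS (WW m A j E i) ≤ 1.4 * (flog (m i) / m i * hh (bc A E i + 4)) := by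
  have ha := bc_nonneg (A := A) E i
  have hF := G.F_ge hi
  have hm := G.posR i
  have hs := WW_split m A j E (le_refl i) h2
  rw [Finset.Ico_self, Finset.sum_empty, zero_add] at hs
  rw [hs]
  refine (hNS.add_le _ _).trans ?_
  rw [NS_piece hNS G]
  have hp : 0 ≤ flog (m i) / m i := by positivity
  have h3 : flog (m i) / m i * hh (bc A E i) ≤ flog (m i) / m i * hh (bc A E i + 4) :=
    mul_le_mul_of_nonneg_left (hh_mono ha (by linarith)) hp
  suffices h4 : NS (WW m A j E (i + 1)) ≤ 0.4 * (flog (m i) / m i * hh (bc A E i + 4)) by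
    linarith
  have hY : 0 ≤ flog (m i) / m i * hh (bc A E i + 4) :=
    mul_nonneg hp (hh_nonneg (by linarith))
  rcases h2.eq_or_lt with rfl | h2
  · rw [WW_top, NS_zero hNS]
    linarith
  refine (H (i + 1) (by omega) h2 E hE).trans ?_
  set a := bc A E i with hadef
  have hu := unifR G S hE h1 (Nat.le_succ i) h2
  simp only [Nat.succ_eq_add_one] at hu
  set θ := (a + 4) / m i with hθ
  have hθ0 : 1 / (m i : ℝ) ≤ θ := by
    rw [hθ]; gcongr; linarith
  have hθ1 : 0 < θ := lt_of_lt_of_le (by positivity) hθ0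
  have hq := G.F_le_quot i
  have hF' := G.F_ge (k := i + 1) (by omega)
  have hm' := G.posR (i + 1)
  have hx : (m (i + 1) : ℝ) / m i ≤ θ * m (i + 1) := by
    rw [div_eq_mul_one_div, mul_comm]
    exact mul_le_mul_of_nonneg_right hθ0 (by linarith)
  have hqb := quot_bound G (le_refl i) (x := θ * m (i + 1) + 4) (by linarith)
  have e := G.eps (i + 1) (by omega)
  have hfx : 0 < flog (θ * m (i + 1) + 4) := flog_pos (by positivity)
  have h5 : flog (m (i + 1)) / m (i + 1) * hh (bc A E (i + 1) + 4) ≤ 1.17 * θ := by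
    calc flog (m (i + 1)) / m (i + 1) * hh (bc A E (i + 1) + 4)
        ≤ flog (m (i + 1)) / m (i + 1) * hh (θ * m (i + 1) + 4) :=
          mul_le_mul_of_nonneg_left (hh_mono (by linarith [bc_nonneg (A := A) E (i + 1)])
            (by linarith)) (by positivity)
      _ = flog (m (i + 1)) / flog (θ * m (i + 1) + 4) * ((θ * m (i + 1) + 4) / m (i + 1)) := by
          unfold hh; field_simp
      _ ≤ (1 + ε (i + 1) / 6) * (1.1 * θ) := by
          apply mul_le_mul hqb _ (by positivity) (by linarith)
          rw [div_le_iff₀ (by linarith)]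
          nlinarith
      _ ≤ 1.17 * θ := by nlinarith
  have h6 : 5 * θ ≤ flog (m i) / m i * hh (a + 4) := by
    have hX0 : 0 < flog (a + 4) := flog_pos (by linarith)
    have : flog (m i) / m i * hh (a + 4) = θ * (flog (m i) / flog (a + 4)) := by
      rw [hθ]; unfold hh; field_simp
    rw [this]
    have : 5 ≤ flog (m i) / flog (a + 4) := by
      rw [le_div_iff₀ hX0]; linarith
    nlinarith
  linarith

lemma lossy_step (hNS : IsSNorm NS) (G : Grow ε m) (S : Sys m A i0 j) {i : ℕ} (hi : 1 ≤ i)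
    (h1 : i0 ≤ i) (h2 : i ≤ j)
    (H : ∀ k, i < k → k ≤ j → ∀ E, IsNatInterval E →
      NS (WW m A j E k) ≤ 1.4 * (flog (m k) / m k * hh (bc A E k + 4)))
    {r : ℝ} (hr : 0 ≤ r)
    (H0 : ∀ E, IsNatInterval E →
      NS (WW m A j E i) ≤ (1.4 + r) * (flog (m i) / m i * hh (bc A E i + 4)))
    {E : Finset ℕ} (hE : IsNatInterval E) :
    NS (WW m A j E i) ≤ (1.4 + r / 1.4) * (flog (m i) / m i * hh (bc A E i + 4)) := by
  have ha := bc_nonneg (A := A) E i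
  have hF := G.F_ge hi
  have hm := G.posR i
  have hp : 0 ≤ flog (m i) / m i := by positivity
  have h1h : 1 ≤ hh (bc A E i + 4) := one_le_hh (by linarith)
  have hY0 : flog (m i) / m i ≤ flog (m i) / m i * hh (bc A E i + 4) :=
    le_mul_of_one_le_right hp h1h
  have hY : flog (m i) / m i * hh (bc A E i + 4)
      = (bc A E i + 4) / m i * (flog (m i) / flog (bc A E i + 4)) := by
    unfold hh
    have hX0 : 0 < flog (bc A E i + 4) := flog_pos (by linarith)
    field_simp
  set Y := flog (m i) / m i * hh (bc A E i + 4) with hYdef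
  have hYn : 0 ≤ Y := hp.trans hY0
  have hr' : 0 ≤ r / 1.4 := by positivity
  rcases le_total (flog (bc A E i + 4)) 64 with hX | hX
  · refine (lossy_few hNS G S hi h1 h2 H hE hX).trans ?_
    nlinarith
  have h14 : 1.4 * Y ≤ (1.4 + r / 1.4) * Y := by nlinarith
  apply NS_upper hNS
  · nlinarith
  · intro t
    refine (WW_sup G S h1 E t).trans ?_
    nlinarith
  · intro l hl P hI hP
    simp only [WW_restrict]
    rcases le_or_gt ((l : ℝ) ^ 2) (bc A E i + 4) with hla | hla
    · refine (small_case G (1.4 + r) (by linarith) i H0 hE hl P hI hP hX hla).trans ?_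
      apply mul_le_mul_of_nonneg_right _ hYn
      rw [div_le_iff₀ (by norm_num)]
      have : r / 1.4 * 1.4 = r := by field_simp
      nlinarith
    · refine le_trans ?_ h14
      have hX0 : 0 < flog (bc A E i + 4) := by linarith
      have hθ0 : 0 < (bc A E i + 4) / m i := by positivity
      rcases large_case hNS G S h1 h2 H hE hl P hI hP rfl hla with h | ⟨k, hk1, hk2, h⟩
      · refine h.trans ?_
        rw [hY, mul_div_assoc]
        have : (flog (m i) + 6) / flog (bc A E i + 4) ≤
            1.4 * (flog (m i) / flog (bc A E i + 4)) := by
          rw [← mul_div_assoc]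
          gcongr
          linarith
        nlinarith
      · refine h.trans ?_
        have e := G.eps k (by omega)
        have hXF : flog (bc A E i + 4) ≤ flog (m i) + 1 := by
          have := bc_le S E h1 h2
          have h5 := flog_mono (by linarith) (by linarith : bc A E i + 4 ≤ m i + 4)
          have h6 : flog ((m i : ℝ) + 4) ≤ flog (m i) + 1 := by
            unfold flog
            have hm3 : (3 : ℝ) ≤ m i := by
              have := flog_le_self_div (x := m i) (by linarith)
              linarith
            have := Real.logb_le_logb_of_le (b := 2) (by norm_num) (by linarith)
              (by linarith : (m i : ℝ) + 4 + 1 ≤ (m i + 1) * 2)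
            rw [Real.logb_mul (by linarith) (by norm_num)] at this
            simpa using this
          linarith
        rw [hY]
        have : 0.99 ≤ flog (m i) / flog (bc A E i + 4) := by
          rw [le_div_iff₀ hX0]; linarith
        have : 1 + 0.75 * ε k ≤ 1.4 * (flog (m i) / flog (bc A E i + 4)) := by linarith
        nlinarith

lemma lossy_level (hNS : IsSNorm NS) (G : Grow ε m) (S : Sys m A i0 j) {i : ℕ} (hi : 1 ≤ i)
    (h1 : i0 ≤ i) (h2 : i ≤ j)
    (H : ∀ k, i < k → k ≤ j → ∀ E, IsNatInterval E →
      NS (WW m A j E k) ≤ 1.4 * (flog (m k) / m k * hh (bc A E k + 4)))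
    {E : Finset ℕ} (hE : IsNatInterval E) :
    NS (WW m A j E i) ≤ 1.4 * (flog (m i) / m i * hh (bc A E i + 4)) := by
  have hF := G.Fpos i
  have hm := G.posR i
  set K := ∑ k ∈ Finset.Icc i j, flog (m k) with hK
  have hK0 : 0 ≤ K := Finset.sum_nonneg fun k _ => (G.Fpos k).le
  set r := K / (flog (m i) / m i) with hr
  have hp : 0 < flog (m i) / m i := by positivity
  have hr0 : 0 ≤ r := by positivity
  have hit : ∀ n : ℕ, ∀ E, IsNatInterval E →
      NS (WW m A j E i) ≤ (1.4 + r / 1.4 ^ n) * (flog (m i) / m i * hh (bc A E i + 4)) := by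
    intro n
    induction n with
    | zero =>
      intro E hE
      have ha := bc_nonneg (A := A) E i
      have h1h : 1 ≤ hh (bc A E i + 4) := one_le_hh (by linarith)
      have hb : NS (WW m A j E i) ≤ K := by
        unfold WW
        refine (NS_sum_le hNS _ _).trans (Finset.sum_le_sum fun k hk => ?_)
        rw [Finset.mem_Icc] at hk
        rw [NS_piece hNS G]
        have h3 := (hh_bc_le (A := A) E k).trans (bc_le S E (by omega) hk.2)
        have h4 := G.Fpos k
        have h5 := G.posR k
        calc flog (m k) / m k * hh (bc A E k) ≤ flog (m k) / m k * m k :=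
              mul_le_mul_of_nonneg_left h3 (by positivity)
          _ = flog (m k) := by field_simp
      have hK' : K = r * (flog (m i) / m i) := by rw [hr]; field_simp
      rw [pow_zero, div_one]
      calc NS (WW m A j E i) ≤ r * (flog (m i) / m i * 1) := by rw [mul_one]; linarith
        _ ≤ (1.4 + r) * (flog (m i) / m i * hh (bc A E i + 4)) := by gcongr; linarith
    | succ n ih =>
      intro E hE
      have := lossy_step hNS G S hi h1 h2 H (r := r / 1.4 ^ n) (by positivity) ih hE
      rwa [div_div, ← pow_succ] at this
  have hlim : Filter.Tendsto
      (fun n : ℕ => (1.4 + r / 1.4 ^ n) * (flog (m i) / m i * hh (bc A E i + 4)))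
      Filter.atTop (nhds ((1.4 + 0) * (flog (m i) / m i * hh (bc A E i + 4)))) := by
    apply Filter.Tendsto.mul_const
    apply Filter.Tendsto.const_add
    apply Filter.Tendsto.const_div_atTop
    exact tendsto_pow_atTop_atTop_of_one_lt (by norm_num)
  have := ge_of_tendsto' hlim (fun n => hit n E hE)
  simpa using this

lemma lossy (hNS : IsSNorm NS) (G : Grow ε m) (S : Sys m A i0 j) (hi : 1 ≤ i0) (n : ℕ) :
    ∀ i, i0 ≤ i → i ≤ j → j - i ≤ n → ∀ E, IsNatInterval E →
      NS (WW m A j E i) ≤ 1.4 * (flog (m i) / m i * hh (bc A E i + 4)) := by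
  induction n with
  | zero =>
    intro i h1 h2 h3 E hE
    exact lossy_level hNS G S (by omega) h1 h2 (fun k hk hkj => by omega) hE
  | succ n ih =>
    intro i h1 h2 h3 E hE
    exact lossy_level hNS G S (by omega) h1 h2
      (fun k hk hkj => ih k (by omega) hkj (by omega)) hE

set_option maxHeartbeats 1600000 in
/-- The sharp bound. -/
lemma sharp (hNS : IsSNorm NS) (G : Grow ε m) {i : ℕ} (hi : 1 ≤ i) (S : Sys m A i j)
    (h2 : i ≤ j) {E : Finset ℕ} (hE : IsNatInterval E) {N : ℝ} (hN1 : 1 ≤ N)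
    (hN2 : N ≤ m (i - 1)) (hb : bc A E i = m i / N) {C : ℝ} (hC : 1 + ε i ≤ C)
    (hC2 : ∀ k, i < k → (1 + ε i) * (1 + ε k) ≤ C) :
    NS (WW m A j E i) ≤ C / N := by
  obtain ⟨i, rfl⟩ : ∃ i', i = i' + 1 := ⟨i - 1, by omega⟩
  simp only [Nat.add_sub_cancel] at hN2
  have hF := G.F_ge hi
  have hm := G.posR (i + 1)
  have hm0 := G.posR i
  have e := G.eps (i + 1) hi
  have eF := G.epsF hi
  have e2F := G.big (i + 1) hi
  have hq := G.F_le_quot i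
  have hqa : (m (i + 1) : ℝ) / m i ≤ bc A E (i + 1) := by
    rw [hb]
    exact div_le_div_of_nonneg_left (by linarith) (by linarith) hN2
  have hqb := quot_bound G (le_refl i) (x := bc A E (i + 1) + 4) (by linarith)
  set a := bc A E (i + 1) with ha
  set F := flog (m (i + 1)) with hFdef
  set δ := ε (i + 1) with hδ
  have haF : F ≤ a := hq.trans hqa
  have ha0 : 0 ≤ a := by linarith
  have hX0 : 0 < flog (a + 4) := flog_pos (by linarith)
  have hX : 64 ≤ flog (a + 4) := by
    rw [div_le_iff₀ hX0] at hqb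
    nlinarith
  have hN0 : 0 < N := by linarith
  have hθ : (a + 4) / m (i + 1) ≤ (1 + 0.1 * δ) / N := by
    have h3 : 4 ≤ 0.1 * δ * a := by nlinarith
    have h4 : (m (i + 1) : ℝ) = a * N := by rw [hb]; field_simp
    rw [h4, div_le_div_iff₀ (by nlinarith) hN0]
    nlinarith
  have hθ0 : 0 < (a + 4) / m (i + 1) := by positivity
  have h6F : (F + 6) ≤ (1 + 0.1 * δ) * F := by nlinarith
  have hpF : 0 < F / m (i + 1) := by positivity
  apply NS_upper hNS
  · have : 0 ≤ C := by linarith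
    positivity
  · intro t
    refine (WW_sup G S (le_refl _) E t).trans ?_
    rw [div_le_div_iff₀ (by linarith) hN0]
    have h4 : (m (i + 1) : ℝ) = a * N := by rw [hb]; field_simp
    have h5 : F ≤ C * a := by nlinarith
    calc F * N ≤ C * a * N := mul_le_mul_of_nonneg_right h5 hN0.le
      _ = C * (a * N) := by ring
      _ = C * m (i + 1) := by rw [← h4]
  · intro l hl P hI hP
    simp only [WW_restrict]
    have H : ∀ k, i + 1 ≤ k → k ≤ j → ∀ E, IsNatInterval E →
      NS (WW m A j E k) ≤ 1.4 * (flog (m k) / m k * hh (bc A E k + 4)) :=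
      fun k hk hkj => lossy hNS G S hi (j - k) k hk hkj le_rfl
    have hY : F / m (i + 1) * hh (a + 4) = (a + 4) / m (i + 1) * (F / flog (a + 4)) := by
      unfold hh
      field_simp
    have hYb : (a + 4) / m (i + 1) * (F / flog (a + 4)) ≤
        (1 + 0.1 * δ) / N * (1 + δ / 6) := by
      have h0 : 0 < 1 + 0.1 * δ := by linarith
      apply mul_le_mul hθ hqb (by positivity) (by positivity)
    rcases le_or_gt ((l : ℝ) ^ 2) (a + 4) with hla | hla
    · refine (small_case G 1.4 (by norm_num) (i + 1) (H (i + 1) le_rfl h2) hE hl P hI hP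
        hX hla).trans ?_
      rw [hY]
      have : (1 + 0.1 * δ) / N * (1 + δ / 6) ≤ C / N := by
        rw [div_mul_eq_mul_div]
        gcongr
        nlinarith
      have : 0 ≤ (a + 4) / m (i + 1) * (F / flog (a + 4)) := by positivity
      linarith
    · rcases large_case hNS G S le_rfl h2 (fun k hk => H k hk.le) hE hl P hI hP rfl hla with
        h | ⟨k, hk1, hk2, h⟩
      · refine h.trans ?_
        calc (a + 4) / m (i + 1) * (F + 6) / flog (a + 4)
            ≤ (a + 4) / m (i + 1) * ((1 + 0.1 * δ) * F) / flog (a + 4) := by gcongr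
          _ = (1 + 0.1 * δ) * ((a + 4) / m (i + 1) * (F / flog (a + 4))) := by ring
          _ ≤ (1 + 0.1 * δ) * ((1 + 0.1 * δ) / N * (1 + δ / 6)) := by
              apply mul_le_mul_of_nonneg_left hYb (by linarith)
          _ = ((1 + 0.1 * δ) * (1 + 0.1 * δ) * (1 + δ / 6)) / N := by ring
          _ ≤ C / N := by
              have d2 : δ ^ 2 ≤ 3 / 8 * δ := by nlinarith
              have d3 : δ ^ 3 ≤ 3 / 8 * δ ^ 2 := by nlinarith [sq_nonneg δ]
              have d4 : (1 + 0.1 * δ) * (1 + 0.1 * δ) * (1 + δ / 6) ≤ C := by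
                ring_nf
                linarith
              exact div_le_div_of_nonneg_right d4 hN0.le
      · refine h.trans ?_
        have ek := G.eps k (by omega)
        have := hC2 k hk1
        calc (a + 4) / m (i + 1) * (1 + 0.75 * ε k)
            ≤ (1 + 0.1 * δ) / N * (1 + 0.75 * ε k) := by gcongr; linarith
          _ = (1 + 0.1 * δ) * (1 + 0.75 * ε k) / N := by ring
          _ ≤ C / N := by
              gcongr
              nlinarith [mul_pos e.1 ek.1]

end Sharp

section Geometry

lemma cells (r M : ℕ) (hr : 1 ≤ r) (hM : 1 ≤ M) (a b : ℕ) : ∃ a' b' : ℕ,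
    (∀ p, 1 ≤ p → ((a ≤ 1 + (p - 1) * r ∧ 1 + (p - 1) * r ≤ b) ↔ (a' ≤ p ∧ p ≤ b'))) ∧
    (Finset.Icc a b ∩ Finset.Icc 1 (M + M * r)).card ≤
      ((Finset.Icc a' b' ∩ Finset.Icc 1 M).card + 1) * r + M ∧
    (1 ≤ (Finset.Icc a' b' ∩ Finset.Icc 1 M).card →
      (Finset.Icc a' b' ∩ Finset.Icc 1 M).card * r + 1 ≤
      (Finset.Icc a b ∩ Finset.Icc 1 (M + M * r)).card + r) := by
  have key : ∀ c d N : ℕ, (Finset.Icc c d ∩ Finset.Icc 1 N).card = min d N + 1 - max c 1 := by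
    intro c d N
    rw [← Nat.card_Icc]
    congr 1
    ext; simp; omega
  rcases Nat.eq_zero_or_pos b with rfl | hb
  · refine ⟨1, 0, ?_, ?_, ?_⟩
    · intro p hp
      constructor <;> intro h <;> omega
    · simp only [key]
      have : min 0 (M + M * r) + 1 - max a 1 = 0 := by omega
      rw [this]; exact Nat.zero_le _
    · simp
  obtain ⟨b, rfl⟩ : ∃ b', b = b' + 1 := ⟨b - 1, by omega⟩
  obtain ⟨c, hc⟩ : ∃ c, c = a - 1 := ⟨_, rfl⟩
  -- `u` is the least index of a cell starting after `c`
  obtain ⟨u, hu1, hu2⟩ : ∃ u, c ≤ u * r ∧ u * r ≤ c + (r - 1) := by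
    refine ⟨(c + (r - 1)) / r, ?_, Nat.div_mul_le_self _ _⟩
    have := Nat.div_add_mod (c + (r - 1)) r
    have h2 := Nat.mod_lt (c + (r - 1)) hr
    rw [mul_comm] at this
    omega
  obtain ⟨v, hv1, hv2⟩ : ∃ v, v * r ≤ b ∧ b < v * r + r := by
    refine ⟨b / r, Nat.div_mul_le_self _ _, ?_⟩
    have := Nat.div_add_mod b r
    have h2 := Nat.mod_lt b hr
    rw [mul_comm] at this
    omega
  have hmax : max a 1 = c + 1 := by omega
  have hmax' : max (u + 1) 1 = u + 1 := by omega
  refine ⟨u + 1, v + 1, ?_, ?_, ?_⟩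
  · intro p hp
    obtain ⟨q, rfl⟩ : ∃ q, p = q + 1 := ⟨p - 1, by omega⟩
    simp only [Nat.add_sub_cancel]
    constructor
    · rintro ⟨h1, h2⟩
      constructor
      · by_contra hcon
        have : q + 1 ≤ u := by omega
        have h3 := Nat.mul_le_mul_right r this
        rw [add_mul] at h3
        omega
      · by_contra hcon
        have : v + 1 ≤ q := by omega
        have h3 := Nat.mul_le_mul_right r this
        rw [add_mul] at h3
        omega
    · rintro ⟨h1, h2⟩
      have h3 := Nat.mul_le_mul_right r (by omega : u ≤ q)
      have h4 := Nat.mul_le_mul_right r (by omega : q ≤ v)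
      omega
  · rw [key, key, hmax, hmax']
    set w := min (v + 1) M with hw
    set B := w + 1 - (u + 1) with hB
    have h1 : min (b + 1) (M + M * r) ≤ w * r + M := by
      rcases le_total (v + 1) M with h | h
      · have : w = v + 1 := by omega
        rw [this, add_mul]; omega
      · have : w = M := by omega
        rw [this]; omega
    have h2 := Nat.mul_le_mul_right r (by omega : w ≤ B + u)
    rw [add_mul] at h2 ⊢
    omega
  · rw [key, key, hmax, hmax']
    intro h
    set w := min (v + 1) M with hw
    obtain ⟨B, hB⟩ : ∃ B, w = u + 1 + B := ⟨w - (u + 1), by omega⟩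
    have e1 : w + 1 - (u + 1) = B + 1 := by omega
    rw [e1, add_mul]
    have h3 := Nat.mul_le_mul_right r (by omega : u + B ≤ v)
    have h4 := Nat.mul_le_mul_right r (by omega : u + B ≤ M)
    rw [add_mul] at h3 h4
    omega

/-- The geometric data of a yardstick vector. -/
structure Geo (m : ℕ → ℕ) (A : ℕ → Finset ℕ) (i j M : ℕ) : Prop where
  sys : Sys m A i j
  sub : ∀ k, i ≤ k → k ≤ j → A k ⊆ Finset.Icc 1 M
  tot : ∀ k, i ≤ k → k ≤ j → ∀ a b, ((Finset.Icc a b ∩ Finset.Icc 1 M).card + 2) * m k ≤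
    M * ((Finset.Icc a b ∩ A k).card + 4)

lemma Geo.base (m : ℕ → ℕ) (i : ℕ) : Geo m (fun _ => Finset.Icc 1 (m i)) i i (m i) := by
  refine ⟨⟨?_, ?_, ?_⟩, ?_, ?_⟩
  · intro k h1 h2
    obtain rfl : k = i := by omega
    simp
  · intro k k' h1 h2 h3
    omega
  · intro k k' h1 h2 h3 a b
    obtain rfl : k = i := by omega
    obtain rfl : k' = k := by omega
    nlinarith
  · intro k h1 h2
    exact subset_rfl
  · intro k h1 h2 a b
    obtain rfl : k = i := by omega
    nlinarith

/-- The spreading map. -/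
def sprd (r p : ℕ) : ℕ := 1 + (p - 1) * r

lemma sprd_inj {r p q : ℕ} (hr : 1 ≤ r) (hp : 1 ≤ p) (hq : 1 ≤ q) (h : sprd r p = sprd r q) :
    p = q := by
  unfold sprd at h
  have h2 : (p - 1) * r = (q - 1) * r := by omega
  have := Nat.eq_of_mul_eq_mul_right hr h2
  omega

lemma Geo.step {m : ℕ → ℕ} {A : ℕ → Finset ℕ} {i j M r : ℕ} (g : Geo m A i j M)
    (hM : 1 ≤ M) (hr : M + 2 ≤ r) (hm : m (j + 1) = M * r) :
    Geo m (fun k => if k = j + 1 then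
        Finset.Icc 1 (M + m (j + 1)) \ (Finset.Icc 1 M).image (sprd r)
      else (A k).image (sprd r)) i (j + 1) (M + m (j + 1)) := by
  have hr1 : 1 ≤ r := by omega
  have injI : ∀ X : Finset ℕ, X ⊆ Finset.Icc 1 M → Set.InjOn (sprd r) X := by
    intro X hX p hp q hq h
    have h1 := Finset.mem_Icc.1 (hX hp)
    have h2 := Finset.mem_Icc.1 (hX hq)
    exact sprd_inj hr1 h1.1 h2.1 h
  have imsub : (Finset.Icc 1 M).image (sprd r) ⊆ Finset.Icc 1 (M + m (j + 1)) := by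
    intro t ht
    obtain ⟨p, hp, rfl⟩ := Finset.mem_image.1 ht
    rw [Finset.mem_Icc] at hp ⊢
    unfold sprd
    have := Nat.mul_le_mul_right r (by omega : p - 1 ≤ M)
    omega
  have trans : ∀ a b a' b', (∀ p, 1 ≤ p →
      ((a ≤ 1 + (p - 1) * r ∧ 1 + (p - 1) * r ≤ b) ↔ (a' ≤ p ∧ p ≤ b'))) →
      ∀ X : Finset ℕ, X ⊆ Finset.Icc 1 M →
      (Finset.Icc a b ∩ X.image (sprd r)).card = (Finset.Icc a' b' ∩ X).card := by
    intro a b a' b' h X hX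
    rw [← Finset.card_image_of_injOn (injI (Finset.Icc a' b' ∩ X)
      (Finset.inter_subset_right.trans hX))]
    congr 1
    ext t
    simp only [Finset.mem_inter, Finset.mem_image, Finset.mem_Icc]
    constructor
    · rintro ⟨h1, p, hp, rfl⟩
      exact ⟨p, ⟨(h p (Finset.mem_Icc.1 (hX hp)).1).1 h1, hp⟩, rfl⟩
    · rintro ⟨p, ⟨h1, hp⟩, rfl⟩
      exact ⟨(h p (Finset.mem_Icc.1 (hX hp)).1).2 h1, p, hp, rfl⟩
  -- the count of points of the new level
  have newcount : ∀ a b a' b', (∀ p, 1 ≤ p →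
      ((a ≤ 1 + (p - 1) * r ∧ 1 + (p - 1) * r ≤ b) ↔ (a' ≤ p ∧ p ≤ b'))) →
      (Finset.Icc a b ∩ (Finset.Icc 1 (M + m (j + 1)) \ (Finset.Icc 1 M).image (sprd r))).card +
        (Finset.Icc a' b' ∩ Finset.Icc 1 M).card =
      (Finset.Icc a b ∩ Finset.Icc 1 (M + m (j + 1))).card := by
    intro a b a' b' h
    rw [← trans a b a' b' h _ subset_rfl, ← Finset.card_union_of_disjoint]
    · congr 1
      ext t
      simp only [Finset.mem_union, Finset.mem_inter, Finset.mem_sdiff]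
      constructor
      · rintro (h1 | h1)
        · exact ⟨h1.1, h1.2.1⟩
        · exact ⟨h1.1, imsub h1.2⟩
      · rintro ⟨h1, h2⟩
        by_cases h3 : t ∈ (Finset.Icc 1 M).image (sprd r)
        · exact Or.inr ⟨h1, h3⟩
        · exact Or.inl ⟨h1, h2, h3⟩
    · rw [Finset.disjoint_left]
      intro t h1 h2
      simp only [Finset.mem_inter, Finset.mem_sdiff] at h1 h2
      exact h1.2.2 h2.2
  have hBM : ∀ a' b', (Finset.Icc a' b' ∩ Finset.Icc 1 M).card ≤ M := fun a' b' => by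
    have := Finset.card_le_card
      (Finset.inter_subset_right : Finset.Icc a' b' ∩ Finset.Icc 1 M ⊆ Finset.Icc 1 M)
    simpa using this
  refine ⟨⟨?_, ?_, ?_⟩, ?_, ?_⟩
  · intro k h1 h2
    by_cases hk : k = j + 1
    · subst hk
      simp only [if_true]
      rw [Finset.card_sdiff_of_subset imsub, Finset.card_image_of_injOn (injI _ subset_rfl)]
      simp
    · simp only [if_neg hk]
      rw [Finset.card_image_of_injOn (injI _ (g.sub k h1 (by omega)))]
      exact g.sys.card k h1 (by omega)
  · intro k k' h1 h2 h3
    have hk : k ≠ j + 1 := by omega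
    simp only [if_neg hk]
    rw [Finset.disjoint_left]
    intro t ht ht'
    by_cases hk' : k' = j + 1
    · simp only [if_pos hk', Finset.mem_sdiff] at ht'
      exact ht'.2 (Finset.image_subset_image (g.sub k h1 (by omega)) ht)
    · simp only [if_neg hk'] at ht'
      obtain ⟨p, hp, rfl⟩ := Finset.mem_image.1 ht
      obtain ⟨q, hq, hpq⟩ := Finset.mem_image.1 ht'
      have hp1 := Finset.mem_Icc.1 (g.sub k h1 (by omega) hp)
      have hq1 := Finset.mem_Icc.1 (g.sub k' (by omega) (by omega) hq)
      have := sprd_inj hr1 hq1.1 hp1.1 hpq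
      subst this
      exact Finset.disjoint_left.1 (g.sys.disj k k' h1 h2 (by omega)) hp hq
  · intro k k' h1 h2 h3 a b
    obtain ⟨a', b', hab, hT, -⟩ := cells r M hr1 hM a b
    rw [← hm] at hT
    by_cases hk : k = j + 1
    · have hk' : k' = j + 1 := by omega
      subst hk
      subst hk'
      nlinarith
    · by_cases hk' : k' = j + 1
      · subst hk'
        simp only [if_neg hk, if_true]
        rw [trans a b a' b' hab _ (g.sub k h1 (by omega))]
        have hn := newcount a b a' b' hab
        have ht := g.tot k h1 (by omega) a' b'
        generalize (Finset.Icc a' b' ∩ A k).card = bk at *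
        generalize (Finset.Icc a' b' ∩ Finset.Icc 1 M).card = B at *
        generalize (Finset.Icc a b ∩ Finset.Icc 1 (M + m (j + 1))).card = T at *
        generalize (Finset.Icc a b ∩ (Finset.Icc 1 (M + m (j + 1)) \
          (Finset.Icc 1 M).image (sprd r))).card = bn at *
        rw [hm]
        have e1 : bn ≤ (B + 2) * r := by nlinarith
        calc bn * m k ≤ (B + 2) * r * m k := Nat.mul_le_mul_right _ e1
          _ = r * ((B + 2) * m k) := by ring
          _ ≤ r * (M * (bk + 4)) := Nat.mul_le_mul_left _ ht
          _ = M * r * (bk + 4) := by ring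
      · simp only [if_neg hk, if_neg hk']
        rw [trans a b a' b' hab _ (g.sub k h1 (by omega)),
          trans a b a' b' hab _ (g.sub k' (by omega) (by omega))]
        exact g.sys.unif k k' h1 h2 (by omega) a' b'
  · intro k h1 h2
    by_cases hk : k = j + 1
    · simp only [if_pos hk]
      exact Finset.sdiff_subset
    · simp only [if_neg hk]
      exact (Finset.image_subset_image (g.sub k h1 (by omega))).trans imsub
  · intro k h1 h2 a b
    obtain ⟨a', b', hab, hT, hT2⟩ := cells r M hr1 hM a b
    rw [← hm] at hT hT2
    have hB := hBM a' b'
    by_cases hk : k = j + 1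
    · subst hk
      simp only [if_true]
      have hn := newcount a b a' b' hab
      generalize (Finset.Icc a' b' ∩ Finset.Icc 1 M).card = B at *
      generalize (Finset.Icc a b ∩ Finset.Icc 1 (M + m (j + 1))).card = T at *
      generalize (Finset.Icc a b ∩ (Finset.Icc 1 (M + m (j + 1)) \
        (Finset.Icc 1 M).image (sprd r))).card = bn at *
      rw [hm]
      subst hn
      have e1 : B * r ≤ bn + 4 + 2 * r := by
        rcases Nat.eq_zero_or_pos B with h | h
        · subst h; omega
        · have := hT2 h
          omega
      have e2 : (bn + B + 2) * r ≤ (1 + r) * (bn + 4) := by nlinarith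
      calc (bn + B + 2) * (M * r) = M * ((bn + B + 2) * r) := by ring
        _ ≤ M * ((1 + r) * (bn + 4)) := Nat.mul_le_mul_left _ e2
        _ = (M + M * r) * (bn + 4) := by ring
    · simp only [if_neg hk]
      rw [trans a b a' b' hab _ (g.sub k h1 (by omega))]
      have ht := g.tot k h1 (by omega) a' b'
      generalize (Finset.Icc a' b' ∩ A k).card = bk at *
      generalize (Finset.Icc a' b' ∩ Finset.Icc 1 M).card = B at *
      generalize (Finset.Icc a b ∩ Finset.Icc 1 (M + m (j + 1))).card = T at *
      rw [hm]
      have e1 : T + 2 ≤ (B + 2) * r := by nlinarith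
      calc (T + 2) * m k ≤ (B + 2) * r * m k := Nat.mul_le_mul_right _ e1
        _ = r * ((B + 2) * m k) := by ring
        _ ≤ r * (M * (bk + 4)) := Nat.mul_le_mul_left _ ht
        _ = M * r * (bk + 4) := by ring
        _ ≤ (M + M * r) * (bk + 4) := Nat.mul_le_mul_right _ (by omega)

/-- The reversed list used in the definition of `yardstick`. -/
def lst (m : ℕ → ℕ) (i j : ℕ) : List ℕ :=
  ((List.range (j + 1 - i)).map fun t => m (i + t)).reverse

lemma lst_self (m : ℕ → ℕ) (i : ℕ) : lst m i i = [m i] := by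
  unfold lst
  have : i + 1 - i = 1 := by omega
  rw [this]
  simp

lemma lst_succ (m : ℕ → ℕ) {i j : ℕ} (h : i ≤ j) : lst m i (j + 1) = m (j + 1) :: lst m i j := by
  unfold lst
  have : j + 1 + 1 - i = (j + 1 - i) + 1 := by omega
  rw [this, List.range_succ]
  simp
  congr 1
  omega

lemma lst_sum (m : ℕ → ℕ) {i j : ℕ} (h : i ≤ j) :
    (lst m i j).sum = ∑ k ∈ Finset.Icc i j, m k := by
  induction j, h using Nat.le_induction with
  | base => simp [lst_self]
  | succ j hj ih =>
    rw [lst_succ m hj, List.sum_cons, ih, Finset.sum_Icc_succ_top (by omega)]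
    ring

lemma yard_singleton (n : ℕ) : yard [n] = (flog n / n) • ind (Finset.Icc 1 n) := by
  simp [yard, ind, Finset.smul_sum]

lemma yard_cons (m : ℕ → ℕ) (A : ℕ → Finset ℕ) {i j : ℕ} (ms : List ℕ) (r : ℕ)
    (hij : i ≤ j) (hr1 : 1 ≤ r)
    (hr : m (j + 1) / ms.sum = r)
    (hsub : ∀ k, i ≤ k → k ≤ j → A k ⊆ Finset.Icc 1 ms.sum)
    (hy : yard ms = ∑ k ∈ Finset.Icc i j, (flog (m k) / m k) • ind (A k)) :
    yard (m (j + 1) :: ms) = ∑ k ∈ Finset.Icc i (j + 1), (flog (m k) / m k) •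
      ind (if k = j + 1 then
        Finset.Icc 1 (ms.sum + m (j + 1)) \ (Finset.Icc 1 ms.sum).image (sprd r)
      else (A k).image (sprd r)) := by
  rw [Finset.sum_Icc_succ_top (by omega)]
  unfold yard
  rw [hr]
  congr 1
  · have e : ∀ p ∈ Finset.Icc 1 ms.sum, Finsupp.single (1 + (p - 1) * r) (yard ms p) =
        ∑ k ∈ Finset.Icc i j, (flog (m k) / m k) •
          (if p ∈ A k then Finsupp.single (sprd r p) (1 : ℝ) else 0) := by
      intro p _
      rw [hy, Finsupp.finsetSum_apply, Finsupp.single_finsetSum]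
      refine Finset.sum_congr rfl fun k _ => ?_
      rw [Finsupp.smul_apply, ind_apply]
      unfold sprd
      split_ifs <;> simp
    rw [Finset.sum_congr rfl e, Finset.sum_comm]
    refine Finset.sum_congr rfl fun k hk => ?_
    rw [Finset.mem_Icc] at hk
    have hk' : k ≠ j + 1 := by omega
    rw [if_neg hk', ← Finset.smul_sum]
    congr 1
    unfold ind
    rw [Finset.sum_image, ← Finset.sum_filter]
    · congr 1
      ext p
      simp only [Finset.mem_filter]
      exact ⟨fun h => h.2, fun h => ⟨hsub k hk.1 hk.2 h, h⟩⟩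
    · intro p hp q hq h
      exact sprd_inj hr1 (Finset.mem_Icc.1 (hsub k hk.1 hk.2 hp)).1
        (Finset.mem_Icc.1 (hsub k hk.1 hk.2 hq)).1 h
  · rw [if_pos rfl]
    unfold ind
    rw [Finset.smul_sum]
    refine Finset.sum_congr rfl fun t _ => ?_
    simp

lemma exists_geo {ε : ℕ → ℝ} {m : ℕ → ℕ} (G : Grow ε m) (hadm : Admissible m) {i j : ℕ}
    (hij : i ≤ j) : ∃ (A : ℕ → Finset ℕ), Geo m A i j (lst m i j).sum ∧
      (lst m i j).sum ≤ 2 * m j ∧ 1 ≤ (lst m i j).sum ∧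
      yard (lst m i j) = ∑ k ∈ Finset.Icc i j, (flog (m k) / m k) • ind (A k) := by
  induction j, hij using Nat.le_induction with
  | base =>
    refine ⟨fun _ => Finset.Icc 1 (m i), ?_, ?_, ?_, ?_⟩
    · rw [lst_self, List.sum_singleton]
      exact Geo.base m i
    · rw [lst_self, List.sum_singleton]; omega
    · rw [lst_self, List.sum_singleton]; exact G.pos i
    · rw [lst_self, yard_singleton]; simp
  | succ j hij ih =>
    obtain ⟨A, g, hM2, hM1, hy⟩ := ih
    have hdvd : (lst m i j).sum ∣ m (j + 1) := by
      rw [lst_sum m hij]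
      refine dvd_trans ?_ (hadm (j + 1)).2
      refine Finset.dvd_prod_of_mem (fun A => ∑ k ∈ A, m k) ?_
      simp only [Finset.mem_filter, Finset.mem_powerset]
      refine ⟨?_, ⟨i, by simp [hij]⟩⟩
      intro k hk
      simp only [Finset.mem_Icc, Finset.mem_range] at *
      omega
    have hp := G.pow_le j
    have hpos := G.pos j
    set ms := lst m i j with hms
    obtain ⟨r, hr⟩ := hdvd
    have hr2 : ms.sum + 2 ≤ r := by
      by_contra hcon
      have h1 : ms.sum * r ≤ ms.sum * (ms.sum + 1) := Nat.mul_le_mul_left _ (by omega)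
      have h2 : ms.sum * (ms.sum + 1) ≤ 2 * m j * (2 * m j + 1) :=
        Nat.mul_le_mul hM2 (by omega)
      have h3 : (m j + 1) ^ 4 = m j ^ 4 + 4 * m j ^ 3 + 6 * m j ^ 2 + 4 * m j + 1 := by ring
      have h4 : 2 * m j * (2 * m j + 1) = 4 * m j ^ 2 + 2 * m j := by ring
      have h5 : 0 < m j ^ 2 := by positivity
      omega
    have hsum : (lst m i (j + 1)).sum = ms.sum + m (j + 1) := by
      rw [lst_succ m hij, List.sum_cons]; ring
    have hdiv : m (j + 1) / ms.sum = r := by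
      rw [hr]; exact Nat.mul_div_cancel_left _ hM1
    refine ⟨fun k => if k = j + 1 then
        Finset.Icc 1 (ms.sum + m (j + 1)) \ (Finset.Icc 1 ms.sum).image (sprd r)
      else (A k).image (sprd r), ?_, ?_, ?_, ?_⟩
    · rw [hsum]
      exact g.step hM1 hr2 hr
    · rw [hsum]
      have h3 : (m j + 1) ^ 4 = m j ^ 4 + 4 * m j ^ 3 + 6 * m j ^ 2 + 4 * m j + 1 := by ring
      omega
    · rw [hsum]; omega
    · rw [lst_succ m hij]
      exact yard_cons m A ms r hij (by omega) hdiv g.sub hy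

end Geometry

section Final

lemma C_ge (ε : ℕ → ℝ) (hpos : ∀ i, 1 ≤ i → 0 < ε i) (hsum : Summable ε) {i : ℕ} (hi : 1 ≤ i)
    (s : Finset ℕ) : ∏ t ∈ s, (1 + ε (i + t)) ≤ ∏' t : ℕ, (1 + ε (i + t)) := by
  have hs : Summable fun t => ε (i + t) := by
    have := (summable_nat_add_iff i).2 hsum
    simpa [add_comm] using this
  have hm : Multipliable fun t => 1 + ε (i + t) := Real.multipliable_one_add_of_summable hs
  have hp : Filter.Tendsto (fun s : Finset ℕ => ∏ t ∈ s, (1 + ε (i + t))) Filter.atTop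
      (nhds (∏' t : ℕ, (1 + ε (i + t)))) := hm.hasProd
  refine ge_of_tendsto hp ?_
  filter_upwards [Filter.eventually_ge_atTop s] with s' hs'
  rw [← Finset.prod_sdiff hs']
  have h1 : ∀ u : Finset ℕ, 1 ≤ ∏ t ∈ u, (1 + ε (i + t)) := fun u => by
    have := Finset.prod_le_prod (s := u) (f := fun _ => (1 : ℝ)) (g := fun t => 1 + ε (i + t))
      (fun _ _ => zero_le_one) (fun t _ => by linarith [hpos (i + t) (by omega)])
    simpa using this
  exact le_mul_of_one_le_left (by linarith [h1 s]) (h1 _)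

/-- Fibers of monotone maps are intervals. -/
lemma fiber_interval (g : ℕ → ℕ) (hg : Monotone g) (M s : ℕ) :
    IsNatInterval ((Finset.Icc 0 M).filter fun t => g t = s) := by
  set X := (Finset.Icc 0 M).filter fun t => g t = s with hX
  rcases X.eq_empty_or_nonempty with h | h
  · exact ⟨1, 0, by rw [h]; simp⟩
  · refine ⟨X.min' h, X.max' h, ?_⟩
    have h1 := X.min'_mem h
    have h2 := X.max'_mem h
    ext t
    rw [Finset.mem_Icc]
    constructor
    · intro ht
      exact ⟨X.min'_le t ht, X.le_max' t ht⟩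
    · rintro ⟨h3, h4⟩
      have h5 := hg h3
      have h6 := hg h4
      have h1' := Finset.mem_filter.1 h1
      have h2' := Finset.mem_filter.1 h2
      rw [Finset.mem_Icc] at h1' h2'
      rw [hX, Finset.mem_filter, Finset.mem_Icc]
      refine ⟨⟨Nat.zero_le _, by omega⟩, by omega⟩

/-- A monotone map splitting a finite set into `n` successive parts of `q` elements. -/
lemma exists_split (T : Finset ℕ) (n q : ℕ) (hn : 1 ≤ n) (hq : 1 ≤ q) (hT : T.card = n * q) :
    ∃ g : ℕ → ℕ, Monotone g ∧ (∀ t, g t ∈ Finset.Icc 1 n) ∧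
      ∀ s ∈ Finset.Icc 1 n, (T.filter fun t => g t = s).card = q := by
  set c : ℕ → ℕ := fun t => (T.filter fun u => u < t).card with hc
  have hmono : Monotone c := by
    intro t t' h
    refine Finset.card_le_card ?_
    intro u hu
    rw [Finset.mem_filter] at hu ⊢
    exact ⟨hu.1, by omega⟩
  have hstrict : ∀ t ∈ T, ∀ t', t < t' → c t < c t' := by
    intro t ht t' h
    refine Finset.card_lt_card ?_
    rw [Finset.ssubset_iff_of_subset]
    · exact ⟨t, by simp [ht, h], by simp⟩
    · intro u hu
      rw [Finset.mem_filter] at hu ⊢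
      exact ⟨hu.1, by omega⟩
  have hinj : Set.InjOn c T := by
    intro t ht t' ht' h
    rcases lt_trichotomy t t' with h1 | h1 | h1
    · have := hstrict t ht t' h1; omega
    · exact h1
    · have := hstrict t' ht' t h1; omega
  have hlt : ∀ t ∈ T, c t < n * q := by
    intro t ht
    rw [← hT]
    refine Finset.card_lt_card ?_
    rw [Finset.ssubset_iff_of_subset (Finset.filter_subset _ _)]
    exact ⟨t, ht, by simp⟩
  have himg : T.image c = Finset.range (n * q) := by
    apply Finset.eq_of_subset_of_card_le
    · intro x hx
      obtain ⟨t, ht, rfl⟩ := Finset.mem_image.1 hx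
      exact Finset.mem_range.2 (hlt t ht)
    · rw [Finset.card_image_of_injOn hinj, hT, Finset.card_range]
  refine ⟨fun t => min (c t / q) (n - 1) + 1, ?_, ?_, ?_⟩
  · intro t t' h
    have := Nat.div_le_div_right (c := q) (hmono h)
    simp only
    omega
  · intro t
    rw [Finset.mem_Icc]
    beta_reduce
    exact ⟨Nat.le_add_left 1 _, by have := min_le_right (c t / q) (n - 1); omega⟩
  · intro s hs
    rw [Finset.mem_Icc] at hs
    obtain ⟨s, rfl⟩ : ∃ s', s = s' + 1 := ⟨s - 1, by omega⟩
    have hdiv : ∀ t ∈ T, c t / q ≤ n - 1 := by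
      intro t ht
      have := (Nat.div_lt_iff_lt_mul hq).2 (hlt t ht)
      omega
    have e : (T.filter fun t => min (c t / q) (n - 1) + 1 = s + 1).image c =
        Finset.Ico (s * q) ((s + 1) * q) := by
      ext x
      simp only [Finset.mem_image, Finset.mem_filter, Finset.mem_Ico]
      constructor
      · rintro ⟨t, ⟨ht, h⟩, rfl⟩
        have := hdiv t ht
        have h2 : c t / q = s := by omega
        rw [Nat.div_eq_iff (by omega)] at h2
        rw [add_mul, one_mul]
        omega
      · rintro ⟨h1, h2⟩
        have h3 : (s + 1) * q ≤ n * q := Nat.mul_le_mul_right q hs.2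
        have hx : x ∈ T.image c := by
          rw [himg, Finset.mem_range]; omega
        obtain ⟨t, ht, rfl⟩ := Finset.mem_image.1 hx
        refine ⟨t, ⟨ht, ?_⟩, rfl⟩
        have h4 : c t / q = s := by
          rw [Nat.div_eq_iff (by omega)]
          rw [add_mul, one_mul] at h2
          omega
        omega
    rw [← Finset.card_image_of_injOn (f := c), e, Nat.card_Ico, add_mul]
    · omega
    · exact hinj.mono (by intro t ht; exact (Finset.mem_filter.1 ht).1)

lemma grow_of (ε : ℕ → ℝ) (hεpos : ∀ i, 1 ≤ i → 0 < ε i ∧ ε i < (flog 2 - 1) / flog 2)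
    (C : ℕ → ℝ) (hC1 : ∀ i, 1 ≤ i → 1 ≤ C i)
    (m : ℕ → ℕ) (hadm : Admissible m) (X : ℝ)
    (hgrowth1 : ∀ i, 1 ≤ i → C i * max (50 / ε i ^ 2) X ≤ flog (m i))
    (hgrowth2 : ∀ i, 1 ≤ i → flog (m i) / flog (m i / m (i - 1)) ≤ 1 + ε i / 6) :
    Grow ε m := by
  have hbig : ∀ k, 1 ≤ k → 50 / ε k ^ 2 ≤ flog (m k) := by
    intro k hk
    have h1 := hgrowth1 k hk
    have h2 := hC1 k hk
    have h3 := (hεpos k hk).1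
    have h4 : 0 < 50 / ε k ^ 2 := by positivity
    have h5 := le_max_left (50 / ε k ^ 2) X
    nlinarith
  have hdvd : ∀ k, m k ∣ m (k + 1) := by
    intro k
    refine dvd_trans ?_ (hadm (k + 1)).2
    have := Finset.dvd_prod_of_mem (fun A => ∑ k ∈ A, m k)
      (show ({k} : Finset ℕ) ∈ (Finset.range (k + 1)).powerset.filter Finset.Nonempty by simp)
    simpa using this
  have hpos1 : ∀ k, 1 ≤ k → 1 ≤ m k := by
    intro k hk
    by_contra hcon
    have h0 : m k = 0 := by omega
    have h1 := hbig k hk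
    have h3 := (hεpos k hk).1
    have h4 : 0 < 50 / ε k ^ 2 := by positivity
    rw [h0] at h1
    simp [flog_zero] at h1
    linarith
  have hpos : ∀ k, 1 ≤ m k := by
    intro k
    rcases Nat.eq_zero_or_pos k with rfl | hk
    · exact Nat.pos_of_dvd_of_pos (hdvd 0) (hpos1 1 le_rfl)
    · exact hpos1 k hk
  refine ⟨?_, ?_, ?_, hpos, hdvd⟩
  · intro k hk
    obtain ⟨h1, h2⟩ := hεpos k hk
    refine ⟨h1, h2.le.trans ?_⟩
    have h3 := flog_two_ge
    have h4 := flog_two_le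
    rw [div_le_iff₀ (by linarith)]
    linarith
  · intro k hk
    have h3 := (hεpos k hk).1
    have := hbig k hk
    rw [div_le_iff₀ (by positivity)] at this
    linarith
  · intro k
    have h := hgrowth2 (k + 1) (by omega)
    simp only [Nat.add_sub_cancel] at h
    have h1 : (1 : ℝ) ≤ m k := by exact_mod_cast hpos k
    have h2 : (1 : ℝ) ≤ m (k + 1) := by exact_mod_cast hpos (k + 1)
    have h3 : 0 < flog ((m (k + 1) : ℝ) / m k) := flog_pos (by positivity)
    rwa [div_le_iff₀ h3] at h

end Final

lemma level_value {m : ℕ → ℕ} {A : ℕ → Finset ℕ} {i j : ℕ} (S : Sys m A i j) (hij : i ≤ j)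
    {t : ℕ} (ht : t ∈ A i) :
    (∑ k ∈ Finset.Icc i j, (flog (m k) / m k) • ind (A k)) t = flog (m i) / m i := by
  rw [Finsupp.finsetSum_apply, Finset.sum_eq_single_of_mem i (by simp [hij])]
  · simp [ind_apply, ht]
  · intro k hk hne
    rw [Finset.mem_Icc] at hk
    have : t ∉ A k := fun h =>
      Finset.disjoint_left.1 (S.disj i k le_rfl (by omega) hk.2) ht h
    simp [ind_apply, this]

lemma l1_average {NS : (ℕ →₀ ℝ) → ℝ} (hNS : IsSNorm NS) {n q M : ℕ} (hn : 1 ≤ n) (hq : 1 ≤ q)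
    {T : Finset ℕ} (hT : T.card = n * q) (hT2 : 2 ≤ T.card) (hTM : T ⊆ Finset.Icc 0 M)
    {C : ℝ} (hC : 1 ≤ C) {y : ℕ →₀ ℝ} (hyM : ∀ t, t ∉ Finset.Icc 0 M → y t = 0)
    (hyT : ∀ t ∈ T, y t = flog T.card / T.card)
    (hb : ∀ E, IsNatInterval E → E ⊆ Finset.Icc 0 M → (E ∩ T).card = q →
      NS (restrictF E y) ≤ C / n) :
    IsL1Average NS n (1 / C) ((1 / C) • y) := by
  obtain ⟨g, hg, hgn, hgc⟩ := exists_split T n q hn hq hT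
  have hn0 : (1 : ℝ) ≤ n := by exact_mod_cast hn
  have hT0 : (2 : ℝ) ≤ T.card := by exact_mod_cast hT2
  have hF : 0 < flog T.card := flog_pos (by linarith)
  set E : ℕ → Finset ℕ := fun s => (Finset.Icc 0 M).filter fun t => g t = s with hE
  have hxs : ∀ s t, (((n : ℝ) / C) • restrictF (E s) y) t = if g t = s then n / C * y t else 0 := by
    intro s t
    rw [Finsupp.smul_apply, restrictF_apply, smul_eq_mul]
    by_cases h : g t = s
    · rw [if_pos h]
      by_cases h2 : t ∈ Finset.Icc 0 M
      · rw [if_pos (by rw [hE]; exact Finset.mem_filter.2 ⟨h2, h⟩)]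
      · rw [hyM t h2]; simp
    · rw [if_neg h, if_neg]
      · simp
      · intro h2
        exact h (Finset.mem_filter.1 h2).2
  refine ⟨fun s => ((n : ℝ) / C) • restrictF (E s) y, ?_, ?_, ?_, ?_⟩
  · intro s hs
    have hET : E s ∩ T = T.filter fun t => g t = s := by
      ext t
      simp only [hE, Finset.mem_inter, Finset.mem_filter]
      exact ⟨fun h => ⟨h.2, h.1.2⟩, fun h => ⟨⟨hTM h.1, h.2⟩, h.1⟩⟩
    have hcard : (E s ∩ T).card = q := by rw [hET]; exact hgc s hs
    constructor
    · rw [hNS.smul, abs_of_nonneg (by positivity)]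
      have h1 := hb (E s) (fiber_interval g hg M s) (Finset.filter_subset _ _) hcard
      calc (n : ℝ) / C * NS (restrictF (E s) y) ≤ n / C * (C / n) :=
            mul_le_mul_of_nonneg_left h1 (by positivity)
        _ = 1 := by field_simp
    · intro h0
      have hne : (T.filter fun t => g t = s).Nonempty := by
        rw [← Finset.card_pos, hgc s hs]; omega
      obtain ⟨t, ht⟩ := hne
      rw [Finset.mem_filter] at ht
      have h1 := hxs s t
      have h0' : ((n : ℝ) / C) • restrictF (E s) y = 0 := h0
      rw [h0', if_pos ht.2, hyT t ht.1] at h1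
      have : 0 < (n : ℝ) / C * (flog T.card / T.card) := by positivity
      simp only [Finsupp.zero_apply] at h1
      linarith
  · intro s hs s' hs' hss t ht t' ht'
    rw [Finsupp.mem_support_iff] at ht ht'
    simp only [hxs] at ht ht'
    by_contra hcon
    have h1 : g t = s := by
      by_contra h; exact ht (if_neg h)
    have h2 : g t' = s' := by
      by_contra h; exact ht' (if_neg h)
    have := hg (not_lt.1 hcon)
    omega
  · ext t
    rw [Finsupp.smul_apply, Finsupp.smul_apply, Finsupp.finsetSum_apply]
    simp only [hxs]
    rw [Finset.sum_ite_eq, if_pos (hgn t)]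
    simp only [smul_eq_mul]
    field_simp
  · intro a
    refine le_trans ?_ (NS_coord_lower hNS _ T hT2)
    have hval : ∀ t ∈ T, |(∑ s ∈ Finset.Icc 1 n, a s • (((n : ℝ) / C) • restrictF (E s) y)) t| =
        |a (g t)| * (n / C * (flog T.card / T.card)) := by
      intro t ht
      rw [Finsupp.finsetSum_apply, Finset.sum_eq_single_of_mem (g t) (hgn t)]
      · rw [Finsupp.smul_apply, hxs, if_pos rfl, hyT t ht, smul_eq_mul, abs_mul]
        congr 1
        exact abs_of_nonneg (by positivity)
      · intro s _ hs
        rw [Finsupp.smul_apply, hxs, if_neg (Ne.symm hs), smul_zero]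
    rw [Finset.sum_congr rfl hval, ← Finset.sum_mul,
      ← Finset.sum_fiberwise_of_maps_to (s := T) (fun t _ => hgn t)]
    have h2 : ∀ s ∈ Finset.Icc 1 n, ∑ t ∈ T with g t = s, |a (g t)| = q * |a s| := by
      intro s hs
      rw [← hgc s hs, ← nsmul_eq_mul, ← Finset.sum_const]
      refine Finset.sum_congr rfl fun t ht => ?_
      rw [(Finset.mem_filter.1 ht).2]
    rw [Finset.sum_congr rfl h2, ← Finset.mul_sum]
    have hTR : (T.card : ℝ) = n * q := by exact_mod_cast hT
    have hq0 : (1 : ℝ) ≤ q := by exact_mod_cast hq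
    apply le_of_eq
    have hC0 : C ≠ 0 := by positivity
    set F := flog T.card
    rw [hTR]
    field_simp

theorem yardstick_norm_le_and_l1_average (NS : (ℕ →₀ ℝ) → ℝ) (hNS : IsSNorm NS)
    (ε : ℕ → ℝ) (hεpos : ∀ i, 1 ≤ i → 0 < ε i ∧ ε i < (flog 2 - 1) / flog 2)
    (hsum : Summable ε)
    (C : ℕ → ℝ) (hC : ∀ i, C i = ∏' t : ℕ, (1 + ε (i + t)))
    (m : ℕ → ℕ) (hadm : Admissible m)
    (l₀ : ℕ) (hl₀ : 6 ≤ flog l₀ ∧ ∀ l : ℕ, l < l₀ → flog l < 6)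
    (hgrowth1 : ∀ i, 1 ≤ i →
      C i * max (50 / ε i ^ 2)
        (flog l₀ * flog (l₀ - 1) / (flog l₀ - flog (l₀ - 1))) ≤ flog (m i))
    (hgrowth2 : ∀ i, 1 ≤ i → flog (m i) / flog (m i / m (i - 1)) ≤ 1 + ε i / 6) :
    ∀ i j : ℕ, 1 ≤ i → i ≤ j →
      NS (yardstick m i j) ≤ C i ∧
      IsL1Average NS (m (i - 1)) (1 / C i) ((1 / C i) • yardstick m i j) := by
  have hp : ∀ i, 1 ≤ i → 0 < ε i := fun i hi => (hεpos i hi).1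
  have hC1 : ∀ i, 1 ≤ i → 1 ≤ C i := by
    intro i hi
    have := C_ge ε hp hsum hi ∅
    rw [hC]
    simpa using this
  have G : Grow ε m := grow_of ε hεpos C hC1 m hadm _ hgrowth1 hgrowth2
  intro i j hi hij
  have hCi : 1 + ε i ≤ C i := by
    have := C_ge ε hp hsum hi {0}
    rw [hC]
    simpa using this
  have hCk : ∀ k, i < k → (1 + ε i) * (1 + ε k) ≤ C i := by
    intro k hk
    have := C_ge ε hp hsum hi {0, k - i}
    rw [Finset.prod_pair (by omega)] at this
    rw [hC]
    have e : i + (k - i) = k := by omega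
    rwa [add_zero, e] at this
  obtain ⟨A, g, -, hM1, hy⟩ := exists_geo G hadm hij
  set M := (lst m i j).sum with hM
  have hyy : yardstick m i j = ∑ k ∈ Finset.Icc i j, (flog (m k) / m k) • ind (A k) := hy
  have hsubM : ∀ k, i ≤ k → k ≤ j → A k ⊆ Finset.Icc 0 M := fun k h1 h2 =>
    (g.sub k h1 h2).trans (Finset.Icc_subset_Icc_left (by omega))
  have hres : ∀ E, restrictF E (yardstick m i j) = WW m A j E i := by
    intro E
    rw [hyy, restrictF_sum]
    unfold WW
    refine Finset.sum_congr rfl fun k _ => ?_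
    rw [restrictF_smul, restrictF_ind]
  have hy0 : yardstick m i j = WW m A j (Finset.Icc 0 M) i := by
    rw [hyy]
    unfold WW
    refine Finset.sum_congr rfl fun k hk => ?_
    rw [Finset.mem_Icc] at hk
    rw [Finset.inter_eq_right.2 (hsubM k hk.1 hk.2)]
  have hcard := g.sys.card i le_rfl hij
  obtain ⟨q, hq⟩ : m (i - 1) ∣ m i := by
    have := G.dvd (i - 1)
    rwa [Nat.sub_add_cancel hi] at this
  have hmi := G.pos i
  have hq1 : 1 ≤ q := by
    rcases Nat.eq_zero_or_pos q with h | h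
    · rw [h, mul_zero] at hq; omega
    · exact h
  have hn := G.pos (i - 1)
  have hnR := G.posR (i - 1)
  constructor
  · rw [hy0]
    have := sharp hNS G hi g.sys hij (E := Finset.Icc 0 M) ⟨0, M, rfl⟩ (N := 1) le_rfl hnR
      (by unfold bc; rw [Finset.inter_eq_right.2 (hsubM i le_rfl hij), hcard, div_one])
      hCi hCk
    simpa using this
  · refine l1_average hNS (T := A i) (M := M) hn hq1 (hcard.trans hq) ?_ (hsubM i le_rfl hij)
      (hC1 i hi) ?_ ?_ ?_
    · rw [hcard]
      exact Nat.le_of_dvd hmi (hadm i).1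
    · intro t ht
      rw [hy0]
      have h := restrictF_apply (Finset.Icc 0 M) (yardstick m i j) t
      rw [hres, if_neg ht] at h
      exact h
    · intro t ht
      rw [hyy, level_value g.sys hij ht, hcard]
    · intro E hE _ hEq
      rw [hres]
      refine sharp hNS G hi g.sys hij hE hnR le_rfl ?_ hCi hCk
      unfold bc
      rw [hEq, hq]
      push_cast
      field_simp
end
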